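/- Let N be a continuous nest on a separable infinite-dimensional complex Hilbert space, and let I₁ and I₂ be stable ideals of Alg N which are the kernels of stable nets O₁ and O₂ respectively. For P₁ ∈ O₁ and P₂ ∈ O₂ define P₁·P₂ := {E₁E₂ : E₁ ∈ P₁, E₂ ∈ P₂} (products of interval projections), and define O₁·O₂ := {P₁·P₂ : P₁ ∈ O₁, P₂ ∈ O₂}. Then O₁·O₂ is a stable net, and the algebraic sum I₁ + I₂ equals {X ∈ Alg N : lim_{P∈O₁·O₂} sup_{E∈P} ‖EXE‖_e = 0}. -/

import Mathlib

open Set Filter Topology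

noncomputable def essNorm {H : Type*} [NormedAddCommGroup H] [InnerProductSpace ℂ H]
    [CompleteSpace H] (T : H →L[ℂ] H) : ℝ :=
  Metric.infDist T {K : H →L[ℂ] H | IsCompactOperator ⇑K}

/-- A continuous nest on `H`, parameterized by `[0,1]`: an increasing family of orthogonal
projections `N t` whose ranges strictly increase, with `N 0 = 0`, `N 1 = 1`, and
`t ↦ N t ξ` norm-continuous on `[0,1]` for every `ξ`. -/
structure ContinuousNest (H : Type*) [NormedAddCommGroup H] [InnerProductSpace ℂ H]
    [CompleteSpace H] where
  N : ℝ → H →L[ℂ] H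
  idem : ∀ t ∈ Icc (0 : ℝ) 1, IsIdempotentElem (N t)
  selfAdjoint : ∀ t ∈ Icc (0 : ℝ) 1, IsSelfAdjoint (N t)
  range_lt : ∀ s t : ℝ, s ∈ Icc (0 : ℝ) 1 → t ∈ Icc (0 : ℝ) 1 → s < t →
    LinearMap.range (N s).toLinearMap < LinearMap.range (N t).toLinearMap
  N_zero : N 0 = 0
  N_one : N 1 = 1
  contOn : ∀ ξ : H, ContinuousOn (fun t => N t ξ) (Icc (0 : ℝ) 1)

variable {H : Type*} [NormedAddCommGroup H] [InnerProductSpace ℂ H] [CompleteSpace H]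

/-- `P₁` refines `P₂`: every interval of `P₁` is dominated by an interval of `P₂`
(in the Loewner order). -/
def OpRefines (P₁ P₂ : Set (H →L[ℂ] H)) : Prop :=
  ∀ E ∈ P₁, ∃ F ∈ P₂, ContinuousLinearMap.IsPositive (F - E)

namespace ContinuousNest

variable (𝒩 : ContinuousNest H)

/-- The nest algebra of `𝒩`. -/
def alg : Set (H →L[ℂ] H) := {T | ∀ t ∈ Icc (0 : ℝ) 1, (1 - 𝒩.N t) * T * 𝒩.N t = 0}

/-- An interval of the nest: a difference `N t - N s` with `0 ≤ s ≤ t ≤ 1`. -/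
def IsInterval (E : H →L[ℂ] H) : Prop :=
  ∃ s t : ℝ, 0 ≤ s ∧ s ≤ t ∧ t ≤ 1 ∧ E = 𝒩.N t - 𝒩.N s

def IsIntervalFamily (P : Set (H →L[ℂ] H)) : Prop := ∀ E ∈ P, 𝒩.IsInterval E

/-- A net of families of intervals: directed under refinement. -/
def IsNet (O : Set (Set (H →L[ℂ] H))) : Prop :=
  (∀ P ∈ O, 𝒩.IsIntervalFamily P) ∧
  ∀ P ∈ O, ∀ Q ∈ O, ∃ R ∈ O, OpRefines R P ∧ OpRefines R Q

def nestSet : Set (H →L[ℂ] H) := 𝒩.N '' Icc (0 : ℝ) 1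

/-- An order automorphism of the nest: an order-preserving bijection of `{N t : t ∈ [0,1]}`
onto itself. -/
def IsAuto (θ : (H →L[ℂ] H) → H →L[ℂ] H) : Prop :=
  Set.BijOn θ 𝒩.nestSet 𝒩.nestSet ∧
  ∀ s t : ℝ, s ∈ Icc (0 : ℝ) 1 → t ∈ Icc (0 : ℝ) 1 → s ≤ t →
    ContinuousLinearMap.IsPositive (θ (𝒩.N t) - θ (𝒩.N s))

/-- The image family `θ(P) = {θ(N t) - θ(N s) : N t - N s ∈ P}`. -/
def autoImage (θ : (H →L[ℂ] H) → H →L[ℂ] H) (P : Set (H →L[ℂ] H)) : Set (H →L[ℂ] H) :=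
  {E | ∃ s t : ℝ, 0 ≤ s ∧ s ≤ t ∧ t ≤ 1 ∧ 𝒩.N t - 𝒩.N s ∈ P ∧ E = θ (𝒩.N t) - θ (𝒩.N s)}

/-- A stable net of intervals. -/
def IsStableNet (O : Set (Set (H →L[ℂ] H))) : Prop :=
  𝒩.IsNet O ∧ ∀ θ, 𝒩.IsAuto θ → ∀ P ∈ O, 𝒩.autoImage θ P ∈ O

/-- The kernel of a net `O`: those `X` in the nest algebra with
`lim_{P ∈ O} sup_{E ∈ P} ‖EXE‖ₑ = 0`; since the sup decreases under refinement, this limit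
is `0` iff for every `ε > 0` some `P ∈ O` has all `‖EXE‖ₑ < ε`. -/
def kernel (O : Set (Set (H →L[ℂ] H))) : Set (H →L[ℂ] H) :=
  {X | X ∈ 𝒩.alg ∧ ∀ ε : ℝ, 0 < ε → ∃ P ∈ O, ∀ E ∈ P, essNorm (E * X * E) < ε}

/-- A two-sided ideal of the nest algebra. -/
def IsIdeal (I : Set (H →L[ℂ] H)) : Prop :=
  I ⊆ 𝒩.alg ∧ (0 : H →L[ℂ] H) ∈ I ∧
  (∀ X ∈ I, ∀ Y ∈ I, X + Y ∈ I) ∧ (∀ X ∈ I, -X ∈ I) ∧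
  ∀ A ∈ 𝒩.alg, ∀ X ∈ I, A * X ∈ I ∧ X * A ∈ I

/-- A stable ideal: a norm-closed two-sided ideal invariant under every automorphism
`T ↦ S T S⁻¹` of the nest algebra implemented by an invertible `S ∈ B(H)`. -/
def IsStableIdeal (I : Set (H →L[ℂ] H)) : Prop :=
  𝒩.IsIdeal I ∧ IsClosed I ∧
  ∀ S : (H →L[ℂ] H)ˣ,
    (fun T => (↑S : H →L[ℂ] H) * T * (↑S⁻¹ : H →L[ℂ] H)) '' 𝒩.alg = 𝒩.alg →
    (fun T => (↑S : H →L[ℂ] H) * T * (↑S⁻¹ : H →L[ℂ] H)) '' I = I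

end ContinuousNest

/-- The family of pairwise products `{E₁E₂ : E₁ ∈ P₁, E₂ ∈ P₂}`. -/
def prodFam {H : Type*} [NormedAddCommGroup H] [InnerProductSpace ℂ H] [CompleteSpace H]
    (P₁ P₂ : Set (H →L[ℂ] H)) : Set (H →L[ℂ] H) :=
  {E | ∃ E₁ ∈ P₁, ∃ E₂ ∈ P₂, E = E₁ * E₂}


open Set Filter Topology

namespace ContinuousNest

variable {H : Type*} [NormedAddCommGroup H] [InnerProductSpace ℂ H] [CompleteSpace H]
variable (𝒩 : ContinuousNest H)

theorem N_mul_left {s t : ℝ} (hs : s ∈ Icc (0 : ℝ) 1) (ht : t ∈ Icc (0 : ℝ) 1) (h : s ≤ t) :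
    𝒩.N t * 𝒩.N s = 𝒩.N s := by
  rcases h.eq_or_lt with rfl | h
  · exact 𝒩.idem s hs
  · ext v
    have h1 := (𝒩.range_lt s t hs ht h).le
    have h2 : 𝒩.N s v ∈ LinearMap.range (𝒩.N t).toLinearMap := h1 ⟨v, rfl⟩
    obtain ⟨w, hw⟩ := h2
    have h3 : 𝒩.N t (𝒩.N t w) = 𝒩.N t w := by
      have := 𝒩.idem t ht
      exact congrArg (fun T : H →L[ℂ] H => T w) this
    have hw' : 𝒩.N t w = 𝒩.N s v := hw
    change 𝒩.N t (𝒩.N s v) = 𝒩.N s v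
    rw [← hw', h3]

theorem N_mul_right {s t : ℝ} (hs : s ∈ Icc (0 : ℝ) 1) (ht : t ∈ Icc (0 : ℝ) 1) (h : s ≤ t) :
    𝒩.N s * 𝒩.N t = 𝒩.N s := by
  have := congrArg star (𝒩.N_mul_left hs ht h)
  rwa [star_mul, (𝒩.selfAdjoint s hs).star_eq, (𝒩.selfAdjoint t ht).star_eq] at this

theorem N_inj {s t : ℝ} (hs : s ∈ Icc (0 : ℝ) 1) (ht : t ∈ Icc (0 : ℝ) 1)
    (h : 𝒩.N s = 𝒩.N t) : s = t := by
  rcases lt_trichotomy s t with h1 | h1 | h1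
  · have := 𝒩.range_lt s t hs ht h1
    rw [h] at this
    exact absurd this (lt_irrefl _)
  · exact h1
  · have := 𝒩.range_lt t s ht hs h1
    rw [h] at this
    exact absurd this (lt_irrefl _)

/-- clamp to the unit interval -/
noncomputable def clamp (t : ℝ) : ℝ := max 0 (min 1 t)

theorem clamp_mem (t : ℝ) : clamp t ∈ Icc (0 : ℝ) 1 := by
  unfold clamp
  constructor
  · exact le_max_left _ _
  · exact max_le zero_le_one (min_le_left _ _)

theorem clamp_of_mem {t : ℝ} (h : t ∈ Icc (0 : ℝ) 1) : clamp t = t := by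
  unfold clamp
  rw [min_eq_right h.2, max_eq_right h.1]

theorem clamp_mono : Monotone clamp := by
  intro s t h
  exact max_le_max le_rfl (min_le_min le_rfl h)

theorem clamp_min (s t : ℝ) : clamp (min s t) = min (clamp s) (clamp t) := clamp_mono.map_min

theorem clamp_continuous : Continuous clamp := by
  unfold clamp
  fun_prop

noncomputable def pr (t : ℝ) : H →L[ℂ] H := 𝒩.N (clamp t)

noncomputable def co (t : ℝ) : H →L[ℂ] H := 1 - 𝒩.pr t

theorem pr_of_mem {t : ℝ} (h : t ∈ Icc (0 : ℝ) 1) : 𝒩.pr t = 𝒩.N t := by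
  rw [pr, clamp_of_mem h]

theorem pr_mul_pr (s t : ℝ) : 𝒩.pr s * 𝒩.pr t = 𝒩.pr (min s t) := by
  unfold pr
  rw [clamp_min]
  rcases le_total (clamp s) (clamp t) with h | h
  · rw [min_eq_left h]
    exact 𝒩.N_mul_right (clamp_mem _) (clamp_mem _) h
  · rw [min_eq_right h]
    exact 𝒩.N_mul_left (clamp_mem _) (clamp_mem _) h

theorem pr_sa (t : ℝ) : IsSelfAdjoint (𝒩.pr t) := 𝒩.selfAdjoint _ (clamp_mem _)

theorem pr_star (t : ℝ) : star (𝒩.pr t) = 𝒩.pr t := (𝒩.pr_sa t).star_eq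

theorem pr_proj (t : ℝ) : IsStarProjection (𝒩.pr t) :=
  ⟨𝒩.idem _ (clamp_mem _), 𝒩.pr_sa t⟩

theorem co_proj (t : ℝ) : IsStarProjection (𝒩.co t) := (𝒩.pr_proj t).one_sub

theorem co_star (t : ℝ) : star (𝒩.co t) = 𝒩.co t := (𝒩.co_proj t).isSelfAdjoint.star_eq

theorem proj_norm_le {p : H →L[ℂ] H} (hp : IsStarProjection p) : ‖p‖ ≤ 1 := by
  exact hp.norm_le

theorem pr_norm (t : ℝ) : ‖𝒩.pr t‖ ≤ 1 := proj_norm_le (𝒩.pr_proj t)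
theorem co_norm (t : ℝ) : ‖𝒩.co t‖ ≤ 1 := proj_norm_le (𝒩.co_proj t)

theorem pr_idem (t : ℝ) : 𝒩.pr t * 𝒩.pr t = 𝒩.pr t := (𝒩.pr_proj t).isIdempotentElem
theorem co_idem (t : ℝ) : 𝒩.co t * 𝒩.co t = 𝒩.co t := (𝒩.co_proj t).isIdempotentElem

theorem co_mul_co (s t : ℝ) : 𝒩.co s * 𝒩.co t = 𝒩.co (max s t) := by
  unfold co
  have h := 𝒩.pr_mul_pr s t
  rcases le_total s t with h1 | h1
  · rw [min_eq_left h1] at h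
    rw [max_eq_right h1]
    noncomm_ring
    rw [h]; abel
  · rw [min_eq_right h1] at h
    rw [max_eq_left h1]
    noncomm_ring
    rw [h]; abel

theorem pr_comm_co (s t : ℝ) : 𝒩.pr s * 𝒩.co t = 𝒩.co t * 𝒩.pr s := by
  unfold co
  have h := 𝒩.pr_mul_pr s t
  have h' := 𝒩.pr_mul_pr t s
  rw [min_comm] at h'
  rw [mul_sub, sub_mul, h, h', mul_one, one_mul]

theorem pr_comm_pr (s t : ℝ) : 𝒩.pr s * 𝒩.pr t = 𝒩.pr t * 𝒩.pr s := by
  rw [pr_mul_pr, pr_mul_pr, min_comm]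

theorem co_comm_co (s t : ℝ) : 𝒩.co s * 𝒩.co t = 𝒩.co t * 𝒩.co s := by
  rw [co_mul_co, co_mul_co, max_comm]

theorem co_mul_pr_of_le {s t : ℝ} (h : t ≤ s) : 𝒩.co s * 𝒩.pr t = 0 := by
  unfold co
  rw [sub_mul, pr_mul_pr, min_eq_right h, one_mul, sub_self]

theorem pr_zero : 𝒩.pr 0 = 0 := by
  rw [pr_of_mem 𝒩 (by simp), 𝒩.N_zero]
theorem pr_one : 𝒩.pr 1 = 1 := by
  rw [pr_of_mem 𝒩 (by simp), 𝒩.N_one]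
theorem co_zero : 𝒩.co 0 = 1 := by rw [co, pr_zero, sub_zero]
theorem co_one : 𝒩.co 1 = 0 := by rw [co, pr_one, sub_self]

theorem pr_cont (v : H) : Continuous (fun t => 𝒩.pr t v) := by
  have := (𝒩.contOn v).comp_continuous clamp_continuous clamp_mem
  exact this

theorem mem_alg {T : H →L[ℂ] H} : T ∈ 𝒩.alg ↔ ∀ t, 𝒩.co t * T * 𝒩.pr t = 0 := by
  constructor
  · intro h t
    exact h _ (clamp_mem t)
  · intro h t ht
    have := h t
    rwa [co, pr_of_mem 𝒩 ht] at this

variable {𝒩}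

theorem alg_pr {T : H →L[ℂ] H} (h : T ∈ 𝒩.alg) (t : ℝ) : 𝒩.pr t * T * 𝒩.pr t = T * 𝒩.pr t := by
  have := 𝒩.mem_alg.1 h t
  rw [co, sub_mul, sub_mul, one_mul, sub_eq_zero] at this
  exact this.symm

theorem alg_co {T : H →L[ℂ] H} (h : T ∈ 𝒩.alg) (t : ℝ) : 𝒩.co t * T * 𝒩.co t = 𝒩.co t * T := by
  have := 𝒩.mem_alg.1 h t
  conv_lhs => rhs; rw [co]
  rw [mul_sub, this, mul_one, sub_zero]

theorem alg_zero_of_le {T : H →L[ℂ] H} (h : T ∈ 𝒩.alg) {s t : ℝ} (hst : t ≤ s) :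
    𝒩.co s * T * 𝒩.pr t = 0 := by
  have h1 : 𝒩.co s = 𝒩.co s * 𝒩.co t := by rw [co_mul_co, max_eq_left hst]
  rw [h1, mul_assoc, mul_assoc, ← mul_assoc (𝒩.co t), 𝒩.mem_alg.1 h t, mul_zero]

theorem alg_add {S T : H →L[ℂ] H} (hS : S ∈ 𝒩.alg) (hT : T ∈ 𝒩.alg) : S + T ∈ 𝒩.alg := by
  rw [mem_alg] at *
  intro t
  rw [mul_add, add_mul, hS, hT, add_zero]

theorem alg_neg {S : H →L[ℂ] H} (hS : S ∈ 𝒩.alg) : -S ∈ 𝒩.alg := by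
  rw [mem_alg] at *
  intro t
  rw [mul_neg, neg_mul, hS, neg_zero]

theorem alg_sub {S T : H →L[ℂ] H} (hS : S ∈ 𝒩.alg) (hT : T ∈ 𝒩.alg) : S - T ∈ 𝒩.alg := by
  rw [sub_eq_add_neg]; exact alg_add hS (alg_neg hT)

theorem alg_zero : (0 : H →L[ℂ] H) ∈ 𝒩.alg := by
  rw [mem_alg]; intro t; simp

theorem alg_one : (1 : H →L[ℂ] H) ∈ 𝒩.alg := by
  rw [mem_alg]; intro t; rw [mul_one, co_mul_pr_of_le 𝒩 le_rfl]

theorem alg_mul {S T : H →L[ℂ] H} (hS : S ∈ 𝒩.alg) (hT : T ∈ 𝒩.alg) : S * T ∈ 𝒩.alg := by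
  rw [mem_alg]
  intro t
  rw [← mul_assoc, ← alg_co hS t, mul_assoc, mul_assoc, ← mul_assoc (𝒩.co t) T,
    𝒩.mem_alg.1 hT t, mul_zero]

theorem alg_pr_mem (s : ℝ) : 𝒩.pr s ∈ 𝒩.alg := by
  rw [mem_alg]
  intro t
  rw [mul_assoc, pr_comm_pr, ← mul_assoc, co_mul_pr_of_le 𝒩 le_rfl, zero_mul]

theorem alg_co_mem (s : ℝ) : 𝒩.co s ∈ 𝒩.alg := alg_sub alg_one (alg_pr_mem s)

theorem alg_sum {ι : Type*} (s : Finset ι) (f : ι → H →L[ℂ] H) (h : ∀ i ∈ s, f i ∈ 𝒩.alg) :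
    ∑ i ∈ s, f i ∈ 𝒩.alg := by
  classical
  induction s using Finset.induction_on with
  | empty => simpa using alg_zero
  | insert a s ha ih =>
    rw [Finset.sum_insert ha]
    exact alg_add (h a (by simp)) (ih fun i hi => h i (by simp [hi]))

/-- weak membership criterion -/
theorem alg_iff_inner {T : H →L[ℂ] H} :
    T ∈ 𝒩.alg ↔ ∀ t v w, inner ℂ (𝒩.co t w) (T (𝒩.pr t v)) = 0 := by
  rw [mem_alg]
  constructor
  · intro h t v w
    have h1 : inner ℂ (𝒩.co t w) (T (𝒩.pr t v)) = inner ℂ w (𝒩.co t (T (𝒩.pr t v))) := by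
      conv_lhs => rw [← co_star]
      exact ContinuousLinearMap.adjoint_inner_left _ _ _
    rw [h1]
    have : 𝒩.co t (T (𝒩.pr t v)) = 0 := congrArg (fun A : H →L[ℂ] H => A v) (h t)
    rw [this, inner_zero_right]
  · intro h t
    ext v
    have h1 : ∀ w, inner ℂ w (𝒩.co t (T (𝒩.pr t v))) = 0 := by
      intro w
      rw [← h t v w]
      conv_rhs => rw [← co_star]
      exact (ContinuousLinearMap.adjoint_inner_left _ _ _).symm
    exact inner_self_eq_zero.1 (h1 _)

theorem alg_isClosed : IsClosed (𝒩.alg) := by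
  have : 𝒩.alg = ⋂ t, {T | 𝒩.co t * T * 𝒩.pr t = 0} := by
    ext T; rw [mem_alg]; simp
  rw [this]
  refine isClosed_iInter fun t => isClosed_eq (by fun_prop) continuous_const

theorem alg_compress {T : H →L[ℂ] H} (h : T ∈ 𝒩.alg) (x y : ℝ) : 𝒩.co x * T * 𝒩.pr y ∈ 𝒩.alg :=
  alg_mul (alg_mul (alg_co_mem x) h) (alg_pr_mem y)

end ContinuousNest

open Set Filter Topology

section Ess
variable {H : Type*} [NormedAddCommGroup H] [InnerProductSpace ℂ H] [CompleteSpace H]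

theorem essNorm_lt_iff {T : H →L[ℂ] H} {ε : ℝ} :
    essNorm T < ε ↔ ∃ K : H →L[ℂ] H, IsCompactOperator ⇑K ∧ ‖T - K‖ < ε := by
  unfold essNorm
  rw [Metric.infDist_lt_iff ⟨0, isCompactOperator_zero⟩]
  simp [dist_eq_norm]

theorem cpt_mul_left {K : H →L[ℂ] H} (A : H →L[ℂ] H) (h : IsCompactOperator ⇑K) :
    IsCompactOperator ⇑(A * K) := h.clm_comp A

theorem cpt_mul_right {K : H →L[ℂ] H} (h : IsCompactOperator ⇑K) (A : H →L[ℂ] H) :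
    IsCompactOperator ⇑(K * A) := h.comp_clm A

theorem cpt_zero : IsCompactOperator ⇑(0 : H →L[ℂ] H) := isCompactOperator_zero

theorem cpt_add {K L : H →L[ℂ] H} (h : IsCompactOperator ⇑K) (h' : IsCompactOperator ⇑L) :
    IsCompactOperator ⇑(K + L) := h.add h'

theorem cpt_sub {K L : H →L[ℂ] H} (h : IsCompactOperator ⇑K) (h' : IsCompactOperator ⇑L) :
    IsCompactOperator ⇑(K - L) := h.sub h'

theorem cpt_neg {K : H →L[ℂ] H} (h : IsCompactOperator ⇑K) :
    IsCompactOperator ⇑(-K) := h.neg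

theorem cpt_sum {ι : Type*} (s : Finset ι) (f : ι → H →L[ℂ] H)
    (h : ∀ i ∈ s, IsCompactOperator ⇑(f i)) : IsCompactOperator ⇑(∑ i ∈ s, f i) := by
  classical
  induction s using Finset.induction_on with
  | empty => simpa using cpt_zero
  | insert a s ha ih =>
    rw [Finset.sum_insert ha]
    exact cpt_add (h a (by simp)) (ih fun i hi => h i (by simp [hi]))

theorem cpt_tsum {ι : Type*} {f : ι → H →L[ℂ] H} {V : H →L[ℂ] H}
    (h : ∀ i, IsCompactOperator ⇑(f i)) (hs : HasSum f V) : IsCompactOperator ⇑V := by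
  have : IsClosed {f : H →L[ℂ] H | IsCompactOperator ⇑f} := isClosed_setOfPred_isCompactOperator
  exact this.mem_of_tendsto hs (Eventually.of_forall fun s => cpt_sum s f fun i _ => h i)

theorem norm_mul3_le {A T B : H →L[ℂ] H} (hA : ‖A‖ ≤ 1) (hB : ‖B‖ ≤ 1) : ‖A * T * B‖ ≤ ‖T‖ := by
  calc ‖A * T * B‖ ≤ ‖A‖ * ‖T‖ * ‖B‖ :=
        (norm_mul_le _ _).trans (mul_le_mul_of_nonneg_right (norm_mul_le _ _) (norm_nonneg _))
    _ ≤ 1 * ‖T‖ * 1 := by gcongr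
    _ = ‖T‖ := by ring

theorem essNorm_mul_lt {A T B : H →L[ℂ] H} {ε : ℝ} (hA : ‖A‖ ≤ 1) (hB : ‖B‖ ≤ 1)
    (h : essNorm T < ε) : essNorm (A * T * B) < ε := by
  rw [essNorm_lt_iff] at *
  obtain ⟨K, hK, h⟩ := h
  refine ⟨A * K * B, cpt_mul_right (cpt_mul_left _ hK) _, ?_⟩
  rw [← sub_mul, ← mul_sub]
  exact (norm_mul3_le hA hB).trans_lt h

theorem essNorm_add_lt {S T : H →L[ℂ] H} {a b : ℝ} (hS : essNorm S < a) (hT : essNorm T < b) :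
    essNorm (S + T) < a + b := by
  rw [essNorm_lt_iff] at *
  obtain ⟨K, hK, h⟩ := hS
  obtain ⟨L, hL, h'⟩ := hT
  refine ⟨K + L, cpt_add hK hL, ?_⟩
  rw [add_sub_add_comm]
  exact (norm_add_le _ _).trans_lt (add_lt_add h h')

theorem essNorm_neg_lt {S : H →L[ℂ] H} {a : ℝ} (hS : essNorm S < a) : essNorm (-S) < a := by
  rw [essNorm_lt_iff] at *
  obtain ⟨K, hK, h⟩ := hS
  refine ⟨-K, cpt_neg hK, ?_⟩
  rw [← neg_sub', norm_neg]
  exact h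

theorem essNorm_lt_of_norm {S : H →L[ℂ] H} {a : ℝ} (hS : ‖S‖ < a) : essNorm S < a := by
  rw [essNorm_lt_iff]
  exact ⟨0, cpt_zero, by simpa using hS⟩

theorem essNorm_lt_of_cpt {S : H →L[ℂ] H} {a : ℝ} (ha : 0 < a) (hS : IsCompactOperator ⇑S) :
    essNorm S < a := by
  rw [essNorm_lt_iff]
  exact ⟨S, hS, by simpa using ha⟩

theorem proj_le_iff {E F : H →L[ℂ] H} (hE : IsStarProjection E) (hF : IsStarProjection F) :
    ContinuousLinearMap.IsPositive (F - E) ↔ E * F = E := by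
  rw [← ContinuousLinearMap.le_def]
  exact hE.le_iff_mul_eq_left hF

end Ess

namespace ContinuousNest

variable {H : Type*} [NormedAddCommGroup H] [InnerProductSpace ℂ H] [CompleteSpace H]
variable (𝒩 : ContinuousNest H)

/-- the interval projection from s to t (zero when t ≤ s) -/
noncomputable def iv (s t : ℝ) : H →L[ℂ] H := 𝒩.co s * 𝒩.pr t

theorem iv_eq_sub {s t : ℝ} (h : s ≤ t) : 𝒩.iv s t = 𝒩.pr t - 𝒩.pr s := by
  rw [iv, co, sub_mul, one_mul, pr_mul_pr, min_eq_left h]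

theorem iv_zero_of_le {s t : ℝ} (h : t ≤ s) : 𝒩.iv s t = 0 := co_mul_pr_of_le 𝒩 h

theorem iv_eq' (s t : ℝ) : 𝒩.iv s t = 𝒩.pr t * 𝒩.co s := by rw [iv, pr_comm_co]

theorem iv_proj (s t : ℝ) : IsStarProjection (𝒩.iv s t) :=
  (𝒩.co_proj s).mul (𝒩.pr_proj t) (𝒩.pr_comm_co t s).symm

theorem iv_norm (s t : ℝ) : ‖𝒩.iv s t‖ ≤ 1 := proj_norm_le (𝒩.iv_proj s t)

theorem iv_mul (s t s' t' : ℝ) : 𝒩.iv s t * 𝒩.iv s' t' = 𝒩.iv (max s s') (min t t') := by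
  unfold iv
  rw [← co_mul_co, ← pr_mul_pr, mul_assoc, ← mul_assoc (𝒩.pr t), pr_comm_co]
  simp only [mul_assoc]

theorem iv_idem (s t : ℝ) : 𝒩.iv s t * 𝒩.iv s t = 𝒩.iv s t := by
  rw [iv_mul, max_self, min_self]

theorem iv_mem_alg (s t : ℝ) : 𝒩.iv s t ∈ 𝒩.alg := alg_mul (alg_co_mem s) (alg_pr_mem t)

variable {𝒩}

theorem iv_compress {X : H →L[ℂ] H} (h : X ∈ 𝒩.alg) (s t : ℝ) :
    𝒩.iv s t * X * 𝒩.iv s t = 𝒩.co s * X * 𝒩.pr t := by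
  conv_lhs => rhs; rw [iv_eq']
  rw [iv]
  have h1 := alg_pr h t
  have h2 := alg_co h s
  calc 𝒩.co s * 𝒩.pr t * X * (𝒩.pr t * 𝒩.co s)
      = 𝒩.co s * (𝒩.pr t * X * 𝒩.pr t) * 𝒩.co s := by simp only [mul_assoc]
    _ = 𝒩.co s * X * (𝒩.pr t * 𝒩.co s) := by rw [h1]; simp only [mul_assoc]
    _ = (𝒩.co s * X * 𝒩.co s) * 𝒩.pr t := by rw [pr_comm_co]; simp only [mul_assoc]
    _ = _ := by rw [h2]

theorem isInterval_iff {E : H →L[ℂ] H} :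
    𝒩.IsInterval E ↔ ∃ s t : ℝ, 0 ≤ s ∧ s ≤ t ∧ t ≤ 1 ∧ E = 𝒩.iv s t := by
  unfold IsInterval
  constructor
  · rintro ⟨s, t, h0, hst, h1, rfl⟩
    refine ⟨s, t, h0, hst, h1, ?_⟩
    rw [iv_eq_sub 𝒩 hst, pr_of_mem 𝒩 ⟨h0.trans hst, h1⟩, pr_of_mem 𝒩 ⟨h0, hst.trans h1⟩]
  · rintro ⟨s, t, h0, hst, h1, rfl⟩
    refine ⟨s, t, h0, hst, h1, ?_⟩
    rw [iv_eq_sub 𝒩 hst, pr_of_mem 𝒩 ⟨h0.trans hst, h1⟩, pr_of_mem 𝒩 ⟨h0, hst.trans h1⟩]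

theorem iv_eq_N {s t : ℝ} (h0 : 0 ≤ s) (hst : s ≤ t) (h1 : t ≤ 1) :
    𝒩.N t - 𝒩.N s = 𝒩.iv s t := by
  rw [iv_eq_sub 𝒩 hst, pr_of_mem 𝒩 ⟨h0.trans hst, h1⟩, pr_of_mem 𝒩 ⟨h0, hst.trans h1⟩]

theorem iv_ne_zero {s t : ℝ} (h0 : 0 ≤ s) (hst : s < t) (h1 : t ≤ 1) : 𝒩.iv s t ≠ 0 := by
  rw [← iv_eq_N h0 hst.le h1]
  intro h
  rw [sub_eq_zero] at h
  exact hst.ne' (𝒩.N_inj ⟨h0.trans hst.le, h1⟩ ⟨h0, hst.le.trans h1⟩ h)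

/-- comparison of intervals -/
theorem iv_le_iv {s t s' t' : ℝ} (h0 : 0 ≤ s) (hst : s < t) (h1 : t ≤ 1)
    (h : 𝒩.iv s t * 𝒩.iv s' t' = 𝒩.iv s t) : s' ≤ s ∧ t ≤ t' := by
  rw [iv_mul] at h
  have key : ∀ a b, s ≤ a → b ≤ t → 𝒩.iv a b = 𝒩.iv s t → a = s ∧ b = t := by
    intro a b ha hb hab
    constructor
    · by_contra hne
      have hlt : s < a := lt_of_le_of_ne ha (Ne.symm hne)
      have e : 𝒩.iv s (min a t) * 𝒩.iv s t = 0 := by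
        rw [← hab, iv_mul]
        apply iv_zero_of_le
        simp only [le_max_iff, min_le_iff, le_refl]
        tauto
      rw [iv_mul, max_self, min_assoc, min_self] at e
      exact iv_ne_zero h0 (lt_min hlt hst) ((min_le_right _ _).trans h1) e
    · by_contra hne
      have hlt : b < t := lt_of_le_of_ne hb hne
      have e : 𝒩.iv (max s b) t * 𝒩.iv s t = 0 := by
        rw [← hab, iv_mul]
        apply iv_zero_of_le
        simp only [le_max_iff, min_le_iff, le_refl]
        tauto
      rw [iv_mul, min_self, max_right_comm, max_self] at e
      exact iv_ne_zero (h0.trans (le_max_left _ _)) (max_lt hst hlt) h1 e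
  obtain ⟨e1, e2⟩ := key _ _ (le_max_left _ _) (min_le_left _ _) h
  exact ⟨by rw [← e1]; exact le_max_right _ _, by rw [← e2]; exact min_le_right _ _⟩

theorem iv_inj {s t s' t' : ℝ} (h0 : 0 ≤ s) (hst : s < t) (h1 : t ≤ 1)
    (h0' : 0 ≤ s') (h1' : t' ≤ 1) (h : 𝒩.iv s t = 𝒩.iv s' t') : s = s' ∧ t = t' := by
  have a1 := iv_le_iv h0 hst h1 (s' := s') (t' := t') (by rw [h, iv_idem])
  have hst' : s' < t' := by linarith
  have a2 := iv_le_iv h0' hst' h1' (s' := s) (t' := t) (by rw [← h, iv_idem])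
  exact ⟨le_antisymm a2.1 a1.1, le_antisymm a1.2 a2.2⟩

theorem N_le_iff {s t : ℝ} (hs : s ∈ Icc (0 : ℝ) 1) (ht : t ∈ Icc (0 : ℝ) 1) :
    ContinuousLinearMap.IsPositive (𝒩.N t - 𝒩.N s) ↔ s ≤ t := by
  rw [proj_le_iff ⟨𝒩.idem s hs, 𝒩.selfAdjoint s hs⟩ ⟨𝒩.idem t ht, 𝒩.selfAdjoint t ht⟩]
  constructor
  · intro h
    by_contra hlt
    push Not at hlt
    rw [𝒩.N_mul_left ht hs hlt.le] at h
    exact hlt.ne (𝒩.N_inj ht hs h)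
  · intro h
    exact 𝒩.N_mul_right hs ht h

/-- An automorphism of the nest comes from a monotone function on the unit interval. -/
theorem auto_fun {θ : (H →L[ℂ] H) → H →L[ℂ] H} (hθ : 𝒩.IsAuto θ) :
    ∃ f : ℝ → ℝ, (∀ t ∈ Icc (0 : ℝ) 1, f t ∈ Icc (0 : ℝ) 1) ∧
      (∀ t ∈ Icc (0 : ℝ) 1, θ (𝒩.N t) = 𝒩.N (f t)) ∧ MonotoneOn f (Icc 0 1) := by
  have h1 : ∀ t, ∃ u, t ∈ Icc (0 : ℝ) 1 → u ∈ Icc (0 : ℝ) 1 ∧ θ (𝒩.N t) = 𝒩.N u := by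
    intro t
    by_cases ht : t ∈ Icc (0 : ℝ) 1
    · obtain ⟨u, hu, e⟩ := hθ.1.mapsTo ⟨t, ht, rfl⟩
      exact ⟨u, fun _ => ⟨hu, e.symm⟩⟩
    · exact ⟨0, fun h => absurd h ht⟩
  choose f hf using h1
  refine ⟨f, fun t ht => (hf t ht).1, fun t ht => (hf t ht).2, ?_⟩
  intro s hs t ht hst
  have := hθ.2 s t hs ht hst
  rw [(hf s hs).2, (hf t ht).2, N_le_iff (hf s hs).1 (hf t ht).1] at this
  exact this

theorem prodFam_interval {P₁ P₂ : Set (H →L[ℂ] H)} (h₁ : 𝒩.IsIntervalFamily P₁)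
    (h₂ : 𝒩.IsIntervalFamily P₂) : 𝒩.IsIntervalFamily (prodFam P₁ P₂) := by
  rintro E ⟨E₁, hE₁, E₂, hE₂, rfl⟩
  obtain ⟨s, t, h0, hst, h1, rfl⟩ := isInterval_iff.1 (h₁ _ hE₁)
  obtain ⟨s', t', h0', hst', h1', rfl⟩ := isInterval_iff.1 (h₂ _ hE₂)
  rw [iv_mul, isInterval_iff]
  by_cases hc : max s s' ≤ min t t'
  · exact ⟨_, _, h0.trans (le_max_left _ _), hc, (min_le_left _ _).trans h1, rfl⟩
  · refine ⟨0, 0, le_rfl, le_rfl, zero_le_one, ?_⟩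
    rw [iv_zero_of_le 𝒩 (not_le.1 hc).le, iv_zero_of_le 𝒩 le_rfl]

theorem prodFam_refines {P₁ P₂ R₁ R₂ : Set (H →L[ℂ] H)} (h₁ : 𝒩.IsIntervalFamily P₁)
    (h₂ : 𝒩.IsIntervalFamily P₂) (h₃ : 𝒩.IsIntervalFamily R₁)
    (h₄ : 𝒩.IsIntervalFamily R₂) (r₁ : OpRefines R₁ P₁) (r₂ : OpRefines R₂ P₂) :
    OpRefines (prodFam R₁ R₂) (prodFam P₁ P₂) := by
  rintro E ⟨E₁, hE₁, E₂, hE₂, rfl⟩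
  obtain ⟨F₁, hF₁, l₁⟩ := r₁ _ hE₁
  obtain ⟨F₂, hF₂, l₂⟩ := r₂ _ hE₂
  refine ⟨F₁ * F₂, ⟨F₁, hF₁, F₂, hF₂, rfl⟩, ?_⟩
  obtain ⟨a, b, _, _, _, rfl⟩ := isInterval_iff.1 (h₁ _ hF₁)
  obtain ⟨c, d, _, _, _, rfl⟩ := isInterval_iff.1 (h₂ _ hF₂)
  obtain ⟨e, f, _, _, _, rfl⟩ := isInterval_iff.1 (h₃ _ hE₁)
  obtain ⟨g, h, _, _, _, rfl⟩ := isInterval_iff.1 (h₄ _ hE₂)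
  rw [proj_le_iff (iv_proj _ _ _) (iv_proj _ _ _)] at l₁ l₂
  rw [iv_mul, iv_mul, proj_le_iff (iv_proj _ _ _) (iv_proj _ _ _), ← iv_mul, ← iv_mul]
  have hc : 𝒩.iv g h * 𝒩.iv a b = 𝒩.iv a b * 𝒩.iv g h := by
    rw [iv_mul, iv_mul, max_comm, min_comm]
  calc 𝒩.iv e f * 𝒩.iv g h * (𝒩.iv a b * 𝒩.iv c d)
      = 𝒩.iv e f * (𝒩.iv g h * 𝒩.iv a b) * 𝒩.iv c d := by simp only [mul_assoc]
    _ = (𝒩.iv e f * 𝒩.iv a b) * (𝒩.iv g h * 𝒩.iv c d) := by rw [hc]; simp only [mul_assoc]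
    _ = _ := by rw [l₁, l₂]

theorem autoImage_prodFam {θ : (H →L[ℂ] H) → H →L[ℂ] H} (hθ : 𝒩.IsAuto θ)
    {P₁ P₂ : Set (H →L[ℂ] H)} (h₁ : 𝒩.IsIntervalFamily P₁)
    (h₂ : 𝒩.IsIntervalFamily P₂) :
    𝒩.autoImage θ (prodFam P₁ P₂) = prodFam (𝒩.autoImage θ P₁) (𝒩.autoImage θ P₂) := by
  obtain ⟨f, fm, fe, fmono⟩ := auto_fun hθ
  have img : ∀ s t, 0 ≤ s → s ≤ t → t ≤ 1 → θ (𝒩.N t) - θ (𝒩.N s) = 𝒩.iv (f s) (f t) := by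
    intro s t h0 hst h1
    have hs : s ∈ Icc (0 : ℝ) 1 := ⟨h0, hst.trans h1⟩
    have ht : t ∈ Icc (0 : ℝ) 1 := ⟨h0.trans hst, h1⟩
    rw [fe s hs, fe t ht, iv_eq_N (fm s hs).1 (fmono hs ht hst) (fm t ht).2]
  have fmax : ∀ s t, s ∈ Icc (0 : ℝ) 1 → t ∈ Icc (0 : ℝ) 1 → f (max s t) = max (f s) (f t) := by
    intro s t hs ht
    exact fmono.map_sup hs ht
  have fmin : ∀ s t, s ∈ Icc (0 : ℝ) 1 → t ∈ Icc (0 : ℝ) 1 → f (min s t) = min (f s) (f t) := by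
    intro s t hs ht
    exact fmono.map_inf hs ht
  ext E
  constructor
  · rintro ⟨s, t, h0, hst, h1, ⟨E₁, hE₁, E₂, hE₂, he⟩, rfl⟩
    obtain ⟨s₁, t₁, a0, ast, a1, rfl⟩ := h₁ _ hE₁
    obtain ⟨s₂, t₂, b0, bst, b1, rfl⟩ := h₂ _ hE₂
    refine ⟨_, ⟨s₁, t₁, a0, ast, a1, hE₁, rfl⟩, _, ⟨s₂, t₂, b0, bst, b1, hE₂, rfl⟩, ?_⟩
    rw [img _ _ h0 hst h1, img _ _ a0 ast a1, img _ _ b0 bst b1, iv_mul,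
      ← fmax _ _ ⟨a0, ast.trans a1⟩ ⟨b0, bst.trans b1⟩,
      ← fmin _ _ ⟨a0.trans ast, a1⟩ ⟨b0.trans bst, b1⟩]
    rw [iv_eq_N h0 hst h1, iv_eq_N a0 ast a1, iv_eq_N b0 bst b1, iv_mul] at he
    rcases hst.eq_or_lt with rfl | hlt
    · rw [iv_zero_of_le 𝒩 le_rfl, iv_zero_of_le]
      rw [iv_zero_of_le 𝒩 le_rfl] at he
      apply fmono
      · exact ⟨le_min (a0.trans ast) (b0.trans bst), (min_le_left _ _).trans a1⟩
      · exact ⟨a0.trans (le_max_left _ _), max_le (ast.trans a1) (bst.trans b1)⟩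
      · by_contra hc
        exact iv_ne_zero (a0.trans (le_max_left _ _)) (not_le.1 hc) ((min_le_left _ _).trans a1)
          he.symm
    · obtain ⟨e1, e2⟩ := iv_inj h0 hlt h1 (a0.trans (le_max_left _ _))
        ((min_le_left _ _).trans a1) he
      rw [← e1, ← e2]
  · rintro ⟨_, ⟨s₁, t₁, a0, ast, a1, hE₁, rfl⟩, _, ⟨s₂, t₂, b0, bst, b1, hE₂, rfl⟩, rfl⟩
    have m1 : max s₁ s₂ ∈ Icc (0 : ℝ) 1 :=
      ⟨a0.trans (le_max_left _ _), max_le (ast.trans a1) (bst.trans b1)⟩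
    have m2 : min t₁ t₂ ∈ Icc (0 : ℝ) 1 :=
      ⟨le_min (a0.trans ast) (b0.trans bst), (min_le_left _ _).trans a1⟩
    rw [img _ _ a0 ast a1, img _ _ b0 bst b1, iv_mul,
      ← fmax _ _ ⟨a0, ast.trans a1⟩ ⟨b0, bst.trans b1⟩,
      ← fmin _ _ ⟨a0.trans ast, a1⟩ ⟨b0.trans bst, b1⟩]
    have hprod : 𝒩.iv (max s₁ s₂) (min t₁ t₂) ∈ prodFam P₁ P₂ := by
      refine ⟨_, hE₁, _, hE₂, ?_⟩
      rw [iv_eq_N a0 ast a1, iv_eq_N b0 bst b1, iv_mul]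
    by_cases hc : max s₁ s₂ ≤ min t₁ t₂
    · refine ⟨_, _, m1.1, hc, m2.2, ?_, ?_⟩
      · rw [iv_eq_N m1.1 hc m2.2]; exact hprod
      · rw [img _ _ m1.1 hc m2.2]
    · have hc' := (not_le.1 hc).le
      refine ⟨max s₁ s₂, max s₁ s₂, m1.1, le_rfl, m1.2, ?_, ?_⟩
      · rw [iv_zero_of_le 𝒩 hc'] at hprod
        rw [sub_self]; exact hprod
      · rw [sub_self, iv_zero_of_le 𝒩 (fmono m2 m1 hc')]

theorem prod_stableNet {O₁ O₂ : Set (Set (H →L[ℂ] H))}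
    (h₁ : 𝒩.IsStableNet O₁) (h₂ : 𝒩.IsStableNet O₂) :
    𝒩.IsStableNet {P | ∃ P₁ ∈ O₁, ∃ P₂ ∈ O₂, P = prodFam P₁ P₂} := by
  refine ⟨⟨?_, ?_⟩, ?_⟩
  · rintro P ⟨P₁, hP₁, P₂, hP₂, rfl⟩
    exact prodFam_interval (h₁.1.1 _ hP₁) (h₂.1.1 _ hP₂)
  · rintro P ⟨P₁, hP₁, P₂, hP₂, rfl⟩ Q ⟨Q₁, hQ₁, Q₂, hQ₂, rfl⟩
    obtain ⟨R₁, hR₁, a, b⟩ := h₁.1.2 _ hP₁ _ hQ₁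
    obtain ⟨R₂, hR₂, c, d⟩ := h₂.1.2 _ hP₂ _ hQ₂
    refine ⟨_, ⟨R₁, hR₁, R₂, hR₂, rfl⟩, ?_, ?_⟩
    · exact prodFam_refines (h₁.1.1 _ hP₁) (h₂.1.1 _ hP₂) (h₁.1.1 _ hR₁) (h₂.1.1 _ hR₂) a c
    · exact prodFam_refines (h₁.1.1 _ hQ₁) (h₂.1.1 _ hQ₂) (h₁.1.1 _ hR₁) (h₂.1.1 _ hR₂) b d
  · rintro θ hθ P ⟨P₁, hP₁, P₂, hP₂, rfl⟩
    exact ⟨_, h₁.2 θ hθ _ hP₁, _, h₂.2 θ hθ _ hP₂,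
      autoImage_prodFam hθ (h₁.1.1 _ hP₁) (h₂.1.1 _ hP₂)⟩

/-- compressions to a refined interval have smaller essential norm -/
theorem essNorm_refine {E F X : H →L[ℂ] H} (hE : 𝒩.IsInterval E) (hF : 𝒩.IsInterval F)
    (h : ContinuousLinearMap.IsPositive (F - E)) {ε : ℝ} (hX : essNorm (F * X * F) < ε) :
    essNorm (E * X * E) < ε := by
  obtain ⟨a, b, _, _, _, rfl⟩ := isInterval_iff.1 hE
  obtain ⟨c, d, _, _, _, rfl⟩ := isInterval_iff.1 hF
  rw [proj_le_iff (iv_proj _ _ _) (iv_proj _ _ _)] at h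
  have h' : 𝒩.iv c d * 𝒩.iv a b = 𝒩.iv a b := by
    rw [iv_mul, max_comm, min_comm, ← iv_mul, h]
  have : 𝒩.iv a b * X * 𝒩.iv a b
      = 𝒩.iv a b * (𝒩.iv c d * X * 𝒩.iv c d) * 𝒩.iv a b := by
    calc 𝒩.iv a b * X * 𝒩.iv a b = (𝒩.iv a b * 𝒩.iv c d) * X * (𝒩.iv c d * 𝒩.iv a b) := by
          rw [h, h']
      _ = _ := by simp only [mul_assoc]
  rw [this]
  exact essNorm_mul_lt (iv_norm _ _ _) (iv_norm _ _ _) hX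

theorem kernel_add {O : Set (Set (H →L[ℂ] H))} (hO : 𝒩.IsNet O) {X Y : H →L[ℂ] H}
    (hX : X ∈ 𝒩.kernel O) (hY : Y ∈ 𝒩.kernel O) : X + Y ∈ 𝒩.kernel O := by
  refine ⟨alg_add hX.1 hY.1, fun ε hε => ?_⟩
  obtain ⟨P, hP, a⟩ := hX.2 (ε / 2) (by positivity)
  obtain ⟨Q, hQ, b⟩ := hY.2 (ε / 2) (by positivity)
  obtain ⟨R, hR, rP, rQ⟩ := hO.2 _ hP _ hQ
  refine ⟨R, hR, fun E hE => ?_⟩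
  obtain ⟨F, hF, l⟩ := rP _ hE
  obtain ⟨G, hG, l'⟩ := rQ _ hE
  have e1 := essNorm_refine (hO.1 _ hR _ hE) (hO.1 _ hP _ hF) l (a _ hF)
  have e2 := essNorm_refine (hO.1 _ hR _ hE) (hO.1 _ hQ _ hG) l' (b _ hG)
  have := essNorm_add_lt e1 e2
  rw [mul_add, add_mul]
  linarith

theorem kernel_neg {O : Set (Set (H →L[ℂ] H))} {X : H →L[ℂ] H}
    (hX : X ∈ 𝒩.kernel O) : -X ∈ 𝒩.kernel O := by
  refine ⟨alg_neg hX.1, fun ε hε => ?_⟩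
  obtain ⟨P, hP, a⟩ := hX.2 ε hε
  refine ⟨P, hP, fun E hE => ?_⟩
  rw [mul_neg, neg_mul]
  exact essNorm_neg_lt (a E hE)

theorem iv_mem_prod_left {E₁ E₂ : H →L[ℂ] H} (h₁ : 𝒩.IsInterval E₁) (h₂ : 𝒩.IsInterval E₂)
    (X : H →L[ℂ] H) : E₁ * E₂ * X * (E₁ * E₂) = E₂ * (E₁ * X * E₁) * E₂ := by
  obtain ⟨a, b, _, _, _, rfl⟩ := isInterval_iff.1 h₁
  obtain ⟨c, d, _, _, _, rfl⟩ := isInterval_iff.1 h₂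
  have hc : 𝒩.iv a b * 𝒩.iv c d = 𝒩.iv c d * 𝒩.iv a b := by
    rw [iv_mul, iv_mul, max_comm, min_comm]
  conv_lhs => lhs; lhs; rw [hc]
  simp only [mul_assoc]

theorem kernel_prod_left {O₁ O₂ : Set (Set (H →L[ℂ] H))}
    (h₁ : 𝒩.IsNet O₁) (h₂ : 𝒩.IsNet O₂) (hne : O₂.Nonempty) :
    𝒩.kernel O₁ ⊆ 𝒩.kernel {P | ∃ P₁ ∈ O₁, ∃ P₂ ∈ O₂, P = prodFam P₁ P₂} := by
  rintro X ⟨hX, h⟩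
  refine ⟨hX, fun ε hε => ?_⟩
  obtain ⟨P, hP, a⟩ := h ε hε
  obtain ⟨Q, hQ⟩ := hne
  refine ⟨_, ⟨P, hP, Q, hQ, rfl⟩, ?_⟩
  rintro E ⟨E₁, hE₁, E₂, hE₂, rfl⟩
  have i1 := h₁.1 _ hP _ hE₁
  have i2 := h₂.1 _ hQ _ hE₂
  rw [iv_mem_prod_left i1 i2]
  obtain ⟨c, d, _, _, _, rfl⟩ := isInterval_iff.1 i2
  exact essNorm_mul_lt (iv_norm _ _ _) (iv_norm _ _ _) (a _ hE₁)

theorem kernel_prod_right {O₁ O₂ : Set (Set (H →L[ℂ] H))}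
    (h₁ : 𝒩.IsNet O₁) (h₂ : 𝒩.IsNet O₂) (hne : O₁.Nonempty) :
    𝒩.kernel O₂ ⊆ 𝒩.kernel {P | ∃ P₁ ∈ O₁, ∃ P₂ ∈ O₂, P = prodFam P₁ P₂} := by
  rintro X ⟨hX, h⟩
  refine ⟨hX, fun ε hε => ?_⟩
  obtain ⟨P, hP, a⟩ := h ε hε
  obtain ⟨Q, hQ⟩ := hne
  refine ⟨_, ⟨Q, hQ, P, hP, rfl⟩, ?_⟩
  rintro E ⟨E₁, hE₁, E₂, hE₂, rfl⟩
  have i1 := h₁.1 _ hQ _ hE₁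
  have i2 := h₂.1 _ hP _ hE₂
  have : E₁ * E₂ * X * (E₁ * E₂) = E₁ * (E₂ * X * E₂) * E₁ := by
    obtain ⟨a, b, _, _, _, rfl⟩ := isInterval_iff.1 i1
    obtain ⟨c, d, _, _, _, rfl⟩ := isInterval_iff.1 i2
    have hc : 𝒩.iv a b * 𝒩.iv c d = 𝒩.iv c d * 𝒩.iv a b := by
      rw [iv_mul, iv_mul, max_comm, min_comm]
    conv_lhs => rhs; rw [hc]
    simp only [mul_assoc]
  rw [this]
  obtain ⟨c, d, _, _, _, rfl⟩ := isInterval_iff.1 i1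
  exact essNorm_mul_lt (iv_norm _ _ _) (iv_norm _ _ _) (a _ hE₂)

/-- a strictly monotone bijection of the unit interval induces an automorphism of the nest -/
theorem exists_auto {f : ℝ → ℝ} (hf : BijOn f (Icc 0 1) (Icc 0 1))
    (hm : StrictMonoOn f (Icc 0 1)) :
    ∃ θ, 𝒩.IsAuto θ ∧ ∀ t ∈ Icc (0 : ℝ) 1, θ (𝒩.N t) = 𝒩.N (f t) := by
  classical
  have h1 : ∀ T : H →L[ℂ] H, ∃ S, ∀ t ∈ Icc (0 : ℝ) 1, T = 𝒩.N t → S = 𝒩.N (f t) := by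
    intro T
    by_cases h : ∃ t ∈ Icc (0 : ℝ) 1, T = 𝒩.N t
    · obtain ⟨t, ht, rfl⟩ := h
      refine ⟨𝒩.N (f t), fun u hu e => ?_⟩
      rw [𝒩.N_inj ht hu e]
    · exact ⟨0, fun t ht e => absurd ⟨t, ht, e⟩ h⟩
  choose θ hθ using h1
  have hθ' : ∀ t ∈ Icc (0 : ℝ) 1, θ (𝒩.N t) = 𝒩.N (f t) := fun t ht => hθ _ t ht rfl
  refine ⟨θ, ⟨⟨?_, ?_, ?_⟩, ?_⟩, hθ'⟩
  · rintro _ ⟨t, ht, rfl⟩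
    rw [hθ' t ht]
    exact ⟨f t, hf.mapsTo ht, rfl⟩
  · rintro _ ⟨t, ht, rfl⟩ _ ⟨u, hu, rfl⟩ e
    rw [hθ' t ht, hθ' u hu] at e
    rw [hf.injOn ht hu (𝒩.N_inj (hf.mapsTo ht) (hf.mapsTo hu) e)]
  · rintro _ ⟨t, ht, rfl⟩
    obtain ⟨u, hu, rfl⟩ := hf.surjOn ht
    exact ⟨_, ⟨u, hu, rfl⟩, hθ' u hu⟩
  · intro s t hs ht hst
    rw [hθ' s hs, hθ' t ht, N_le_iff (hf.mapsTo hs) (hf.mapsTo ht)]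
    exact hm.monotoneOn hs ht hst

end ContinuousNest

open Set Filter Topology
set_option linter.unusedSectionVars false

section Orth
variable {H : Type*} [NormedAddCommGroup H] [InnerProductSpace ℂ H] [CompleteSpace H]

theorem orth_norm_sq {ι : Type*} (S : Finset ι) (f : ι → H) (c : ι → ℂ)
    (ho : ∀ i ∈ S, ∀ j ∈ S, i ≠ j → inner ℂ (f i) (f j) = 0) :
    ‖∑ i ∈ S, c i • f i‖ ^ 2 = ∑ i ∈ S, ‖c i‖ ^ 2 * ‖f i‖ ^ 2 := by
  classical
  induction S using Finset.induction_on with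
  | empty => simp
  | insert a S ha ih =>
    rw [Finset.sum_insert ha, Finset.sum_insert ha,
      ← ih (fun i hi j hj hij => ho i (by simp [hi]) j (by simp [hj]) hij)]
    have h0 : inner ℂ (c a • f a) (∑ i ∈ S, c i • f i) = 0 := by
      rw [inner_sum]
      apply Finset.sum_eq_zero
      intro i hi
      rw [inner_smul_left, inner_smul_right, ho a (by simp) i (by simp [hi]) (by rintro rfl; exact ha hi)]
      simp
    have := norm_add_sq_eq_norm_sq_add_norm_sq_of_inner_eq_zero _ _ h0
    rw [sq, this, norm_smul]
    ring

theorem orth_bessel {ι : Type*} (S : Finset ι) (f : ι → H)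
    (ho : ∀ i ∈ S, ∀ j ∈ S, i ≠ j → inner ℂ (f i) (f j) = 0) (hn : ∀ i ∈ S, ‖f i‖ ≤ 1) (v : H) :
    ∑ i ∈ S, ‖inner ℂ (f i) v‖ ^ 2 ≤ ‖v‖ ^ 2 := by
  set w := ∑ i ∈ S, (inner ℂ (f i) v : ℂ) • f i with hw
  set Q := ∑ i ∈ S, ‖(inner ℂ (f i) v : ℂ)‖ ^ 2 with hQ
  have h1 : ‖w‖ ^ 2 ≤ Q := by
    rw [hw, orth_norm_sq S f _ ho]
    apply Finset.sum_le_sum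
    intro i hi
    have : ‖f i‖ ^ 2 ≤ 1 := pow_le_one₀ (norm_nonneg _) (hn i hi)
    nlinarith [sq_nonneg ‖(inner ℂ (f i) v : ℂ)‖]
  have h2 : ((Q : ℝ) : ℂ) = inner ℂ w v := by
    rw [hw, sum_inner, hQ]
    push_cast
    apply Finset.sum_congr rfl
    intro i _
    rw [inner_smul_left, ← Complex.conj_mul']
  have h3 : Q ≤ ‖w‖ * ‖v‖ := by
    have hQ0 : 0 ≤ Q := Finset.sum_nonneg fun i _ => sq_nonneg _
    have : ‖((Q : ℝ) : ℂ)‖ ≤ ‖w‖ * ‖v‖ := by rw [h2]; exact norm_inner_le_norm _ _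
    rwa [Complex.norm_real, Real.norm_of_nonneg hQ0] at this
  by_contra hlt
  push Not at hlt
  have h4 : ‖v‖ ^ 2 < ‖w‖ * ‖v‖ := hlt.trans_le h3
  have h5 : ‖w‖ ^ 2 ≤ ‖w‖ * ‖v‖ := h1.trans h3
  nlinarith [norm_nonneg v, norm_nonneg w]

/-- finite-rank shift operator -/
noncomputable def shiftOp {ι : Type*} (S : Finset ι) (f g : ι → H) : H →L[ℂ] H :=
  ∑ i ∈ S, InnerProductSpace.rankOne ℂ (f i) (g i)

theorem shiftOp_apply {ι : Type*} (S : Finset ι) (f g : ι → H) (v : H) :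
    shiftOp S f g v = ∑ i ∈ S, (inner ℂ (g i) v : ℂ) • f i := by
  unfold shiftOp
  rw [_root_.sum_apply]
  rfl

theorem shiftOp_norm {ι : Type*} (S : Finset ι) (f g : ι → H)
    (ho : ∀ i ∈ S, ∀ j ∈ S, i ≠ j → inner ℂ (f i) (f j) = 0) (hn : ∀ i ∈ S, ‖f i‖ ≤ 1)
    (ho' : ∀ i ∈ S, ∀ j ∈ S, i ≠ j → inner ℂ (g i) (g j) = 0) (hn' : ∀ i ∈ S, ‖g i‖ ≤ 1) :
    ‖shiftOp S f g‖ ≤ 1 := by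
  refine ContinuousLinearMap.opNorm_le_bound _ zero_le_one fun v => ?_
  rw [one_mul, shiftOp_apply]
  have h1 := orth_norm_sq S f (fun i => inner ℂ (g i) v) ho
  have h2 := orth_bessel S g ho' hn' v
  have h3 : ‖∑ i ∈ S, (inner ℂ (g i) v : ℂ) • f i‖ ^ 2 ≤ ‖v‖ ^ 2 := by
    rw [h1]
    refine le_trans (Finset.sum_le_sum fun i hi => ?_) h2
    have : ‖f i‖ ^ 2 ≤ 1 := pow_le_one₀ (norm_nonneg _) (hn i hi)
    nlinarith [sq_nonneg ‖(inner ℂ (g i) v : ℂ)‖]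
  exact (sq_le_sq₀ (norm_nonneg _) (norm_nonneg _)).1 h3

theorem shiftOp_finite {ι : Type*} (S : Finset ι) (f g : ι → H) :
    FiniteDimensional ℂ (LinearMap.range (shiftOp S f g).toLinearMap) := by
  classical
  have hle : LinearMap.range (shiftOp S f g).toLinearMap ≤ Submodule.span ℂ ((S.image f : Finset H) : Set H) := by
    rintro _ ⟨v, rfl⟩
    change shiftOp S f g v ∈ _
    rw [shiftOp_apply]
    refine Submodule.sum_mem _ fun i hi => Submodule.smul_mem _ _ (Submodule.subset_span ?_)
    simp only [Finset.coe_image]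
    exact ⟨i, hi, rfl⟩
  have : FiniteDimensional ℂ (Submodule.span ℂ ((S.image f : Finset H) : Set H)) :=
    FiniteDimensional.span_finset ℂ _
  exact Submodule.finiteDimensional_of_le hle

end Orth

open Set Filter Topology
set_option linter.unusedSectionVars false

namespace ContinuousNest

variable {H : Type*} [NormedAddCommGroup H] [InnerProductSpace ℂ H] [CompleteSpace H]
variable (𝒩 : ContinuousNest H)

theorem pr_inner (a : ℝ) (u v : H) : inner ℂ (𝒩.pr a u) v = inner ℂ u (𝒩.pr a v) := by
  conv_lhs => rw [← pr_star]
  exact ContinuousLinearMap.adjoint_inner_left _ _ _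

theorem pr_apply_pr (a b : ℝ) (u : H) : 𝒩.pr a (𝒩.pr b u) = 𝒩.pr (min a b) u := by
  rw [← pr_mul_pr]; rfl

theorem pr_pyth {a b : ℝ} (h : a ≤ b) (e : H) :
    ‖𝒩.pr b e - 𝒩.pr a e‖ ^ 2 = ‖𝒩.pr b e‖ ^ 2 - ‖𝒩.pr a e‖ ^ 2 := by
  have h0 : inner ℂ (𝒩.pr a e) (𝒩.pr b e - 𝒩.pr a e) = 0 := by
    rw [pr_inner, map_sub, pr_apply_pr, pr_apply_pr, min_eq_left h, min_self, sub_self,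
      inner_zero_right]
  have := norm_add_sq_eq_norm_sq_add_norm_sq_of_inner_eq_zero _ _ h0
  rw [add_sub_cancel] at this
  linarith [sq ‖𝒩.pr b e‖, sq ‖𝒩.pr a e‖, sq ‖𝒩.pr b e - 𝒩.pr a e‖]

theorem pr_norm_mono {a b : ℝ} (h : a ≤ b) (e : H) : ‖𝒩.pr a e‖ ^ 2 ≤ ‖𝒩.pr b e‖ ^ 2 := by
  linarith [𝒩.pr_pyth h e, sq_nonneg ‖𝒩.pr b e - 𝒩.pr a e‖]

theorem pr_pyth_abs (a b : ℝ) (e : H) :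
    ‖𝒩.pr b e - 𝒩.pr a e‖ ^ 2 = |‖𝒩.pr b e‖ ^ 2 - ‖𝒩.pr a e‖ ^ 2| := by
  rcases le_total a b with h | h
  · rw [pr_pyth 𝒩 h, abs_of_nonneg]
    linarith [pr_norm_mono 𝒩 h e]
  · rw [norm_sub_rev, pr_pyth 𝒩 h, abs_sub_comm, abs_of_nonneg]
    linarith [pr_norm_mono 𝒩 h e]

theorem exists_points (e : H) (m : ℕ) : ∃ τ : ℕ → ℝ, Monotone τ ∧
    ∀ i ≤ m + 1, ‖𝒩.pr (τ i) e‖ ^ 2 = (i / (m + 1 : ℝ)) * ‖e‖ ^ 2 := by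
  have hc : ContinuousOn (fun t => ‖𝒩.pr t e‖ ^ 2) (Icc 0 1) := by
    have := 𝒩.pr_cont e
    fun_prop
  have h1 : ∀ i : ℕ, ∃ t, ‖𝒩.pr t e‖ ^ 2 = (min (i / (m + 1 : ℝ)) 1) * ‖e‖ ^ 2 := by
    intro i
    have := intermediate_value_Icc zero_le_one hc
    have hm : (min (i / (m + 1 : ℝ)) 1) * ‖e‖ ^ 2 ∈
        Icc (‖𝒩.pr 0 e‖ ^ 2) (‖𝒩.pr 1 e‖ ^ 2) := by
      rw [pr_zero, pr_one]
      constructor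
      · simp only [_root_.zero_apply, norm_zero]
        rw [zero_pow two_ne_zero]
        positivity
      · calc _ ≤ 1 * ‖e‖ ^ 2 := by gcongr; exact min_le_right _ _
          _ = _ := by simp
    obtain ⟨t, _, ht⟩ := this hm
    exact ⟨t, ht⟩
  choose t ht using h1
  let τ : ℕ → ℝ := fun n => Nat.rec (t 0) (fun k x => max x (t (k + 1))) n
  have τs : ∀ n, τ (n + 1) = max (τ n) (t (n + 1)) := fun n => rfl
  have hτ : ∀ n, ‖𝒩.pr (τ n) e‖ ^ 2 = (min (n / (m + 1 : ℝ)) 1) * ‖e‖ ^ 2 := by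
    intro n
    induction n with
    | zero => exact ht 0
    | succ n ih =>
      rw [τs]
      have hmono : Monotone fun s => ‖𝒩.pr s e‖ ^ 2 := fun a b h => 𝒩.pr_norm_mono h e
      have := hmono.map_max (a := τ n) (b := t (n + 1))
      rw [this, ih, ht, max_eq_right]
      gcongr
      linarith
  refine ⟨τ, monotone_nat_of_le_succ fun n => by rw [τs]; exact le_max_left _ _, fun i hi => ?_⟩
  rw [hτ, min_eq_left]
  rw [div_le_one (by positivity)]
  exact_mod_cast hi

/-- choice of points -/
noncomputable def pts (e : H) (m : ℕ) : ℕ → ℝ := (𝒩.exists_points e m).choose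

theorem pts_mono (e : H) (m : ℕ) : Monotone (𝒩.pts e m) := (𝒩.exists_points e m).choose_spec.1

theorem pts_spec (e : H) (m : ℕ) {i : ℕ} (hi : i ≤ m + 1) :
    ‖𝒩.pr (𝒩.pts e m i) e‖ ^ 2 = (i / (m + 1 : ℝ)) * ‖e‖ ^ 2 :=
  (𝒩.exists_points e m).choose_spec.2 i hi

noncomputable def dl (e : H) (m i : ℕ) : H :=
  𝒩.pr (𝒩.pts e m (i + 1)) e - 𝒩.pr (𝒩.pts e m i) e

theorem dl_norm (e : H) {m i : ℕ} (hi : i ≤ m) : ‖𝒩.dl e m i‖ ^ 2 = ‖e‖ ^ 2 / (m + 1) := by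
  unfold dl
  rw [pr_pyth 𝒩 (𝒩.pts_mono e m (Nat.le_succ i)), pts_spec 𝒩 e m (by omega),
    pts_spec 𝒩 e m (by omega)]
  push_cast
  field_simp
  ring

theorem dl_inner (e : H) {m i j : ℕ} (hij : i < j) : inner ℂ (𝒩.dl e m i) (𝒩.dl e m j) = 0 := by
  unfold dl
  have hm := 𝒩.pts_mono e m
  have h1 : 𝒩.pts e m i ≤ 𝒩.pts e m j := hm hij.le
  have h2 : 𝒩.pts e m i ≤ 𝒩.pts e m (j + 1) := hm (by omega)
  have h3 : 𝒩.pts e m (i + 1) ≤ 𝒩.pts e m j := hm (by omega)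
  have h4 : 𝒩.pts e m (i + 1) ≤ 𝒩.pts e m (j + 1) := hm (by omega)
  rw [inner_sub_left, pr_inner, pr_inner, map_sub, map_sub]
  simp only [pr_apply_pr]
  rw [min_eq_left h1, min_eq_left h2, min_eq_left h3, min_eq_left h4]
  simp

noncomputable def ff (e : H) (m i : ℕ) : H := ((Real.sqrt (m + 1) / ‖e‖ : ℝ) : ℂ) • 𝒩.dl e m i

theorem ff_norm (e : H) {m i : ℕ} (hi : i ≤ m) : ‖𝒩.ff e m i‖ ≤ 1 := by
  unfold ff
  rw [norm_smul, Complex.norm_real, Real.norm_of_nonneg (by positivity)]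
  by_cases he : ‖e‖ = 0
  · rw [he]; simp
  have h1 := 𝒩.dl_norm e hi
  have : (Real.sqrt (m + 1) / ‖e‖ * ‖𝒩.dl e m i‖) ^ 2 ≤ 1 := by
    rw [mul_pow, div_pow, Real.sq_sqrt (by positivity), h1]
    apply le_of_eq
    field_simp
  nlinarith [norm_nonneg (𝒩.dl e m i), this]

theorem ff_inner (e : H) {m i j : ℕ} (hij : i ≠ j) : inner ℂ (𝒩.ff e m i) (𝒩.ff e m j) = 0 := by
  unfold ff
  rw [inner_smul_left, inner_smul_right]
  rcases hij.lt_or_gt with h | h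
  · rw [dl_inner 𝒩 e h]; simp
  · rw [← inner_conj_symm, dl_inner 𝒩 e h]; simp

theorem ff_cross {e e' : H} (h : ∀ s t, inner ℂ (𝒩.pr s e) (𝒩.pr t e') = 0) (m i j : ℕ) :
    inner ℂ (𝒩.ff e m i) (𝒩.ff e' m j) = 0 := by
  unfold ff dl
  rw [inner_smul_left, inner_smul_right, inner_sub_left, inner_sub_right, inner_sub_right]
  simp [h]

theorem ff_cross' {e e' : H} (h : ∀ s t, inner ℂ (𝒩.pr s e) (𝒩.pr t e') = 0) (m i : ℕ) (t : ℝ) :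
    inner ℂ (𝒩.ff e m i) (𝒩.pr t e') = 0 := by
  unfold ff dl
  rw [inner_smul_left, inner_sub_left]
  simp [h]

theorem ff_co (e : H) {m i : ℕ} {t : ℝ} (h : 𝒩.pts e m (i + 1) ≤ t) : 𝒩.pr t (𝒩.ff e m i) = 𝒩.ff e m i := by
  unfold ff dl
  have h' : 𝒩.pts e m i ≤ t := (𝒩.pts_mono e m (Nat.le_succ i)).trans h
  rw [map_smul, map_sub, pr_apply_pr, pr_apply_pr, min_eq_right h, min_eq_right h']

theorem ff_pr (e : H) {m i : ℕ} {t : ℝ} (h : t ≤ 𝒩.pts e m i) : 𝒩.pr t (𝒩.ff e m i) = 0 := by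
  unfold ff dl
  have h' : t ≤ 𝒩.pts e m (i + 1) := h.trans (𝒩.pts_mono e m (Nat.le_succ i))
  rw [map_smul, map_sub, pr_apply_pr, pr_apply_pr, min_eq_left h, min_eq_left h', sub_self, smul_zero]

/-- orthogonal cyclic vectors -/
def CycSeq (e : ℕ → H) : Prop := ∀ k l, k ≠ l → ∀ s t, inner ℂ (𝒩.pr s (e k)) (𝒩.pr t (e l)) = 0

noncomputable def erd (e : ℕ → H) (m : ℕ) : H →L[ℂ] H :=
  shiftOp (Finset.range m ×ˢ Finset.range m) (fun p => 𝒩.ff (e p.1) m p.2)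
    (fun p => 𝒩.ff (e p.1) m (p.2 + 1))

variable {𝒩}

theorem erd_norm {e : ℕ → H} (he : 𝒩.CycSeq e) (m : ℕ) : ‖𝒩.erd e m‖ ≤ 1 := by
  unfold erd
  apply shiftOp_norm
  · rintro ⟨k, i⟩ _ ⟨l, j⟩ _ hne
    by_cases hkl : k = l
    · subst hkl
      exact ff_inner 𝒩 _ (by rintro rfl; exact hne rfl)
    · exact ff_cross 𝒩 (he k l hkl) _ _ _
  · rintro ⟨k, i⟩ h
    simp only [Finset.mem_product, Finset.mem_range] at h
    exact ff_norm 𝒩 _ (by omega)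
  · rintro ⟨k, i⟩ _ ⟨l, j⟩ _ hne
    by_cases hkl : k = l
    · subst hkl
      exact ff_inner 𝒩 _ (by rintro h; exact hne (by simp at h; rw [h]))
    · exact ff_cross 𝒩 (he k l hkl) _ _ _
  · rintro ⟨k, i⟩ h
    simp only [Finset.mem_product, Finset.mem_range] at h
    exact ff_norm 𝒩 _ (by omega)

theorem erd_alg (e : ℕ → H) (m : ℕ) : 𝒩.erd e m ∈ 𝒩.alg := by
  unfold erd shiftOp
  refine alg_sum _ _ ?_
  rintro ⟨k, i⟩ _
  rw [alg_iff_inner]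
  intro t v w
  simp only [InnerProductSpace.rankOne_apply]
  rw [inner_smul_right, ← pr_inner]
  rcases le_total (𝒩.pts (e k) m (i + 1)) t with h | h
  · have : inner ℂ (𝒩.co t w) (𝒩.ff (e k) m i) = 0 := by
      rw [← ff_co 𝒩 (e k) h, ← pr_inner]
      have h2 : 𝒩.pr t (𝒩.co t w) = 0 := by
        change (𝒩.pr t * 𝒩.co t) w = 0
        rw [pr_comm_co, co_mul_pr_of_le 𝒩 le_rfl]; rfl
      rw [h2, inner_zero_left]
    rw [this, mul_zero]
  · rw [ff_pr 𝒩 (e k) h, inner_zero_left, zero_mul]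

theorem erd_apply_pr {e : ℕ → H} (he : 𝒩.CycSeq e) {m k : ℕ} (hk : k < m) (t : ℝ) :
    𝒩.erd e m (𝒩.pr t (e k)) = ∑ i ∈ Finset.range m,
      (inner ℂ (𝒩.ff (e k) m (i + 1)) (𝒩.pr t (e k)) : ℂ) • 𝒩.ff (e k) m i := by
  unfold erd
  rw [shiftOp_apply, Finset.sum_product]
  rw [Finset.sum_eq_single k]
  · intro l _ hl
    apply Finset.sum_eq_zero
    intro i _
    rw [ff_cross' 𝒩 (he l k hl), zero_smul]
  · intro h
    exact absurd (Finset.mem_range.2 hk) h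

theorem erd_step {e : ℕ → H} (he : 𝒩.CycSeq e) {m k : ℕ} (hk : k < m) {j : ℕ} (hj : j ≤ m) :
    𝒩.erd e m (𝒩.pr (𝒩.pts (e k) m (j + 1)) (e k)) = 𝒩.pr (𝒩.pts (e k) m j) (e k) := by
  by_cases hz : e k = 0
  · rw [hz]; simp
  have hz' : ‖e k‖ ≠ 0 := by simpa using hz
  have h0 : 𝒩.pr (𝒩.pts (e k) m 0) (e k) = 0 := by
    have := pts_spec 𝒩 (e k) m (i := 0) (by omega)
    simpa using this
  have hd : ∀ n, 𝒩.erd e m (𝒩.dl (e k) m n) = ∑ i ∈ Finset.range m,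
      (inner ℂ (𝒩.ff (e k) m (i + 1)) (𝒩.dl (e k) m n) : ℂ) • 𝒩.ff (e k) m i := by
    intro n
    unfold dl
    rw [map_sub, erd_apply_pr he hk, erd_apply_pr he hk, ← Finset.sum_sub_distrib]
    simp only [inner_sub_right, sub_smul]
  have hin : ∀ i n, i ≠ n → inner ℂ (𝒩.ff (e k) m i) (𝒩.dl (e k) m n) = 0 := by
    intro i n hne
    unfold ff
    rw [inner_smul_left]
    rcases hne.lt_or_gt with h | h
    · rw [dl_inner 𝒩 _ h]; simp
    · rw [← inner_conj_symm, dl_inner 𝒩 _ h]; simp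
  have hd0 : 𝒩.erd e m (𝒩.dl (e k) m 0) = 0 := by
    rw [hd]
    apply Finset.sum_eq_zero
    intro i _
    rw [hin _ _ (by omega), zero_smul]
  have hds : ∀ n < m, 𝒩.erd e m (𝒩.dl (e k) m (n + 1)) = 𝒩.dl (e k) m n := by
    intro n hn
    rw [hd, Finset.sum_eq_single n]
    · unfold ff
      rw [inner_smul_left, inner_self_eq_norm_sq_to_K, smul_smul]
      have h1 := dl_norm 𝒩 (e k) (m := m) (i := n + 1) (by omega)
      have h2 : (starRingEnd ℂ) ((Real.sqrt (m + 1) / ‖e k‖ : ℝ) : ℂ) *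
          ((‖𝒩.dl (e k) m (n + 1)‖ : ℝ) : ℂ) ^ 2 * ((Real.sqrt (m + 1) / ‖e k‖ : ℝ) : ℂ) = 1 := by
        rw [Complex.conj_ofReal]
        norm_cast
        rw [h1]
        have : Real.sqrt (m + 1) * Real.sqrt (m + 1) = m + 1 := Real.mul_self_sqrt (by positivity)
        field_simp
        rw [sq, ← this]
        push_cast
        rfl
      exact (congrArg (fun z : ℂ => z • 𝒩.dl (e k) m n) h2).trans (one_smul _ _)
    · intro i _ hi
      rw [hin _ _ (by omega), zero_smul]
    · intro h
      exact absurd (Finset.mem_range.2 hn) h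
  have hsplit : ∀ n, 𝒩.pr (𝒩.pts (e k) m (n + 1)) (e k)
      = 𝒩.pr (𝒩.pts (e k) m n) (e k) + 𝒩.dl (e k) m n := by
    intro n; unfold dl; abel
  induction j with
  | zero => rw [hsplit, map_add, hd0, h0, map_zero, add_zero]
  | succ j ih =>
    rw [hsplit (j + 1), map_add, ih (by omega), hds j (by omega)]
    rw [← hsplit]

theorem erd_close {e : ℕ → H} (he : 𝒩.CycSeq e) {m k : ℕ} (hk : k < m) (t : ℝ) :
    ‖𝒩.erd e m (𝒩.pr t (e k)) - 𝒩.pr t (e k)‖ ≤ 2 * (‖e k‖ / Real.sqrt (m + 1)) := by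
  have hm1 : (0 : ℝ) < m + 1 := by positivity
  -- find j
  have hle : ‖𝒩.pr t (e k)‖ ^ 2 ≤ ‖e k‖ ^ 2 := by
    have h1 : ‖𝒩.pr t (e k)‖ ≤ 1 * ‖e k‖ := (𝒩.pr t).le_of_opNorm_le (𝒩.pr_norm t) _
    rw [one_mul] at h1
    gcongr
  have hj : ∃ j ≤ m, (j / (m + 1 : ℝ)) * ‖e k‖ ^ 2 ≤ ‖𝒩.pr t (e k)‖ ^ 2 ∧
      ‖𝒩.pr t (e k)‖ ^ 2 ≤ ((j + 1 : ℕ) / (m + 1 : ℝ)) * ‖e k‖ ^ 2 := by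
    by_contra hcon
    push Not at hcon
    have : ∀ j ≤ m + 1, (j / (m + 1 : ℝ)) * ‖e k‖ ^ 2 ≤ ‖𝒩.pr t (e k)‖ ^ 2 := by
      intro j
      induction j with
      | zero => intro _; simp
      | succ j ih =>
        intro hj
        exact (hcon j (by omega) (ih (by omega))).le
    have h2 := hcon m le_rfl (this m (by omega))
    push_cast at h2
    rw [div_self hm1.ne', one_mul] at h2
    linarith
  obtain ⟨j, hjm, h1, h2⟩ := hj
  have e1 : ‖𝒩.pr t (e k) - 𝒩.pr (𝒩.pts (e k) m j) (e k)‖ ^ 2 ≤ ‖e k‖ ^ 2 / (m + 1) := by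
    rw [pr_pyth_abs, pts_spec 𝒩 (e k) m (by omega), abs_of_nonneg (by linarith)]
    push_cast at h2
    have : ((j + 1 : ℝ) / (m + 1 : ℝ)) * ‖e k‖ ^ 2 - (j / (m + 1 : ℝ)) * ‖e k‖ ^ 2 = ‖e k‖ ^ 2 / (m + 1) := by
      field_simp; ring
    linarith
  have e2 : ‖𝒩.pr t (e k) - 𝒩.pr (𝒩.pts (e k) m (j + 1)) (e k)‖ ^ 2 ≤ ‖e k‖ ^ 2 / (m + 1) := by
    rw [pr_pyth_abs, pts_spec 𝒩 (e k) m (by omega), abs_of_nonpos (by linarith)]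
    push_cast at h2 ⊢
    have : ((j + 1 : ℝ) / (m + 1 : ℝ)) * ‖e k‖ ^ 2 - (j / (m + 1 : ℝ)) * ‖e k‖ ^ 2 = ‖e k‖ ^ 2 / (m + 1) := by
      field_simp; ring
    linarith
  have hs : ∀ x : ℝ, 0 ≤ x → x ^ 2 ≤ ‖e k‖ ^ 2 / (m + 1) → x ≤ ‖e k‖ / Real.sqrt (m + 1) := by
    intro x hx h
    rw [← sq_le_sq₀ hx (by positivity), div_pow, Real.sq_sqrt hm1.le]
    exact h
  have f1 := hs _ (norm_nonneg _) e1
  have f2 := hs _ (norm_nonneg _) e2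
  have f3 : 𝒩.erd e m (𝒩.pr t (e k)) - 𝒩.pr t (e k)
      = 𝒩.erd e m (𝒩.pr t (e k) - 𝒩.pr (𝒩.pts (e k) m (j + 1)) (e k))
        - (𝒩.pr t (e k) - 𝒩.pr (𝒩.pts (e k) m j) (e k)) := by
    rw [map_sub, erd_step he hk hjm]; abel
  rw [f3]
  have f4 : ‖𝒩.erd e m (𝒩.pr t (e k) - 𝒩.pr (𝒩.pts (e k) m (j + 1)) (e k))‖
      ≤ 1 * ‖𝒩.pr t (e k) - 𝒩.pr (𝒩.pts (e k) m (j + 1)) (e k)‖ :=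
    (𝒩.erd e m).le_of_opNorm_le (erd_norm he m) _
  calc _ ≤ _ := norm_sub_le _ _
    _ ≤ _ := by linarith

theorem erd_tendsto {e : ℕ → H} (he : 𝒩.CycSeq e) (k : ℕ) (t : ℝ) :
    Tendsto (fun m => 𝒩.erd e m (𝒩.pr t (e k))) atTop (𝓝 (𝒩.pr t (e k))) := by
  rw [tendsto_iff_norm_sub_tendsto_zero]
  have h1 : Tendsto (fun m : ℕ => 2 * (‖e k‖ / Real.sqrt (m + 1))) atTop (𝓝 (2 * 0)) := by
    apply Tendsto.const_mul
    apply Tendsto.div_atTop tendsto_const_nhds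
    apply Real.tendsto_sqrt_atTop.comp
    exact tendsto_atTop_add_const_right _ _ tendsto_natCast_atTop_atTop
  rw [mul_zero] at h1
  refine squeeze_zero' (Eventually.of_forall fun _ => norm_nonneg _) ?_ h1
  filter_upwards [eventually_gt_atTop k] with m hm
  exact erd_close he hm t

end ContinuousNest

open Set Filter Topology
set_option linter.unusedSectionVars false

namespace ContinuousNest

variable {H : Type*} [NormedAddCommGroup H] [InnerProductSpace ℂ H] [CompleteSpace H]
variable (𝒩 : ContinuousNest H)

/-- closed invariant subspace generated by a set of vectors -/
def gen (S : Set H) : Submodule ℂ H :=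
  (Submodule.span ℂ {x | ∃ v ∈ S, ∃ t, x = 𝒩.pr t v}).topologicalClosure

theorem gen_le {S : Set H} {M : Submodule ℂ H} (hM : IsClosed (M : Set H))
    (h : ∀ v ∈ S, ∀ t, 𝒩.pr t v ∈ M) : 𝒩.gen S ≤ M := by
  refine Submodule.topologicalClosure_minimal _ ?_ hM
  rw [Submodule.span_le]
  rintro _ ⟨v, hv, t, rfl⟩
  exact h v hv t

theorem gen_closed (S : Set H) : IsClosed (𝒩.gen S : Set H) := Submodule.isClosed_topologicalClosure _

theorem pr_mem_gen {S : Set H} {v : H} (hv : v ∈ S) (t : ℝ) : 𝒩.pr t v ∈ 𝒩.gen S :=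
  Submodule.le_topologicalClosure _ (Submodule.subset_span ⟨v, hv, t, rfl⟩)

theorem mem_gen {S : Set H} {v : H} (hv : v ∈ S) : v ∈ 𝒩.gen S := by
  have := 𝒩.pr_mem_gen hv 1
  rwa [pr_one] at this

theorem gen_inv {S : Set H} {x : H} (hx : x ∈ 𝒩.gen S) (s : ℝ) : 𝒩.pr s x ∈ 𝒩.gen S := by
  have : 𝒩.gen S ≤ (𝒩.gen S).comap (𝒩.pr s).toLinearMap := by
    apply gen_le
    · exact (𝒩.gen_closed S).preimage (𝒩.pr s).continuous
    · intro v hv t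
      change 𝒩.pr s (𝒩.pr t v) ∈ 𝒩.gen S
      rw [pr_apply_pr]
      exact 𝒩.pr_mem_gen hv _
  exact this hx

theorem exists_cyc [TopologicalSpace.SeparableSpace H] :
    ∃ e : ℕ → H, 𝒩.CycSeq e ∧ 𝒩.gen (range e) = ⊤ := by
  obtain ⟨v, hv⟩ := TopologicalSpace.exists_dense_seq H
  have h1 : ∀ k, ∃ e, e ∈ (𝒩.gen (v '' {j | j < k}))ᗮ ∧ v k - e ∈ 𝒩.gen (v '' {j | j < k}) := by
    intro k
    have : CompleteSpace (𝒩.gen (v '' {j | j < k})) := (𝒩.gen_closed _).completeSpace_coe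
    obtain ⟨y, hy, z, hz, h⟩ := (𝒩.gen (v '' {j | j < k})).exists_add_mem_mem_orthogonal (v k)
    refine ⟨z, hz, ?_⟩
    rw [h, add_sub_cancel_right]
    exact hy
  choose e he1 he2 using h1
  refine ⟨e, ?_, ?_⟩
  · have key : ∀ k l, k < l → ∀ s t, inner ℂ (𝒩.pr s (e k)) (𝒩.pr t (e l)) = 0 := by
      intro k l hkl s t
      rw [← pr_inner, pr_apply_pr]
      have hm : e k ∈ 𝒩.gen (v '' {j | j < l}) := by
        have a1 : v k ∈ 𝒩.gen (v '' {j | j < l}) := 𝒩.mem_gen ⟨k, hkl, rfl⟩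
        have a2 : v k - e k ∈ 𝒩.gen (v '' {j | j < l}) := by
          refine 𝒩.gen_le (𝒩.gen_closed _) ?_ (he2 k)
          rintro _ ⟨j, hj, rfl⟩ t
          exact 𝒩.pr_mem_gen (S := v '' {j | j < l}) ⟨j, lt_trans hj hkl, rfl⟩ t
        have := Submodule.sub_mem _ a1 a2
        simpa using this
      exact he1 l _ (𝒩.gen_inv hm _)
    intro k l hkl s t
    rcases hkl.lt_or_gt with h | h
    · exact key k l h s t
    · rw [← inner_conj_symm, key l k h t s, map_zero]
  · have hmem : ∀ k, v k ∈ 𝒩.gen (range e) := by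
      intro k
      induction k using Nat.strong_induction_on with
      | _ k ih =>
        have a1 : v k - e k ∈ 𝒩.gen (range e) := by
          refine 𝒩.gen_le (𝒩.gen_closed _) ?_ (he2 k)
          rintro _ ⟨j, hj, rfl⟩ t
          exact 𝒩.gen_inv (ih j hj) t
        have := Submodule.add_mem _ a1 (𝒩.mem_gen (mem_range_self k))
        simpa using this
    rw [eq_top_iff]
    intro x _
    have : closure (range v) ⊆ (𝒩.gen (range e) : Set H) :=
      closure_minimal (by rintro _ ⟨k, rfl⟩; exact hmem k) (𝒩.gen_closed _)
    exact this (hv x)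

/-- set of vectors on which a bounded sequence converges strongly to the identity is closed -/
theorem strong_closed {r : ℕ → H →L[ℂ] H} (hr : ∀ n, ‖r n‖ ≤ 1) :
    IsClosed {v | Tendsto (fun n => r n v) atTop (𝓝 v)} := by
  rw [← isSeqClosed_iff_isClosed]
  intro x v hx hxv
  rw [mem_ofPred_eq, Metric.tendsto_atTop]
  intro ε hε
  rw [Metric.tendsto_atTop] at hxv
  obtain ⟨k, hk⟩ := hxv (ε / 3) (by positivity)
  have hk := hk k le_rfl
  obtain ⟨n₀, hn⟩ := (Metric.tendsto_atTop.1 (hx k)) (ε / 3) (by positivity)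
  refine ⟨n₀, fun n hnn => ?_⟩
  have h1 := hn n hnn
  rw [dist_eq_norm] at *
  have e : r n v - v = r n (v - x k) + (r n (x k) - x k) + (x k - v) := by
    rw [map_sub]; abel
  have h2 : ‖r n (v - x k)‖ ≤ 1 * ‖v - x k‖ := (r n).le_of_opNorm_le (hr n) _
  rw [norm_sub_rev v] at h2
  rw [e]
  calc _ ≤ ‖r n (v - x k)‖ + ‖r n (x k) - x k‖ + ‖x k - v‖ := norm_add₃_le
    _ < ε := by linarith

theorem strong_adjoint {r : ℕ → H →L[ℂ] H} (hr : ∀ n, ‖r n‖ ≤ 1)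
    (h : ∀ v, Tendsto (fun n => r n v) atTop (𝓝 v)) (v : H) :
    Tendsto (fun n => star (r n) v) atTop (𝓝 v) := by
  rw [tendsto_iff_norm_sub_tendsto_zero]
  have key : ∀ n, ‖star (r n) v - v‖ ^ 2 ≤ 2 * ‖v‖ * ‖r n v - v‖ := by
    intro n
    have h1 : ‖star (r n) v‖ ≤ 1 * ‖v‖ :=
      (star (r n)).le_of_opNorm_le (by rw [norm_star]; exact hr n) _
    rw [one_mul] at h1
    have h2 := @norm_sub_sq ℂ H _ _ _ (star (r n) v) v
    have h3 : inner ℂ (star (r n) v) v = inner ℂ v (r n v) :=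
      ContinuousLinearMap.adjoint_inner_left _ _ _
    have h4 : inner ℂ v (r n v) = inner ℂ v (r n v - v) + inner ℂ v v := by
      rw [← inner_add_right, sub_add_cancel]
    have h5 : RCLike.re (inner ℂ v v : ℂ) = ‖v‖ ^ 2 := by
      rw [inner_self_eq_norm_sq]
    have h6 : -(‖v‖ * ‖r n v - v‖) ≤ RCLike.re (inner ℂ v (r n v - v) : ℂ) := by
      have := norm_inner_le_norm (𝕜 := ℂ) v (r n v - v)
      have h7 := RCLike.abs_re_le_norm (inner ℂ v (r n v - v) : ℂ)
      linarith [neg_abs_le (RCLike.re (inner ℂ v (r n v - v) : ℂ))]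
    rw [h3, h4, map_add, h5] at h2
    have h8 : ‖star (r n) v‖ ^ 2 ≤ ‖v‖ ^ 2 := by gcongr
    linarith
  have h0 := (tendsto_iff_norm_sub_tendsto_zero.1 (h v)).const_mul (2 * ‖v‖)
  rw [mul_zero] at h0
  have h1 : Tendsto (fun n => ‖star (r n) v - v‖ ^ 2) atTop (𝓝 0) :=
    squeeze_zero (fun _ => sq_nonneg _) key h0
  have h2 := h1.sqrt
  simpa using h2

theorem strong_compact {r : ℕ → H →L[ℂ] H} (hr : ∀ n, ‖r n‖ ≤ 1)
    (h : ∀ v, Tendsto (fun n => r n v) atTop (𝓝 v)) {K : H →L[ℂ] H}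
    (hK : IsCompactOperator ⇑K) : Tendsto (fun n => ‖(r n - 1) * K‖) atTop (𝓝 0) := by
  rw [Metric.tendsto_atTop]
  intro ε hε
  have hc : IsCompact (closure (K '' Metric.closedBall 0 1)) :=
    hK.isCompact_closure_image_closedBall 1
  obtain ⟨t, _, htf, ht⟩ := hc.finite_cover_balls (e := ε / 8) (by positivity)
  have h1 : ∀ᶠ n in atTop, ∀ y ∈ t, ‖r n y - y‖ < ε / 8 := by
    rw [htf.eventually_all]
    intro y _
    have := tendsto_iff_norm_sub_tendsto_zero.1 (h y)
    exact this.eventually_lt_const (by positivity)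
  obtain ⟨n₀, hn₀⟩ := eventually_atTop.1 h1
  refine ⟨n₀, fun n hn => ?_⟩
  rw [dist_zero_right, Real.norm_of_nonneg (norm_nonneg _)]
  have h2 : ‖(r n - 1) * K‖ ≤ ε / 2 := by
    refine ContinuousLinearMap.opNorm_le_of_unit_norm (by positivity) ?_
    intro x hx
    have hKx : K x ∈ closure (K '' Metric.closedBall 0 1) :=
      subset_closure ⟨x, by simp [hx], rfl⟩
    obtain ⟨y, hy, hd⟩ := mem_iUnion₂.1 (ht hKx)
    rw [Metric.mem_ball, dist_eq_norm] at hd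
    have h3 := hn₀ n hn y hy
    change ‖r n (K x) - K x‖ ≤ _
    have e : r n (K x) - K x = r n (K x - y) + (r n y - y) - (K x - y) := by
      rw [map_sub]; abel
    have h4 : ‖r n (K x - y)‖ ≤ 1 * ‖K x - y‖ := (r n).le_of_opNorm_le (hr n) _
    rw [e]
    calc _ ≤ ‖r n (K x - y) + (r n y - y)‖ + ‖K x - y‖ := norm_sub_le _ _
      _ ≤ ‖r n (K x - y)‖ + ‖r n y - y‖ + ‖K x - y‖ := by gcongr; exact norm_add_le _ _
      _ ≤ ε / 2 := by linarith
  linarith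

theorem exists_erdos [TopologicalSpace.SeparableSpace H] :
    ∃ r : ℕ → H →L[ℂ] H, (∀ n, r n ∈ 𝒩.alg) ∧ (∀ n, ‖r n‖ ≤ 1) ∧
      (∀ n, FiniteDimensional ℂ (LinearMap.range (r n).toLinearMap)) ∧
      (∀ v, Tendsto (fun n => r n v) atTop (𝓝 v)) ∧
      (∀ v, Tendsto (fun n => star (r n) v) atTop (𝓝 v)) := by
  obtain ⟨e, he, hg⟩ := 𝒩.exists_cyc
  have hr := erd_norm he
  have hs : ∀ v, Tendsto (fun n => 𝒩.erd e n v) atTop (𝓝 v) := by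
    let M : Submodule ℂ H :=
      { carrier := {v | Tendsto (fun n => 𝒩.erd e n v) atTop (𝓝 v)}
        add_mem' := by
          intro a b ha hb
          simp only [mem_ofPred_eq, map_add] at *
          exact ha.add hb
        zero_mem' := by simp
        smul_mem' := by
          intro c x hx
          simp only [mem_ofPred_eq, map_smul] at *
          exact hx.const_smul c }
    have : 𝒩.gen (range e) ≤ M := by
      apply gen_le
      · exact strong_closed hr
      · rintro _ ⟨k, rfl⟩ t
        exact erd_tendsto he k t
    rw [hg] at this
    intro v
    exact this (Submodule.mem_top)
  exact ⟨𝒩.erd e, erd_alg e, hr, fun n => shiftOp_finite _ _ _, hs, strong_adjoint hr hs⟩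

end ContinuousNest

open Set Filter Topology
set_option linter.unusedSectionVars false

section Fin
variable {H : Type*} [NormedAddCommGroup H] [InnerProductSpace ℂ H] [CompleteSpace H]

/-- finite rank -/
def FR (F : H →L[ℂ] H) : Prop := FiniteDimensional ℂ (LinearMap.range F.toLinearMap)

theorem FR.zero : FR (0 : H →L[ℂ] H) := by
  unfold FR
  have : LinearMap.range (0 : H →L[ℂ] H).toLinearMap = ⊥ := by
    rw [LinearMap.range_eq_bot]; rfl
  rw [this]
  infer_instance

theorem FR.add {F G : H →L[ℂ] H} (hF : FR F) (hG : FR G) : FR (F + G) := by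
  unfold FR at *
  have hle : LinearMap.range (F + G).toLinearMap ≤
      LinearMap.range F.toLinearMap ⊔ LinearMap.range G.toLinearMap := by
    rintro _ ⟨v, rfl⟩
    exact Submodule.add_mem_sup ⟨v, rfl⟩ ⟨v, rfl⟩
  exact Submodule.finiteDimensional_of_le hle

theorem FR.neg {F : H →L[ℂ] H} (hF : FR F) : FR (-F) := by
  unfold FR at *
  have hle : LinearMap.range (-F).toLinearMap ≤ LinearMap.range F.toLinearMap := by
    rintro _ ⟨v, rfl⟩
    exact ⟨-v, by simp⟩
  exact Submodule.finiteDimensional_of_le hle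

theorem FR.sub {F G : H →L[ℂ] H} (hF : FR F) (hG : FR G) : FR (F - G) := by
  rw [sub_eq_add_neg]; exact hF.add hG.neg

theorem FR.mul_left {F : H →L[ℂ] H} (hF : FR F) (A : H →L[ℂ] H) : FR (A * F) := by
  unfold FR at *
  have : LinearMap.range (A * F).toLinearMap = (LinearMap.range F.toLinearMap).map A.toLinearMap := by
    rw [← LinearMap.range_comp]; rfl
  rw [this]
  infer_instance

theorem FR.mul_right {F : H →L[ℂ] H} (hF : FR F) (A : H →L[ℂ] H) : FR (F * A) := by
  unfold FR at *
  have hle : LinearMap.range (F * A).toLinearMap ≤ LinearMap.range F.toLinearMap := by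
    rintro _ ⟨v, rfl⟩
    exact ⟨A v, rfl⟩
  exact Submodule.finiteDimensional_of_le hle

theorem FR.cpt {F : H →L[ℂ] H} (hF : FR F) : IsCompactOperator ⇑F := by
  unfold FR at *
  have : ProperSpace (LinearMap.range F.toLinearMap) := FiniteDimensional.proper ℂ _
  let G : H →L[ℂ] LinearMap.range F.toLinearMap :=
    F.codRestrict _ (fun v => ⟨v, rfl⟩)
  have hG : IsCompactOperator ⇑G := isCompactOperator_of_locallyCompactSpace_dom G
  exact hG.clm_comp (Submodule.subtypeL _)

/-- projection onto the orthogonal complement of the kernel -/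
noncomputable def kp (F : H →L[ℂ] H) : H →L[ℂ] H := ((LinearMap.ker F.toLinearMap)ᗮ).starProjection

theorem kp_proj (F : H →L[ℂ] H) : IsStarProjection (kp F) := isStarProjection_starProjection

theorem mul_kp (F : H →L[ℂ] H) : F * kp F = F := by
  ext v
  change F (kp F v) = F v
  have hc : IsClosed ((LinearMap.ker F.toLinearMap : Submodule ℂ H) : Set H) := F.isClosed_ker
  have h1 : v - kp F v ∈ (LinearMap.ker F.toLinearMap)ᗮᗮ := Submodule.sub_starProjection_mem_orthogonal v
  have : CompleteSpace (LinearMap.ker F.toLinearMap) := hc.completeSpace_coe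
  rw [Submodule.orthogonal_orthogonal] at h1
  have h2 : F (v - kp F v) = 0 := h1
  rw [map_sub, sub_eq_zero] at h2
  exact h2.symm

theorem FR.kp {F : H →L[ℂ] H} (hF : FR F) : FR (kp F) := by
  unfold FR at *
  have hfd : FiniteDimensional ℂ ((LinearMap.ker F.toLinearMap)ᗮ : Submodule ℂ H) := by
    let G : ((LinearMap.ker F.toLinearMap)ᗮ : Submodule ℂ H) →ₗ[ℂ] LinearMap.range F.toLinearMap :=
      F.toLinearMap.rangeRestrict.comp (Submodule.subtype _)
    apply FiniteDimensional.of_injective G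
    rw [← LinearMap.ker_eq_bot, LinearMap.ker_eq_bot']
    rintro ⟨m, hm⟩ h
    have h1 : F m = 0 := congrArg Subtype.val h
    have h2 := hm m h1
    ext
    exact inner_self_eq_zero.1 h2
  have hle : LinearMap.range (_root_.kp F).toLinearMap ≤ (LinearMap.ker F.toLinearMap)ᗮ := by
    rintro _ ⟨v, rfl⟩
    exact Submodule.starProjection_apply_mem _ v
  exact Submodule.finiteDimensional_of_le hle

theorem FR.star_cpt {F : H →L[ℂ] H} (hF : FR F) : IsCompactOperator ⇑(star F) := by
  have h := congrArg star (mul_kp F)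
  rw [star_mul, (kp_proj F).isSelfAdjoint.star_eq] at h
  rw [← h]
  exact cpt_mul_right hF.kp.cpt _

/-- norm of an almost orthogonal sum -/
theorem norm_add_almost {F T p : H →L[ℂ] H} {m η δ : ℝ} (hp : IsStarProjection p) (hFp : F * p = F)
    (hm : 0 ≤ m) (hF : ‖F‖ ≤ m) (hT : ‖T‖ ≤ m) (h1 : ‖T * p‖ ≤ η) (h2 : ‖star F * T‖ ≤ η)
    (hd : 0 ≤ δ) (e1 : η ≤ δ / 2) (e2 : η ≤ m * δ / 2) : ‖F + T‖ ≤ m + δ := by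
  have hη : 0 ≤ η := (norm_nonneg _).trans h1
  refine ContinuousLinearMap.opNorm_le_bound _ (by positivity) fun v => ?_
  rw [← sq_le_sq₀ (norm_nonneg _) (by positivity)]
  change ‖F v + T v‖ ^ 2 ≤ _
  have h3 := @norm_add_sq ℂ H _ _ _ (F v) (T v)
  have h4 : RCLike.re (inner ℂ (F v) (T v) : ℂ) ≤ η * ‖v‖ ^ 2 := by
    have a1 : inner ℂ (F v) (T v) = inner ℂ v ((star F * T) v) :=
      (ContinuousLinearMap.adjoint_inner_right F v (T v)).symm
    rw [a1]
    have a2 : ‖(star F * T) v‖ ≤ η * ‖v‖ := ContinuousLinearMap.le_of_opNorm_le _ h2 v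
    calc _ ≤ ‖(inner ℂ v ((star F * T) v) : ℂ)‖ := RCLike.re_le_norm _
      _ ≤ ‖v‖ * ‖(star F * T) v‖ := norm_inner_le_norm _ _
      _ ≤ ‖v‖ * (η * ‖v‖) := by gcongr
      _ = _ := by ring
  have hpv : ‖v‖ ^ 2 = ‖p v‖ ^ 2 + ‖v - p v‖ ^ 2 := by
    have h0 : inner ℂ (p v) (v - p v) = 0 := by
      have a1 : inner ℂ (p v) (v - p v) = inner ℂ v (p (v - p v)) := by
        conv_lhs => rw [← hp.isSelfAdjoint.star_eq]
        rw [hp.isSelfAdjoint.star_eq]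
        have := ContinuousLinearMap.adjoint_inner_right p v (v - p v)
        rw [← this]
        have h9 : ContinuousLinearMap.adjoint p = p := hp.isSelfAdjoint.star_eq
        rw [h9]
      have a2 : p (p v) = p v := congrArg (fun A : H →L[ℂ] H => A v) hp.isIdempotentElem.eq
      rw [a1, map_sub, a2, sub_self, inner_zero_right]
    have := norm_add_sq_eq_norm_sq_add_norm_sq_of_inner_eq_zero _ _ h0
    rw [add_sub_cancel] at this
    linarith [sq ‖v‖, sq ‖p v‖, sq ‖v - p v‖]
  have h5 : ‖F v‖ ≤ m * ‖p v‖ := by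
    have : F v = F (p v) := congrArg (fun A : H →L[ℂ] H => A v) hFp.symm
    rw [this]
    exact ContinuousLinearMap.le_of_opNorm_le _ hF _
  have h6 : ‖T v‖ ≤ η * ‖v‖ + m * ‖v - p v‖ := by
    have : T v = (T * p) v + T (v - p v) := by
      rw [map_sub]; change _ = T (p v) + _; abel
    rw [this]
    exact (norm_add_le _ _).trans (add_le_add (ContinuousLinearMap.le_of_opNorm_le _ h1 _)
      (ContinuousLinearMap.le_of_opNorm_le _ hT _))
  have h7 : ‖v - p v‖ ≤ ‖v‖ := by
    rw [← sq_le_sq₀ (norm_nonneg _) (norm_nonneg _)]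
    nlinarith [sq_nonneg ‖p v‖]
  have h8 : ‖F v‖ ^ 2 ≤ m ^ 2 * ‖p v‖ ^ 2 := by
    rw [← mul_pow]; gcongr
  have h9 : ‖T v‖ ^ 2 ≤ (η * ‖v‖ + m * ‖v - p v‖) ^ 2 := by gcongr
  have h10 : (η * ‖v‖ + m * ‖v - p v‖) ^ 2 ≤
      η ^ 2 * ‖v‖ ^ 2 + 2 * η * m * ‖v‖ ^ 2 + m ^ 2 * ‖v - p v‖ ^ 2 := by
    have : η * m * (‖v‖ * ‖v - p v‖) ≤ η * m * (‖v‖ * ‖v‖) := by gcongr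
    nlinarith
  have hsq := sq_nonneg ‖v‖
  have c1 : η ^ 2 + 2 * η * m + 2 * η ≤ 2 * m * δ + δ ^ 2 := by nlinarith
  have c2 : (η ^ 2 + 2 * η * m + 2 * η) * ‖v‖ ^ 2 ≤ (2 * m * δ + δ ^ 2) * ‖v‖ ^ 2 := by gcongr
  rw [h3, mul_pow]
  nlinarith

/-- bounded sesquilinear forms come from operators -/
theorem exists_op_of_form (B : H → H → ℂ) (C : ℝ) (hC : 0 ≤ C)
    (add_r : ∀ w v v', B w (v + v') = B w v + B w v')
    (smul_r : ∀ w (c : ℂ) v, B w (c • v) = c * B w v)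
    (add_l : ∀ w w' v, B (w + w') v = B w v + B w' v)
    (smul_l : ∀ w (c : ℂ) v, B (c • w) v = (starRingEnd ℂ) c * B w v)
    (hB : ∀ w v, ‖B w v‖ ≤ C * ‖w‖ * ‖v‖) :
    ∃ V : H →L[ℂ] H, ‖V‖ ≤ C ∧ ∀ w v, inner ℂ w (V v) = B w v := by
  have h1 : ∀ v, ∃ u : H, ∀ w, inner ℂ w u = B w v := by
    intro v
    let l : H →ₗ[ℂ] ℂ :=
      { toFun := fun w => (starRingEnd ℂ) (B w v)
        map_add' := by intro a b; simp [add_l]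
        map_smul' := by intro c a; simp [smul_l] }
    let L : H →L[ℂ] ℂ := l.mkContinuous (C * ‖v‖) (by
      intro w
      change ‖(starRingEnd ℂ) (B w v)‖ ≤ _
      rw [RCLike.norm_conj]
      calc _ ≤ _ := hB w v
        _ = _ := by ring)
    refine ⟨(InnerProductSpace.toDual ℂ H).symm L, fun w => ?_⟩
    have : inner ℂ ((InnerProductSpace.toDual ℂ H).symm L) w = L w :=
      InnerProductSpace.toDual_symm_apply
    rw [← inner_conj_symm, this]
    change (starRingEnd ℂ) ((starRingEnd ℂ) (B w v)) = _
    simp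
  choose V hV using h1
  let V' : H →ₗ[ℂ] H :=
    { toFun := V
      map_add' := by
        intro a b
        apply ext_inner_left ℂ
        intro w
        rw [hV, inner_add_right, hV, hV, add_r]
      map_smul' := by
        intro c a
        apply ext_inner_left ℂ
        intro w
        rw [hV, inner_smul_right, RingHom.id_apply, hV, smul_r] }
  have hb : ∀ v, ‖V' v‖ ≤ C * ‖v‖ := by
    intro v
    by_cases h0 : ‖V v‖ = 0
    · change ‖V v‖ ≤ _
      rw [h0]; positivity
    · have h2 := hB (V v) v
      rw [← hV, inner_self_eq_norm_sq_to_K] at h2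
      have h3 : ‖V v‖ ^ 2 ≤ C * ‖V v‖ * ‖v‖ := by
        simpa using h2
      have h4 : 0 < ‖V v‖ := lt_of_le_of_ne (norm_nonneg _) (Ne.symm h0)
      change ‖V v‖ ≤ _
      nlinarith
  exact ⟨V'.mkContinuous C hb, LinearMap.mkContinuous_norm_le _ hC _, fun w v => hV v w⟩

theorem exists_weak_limit (S : ℕ → H →L[ℂ] H) {C : ℝ} (hS : ∀ n, ‖S n‖ ≤ C) :
    ∃ V : H →L[ℂ] H, ‖V‖ ≤ C ∧ ∀ w v,
      Tendsto (fun n => inner ℂ w (S n v)) (hyperfilter ℕ : Filter ℕ) (𝓝 (inner ℂ w (V v))) := by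
  have hC : 0 ≤ C := (norm_nonneg _).trans (hS 0)
  have hb : ∀ w v n, ‖(inner ℂ w (S n v) : ℂ)‖ ≤ C * ‖w‖ * ‖v‖ := by
    intro w v n
    calc _ ≤ ‖w‖ * ‖S n v‖ := norm_inner_le_norm _ _
      _ ≤ ‖w‖ * (C * ‖v‖) := by gcongr; exact ContinuousLinearMap.le_of_opNorm_le _ (hS n) _
      _ = _ := by ring
  have h1 : ∀ w v, ∃ z : ℂ, ‖z‖ ≤ C * ‖w‖ * ‖v‖ ∧
      Tendsto (fun n => (inner ℂ w (S n v) : ℂ)) (hyperfilter ℕ : Filter ℕ) (𝓝 z) := by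
    intro w v
    have hK : IsCompact (Metric.closedBall (0 : ℂ) (C * ‖w‖ * ‖v‖)) := isCompact_closedBall _ _
    obtain ⟨z, hz, hle⟩ := hK.ultrafilter_le_nhds
      ((hyperfilter ℕ).map (fun n => (inner ℂ w (S n v) : ℂ))) (by
        rw [le_principal_iff]
        refine Filter.mem_map.2 (Filter.univ_mem' fun n => ?_)
        simpa using hb w v n)
    exact ⟨z, by simpa using hz, hle⟩
  choose B hB1 hB2 using h1
  obtain ⟨V, hV, hVB⟩ := exists_op_of_form B C hC
    (fun w v v' => tendsto_nhds_unique (hB2 w (v + v')) (by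
      simpa only [map_add, inner_add_right] using (hB2 w v).add (hB2 w v')))
    (fun w c v => tendsto_nhds_unique (hB2 w (c • v)) (by
      simpa only [map_smul, inner_smul_right] using (hB2 w v).const_mul c))
    (fun w w' v => tendsto_nhds_unique (hB2 (w + w') v) (by
      simpa only [inner_add_left] using (hB2 w v).add (hB2 w' v)))
    (fun w c v => tendsto_nhds_unique (hB2 (c • w) v) (by
      simpa only [inner_smul_left] using (hB2 w v).const_mul _))
    hB1
  refine ⟨V, hV, fun w v => ?_⟩
  rw [hVB]
  exact hB2 w v

theorem weak_limit_compress {S : ℕ → H →L[ℂ] H} {V W p q : H →L[ℂ] H}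
    (hV : ∀ w v, Tendsto (fun n => (inner ℂ w (S n v) : ℂ)) (hyperfilter ℕ : Filter ℕ)
      (𝓝 (inner ℂ w (V v))))
    (hW : ∀ v, Tendsto (fun n => (p * S n * q) v) atTop (𝓝 (W v))) : p * V * q = W := by
  ext v
  apply ext_inner_left ℂ
  intro w
  have h1 : Tendsto (fun n => (inner ℂ w ((p * S n * q) v) : ℂ)) (hyperfilter ℕ : Filter ℕ)
      (𝓝 (inner ℂ w (W v))) := by
    have : Tendsto (fun n => (inner ℂ w ((p * S n * q) v) : ℂ)) atTop (𝓝 (inner ℂ w (W v))) :=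
      (tendsto_const_nhds).inner (hW v)
    refine this.mono_left ?_
    rw [← Nat.cofinite_eq_atTop]
    exact hyperfilter_le_cofinite
  have h2 : Tendsto (fun n => (inner ℂ w ((p * S n * q) v) : ℂ)) (hyperfilter ℕ : Filter ℕ)
      (𝓝 (inner ℂ w ((p * V * q) v))) := by
    have := hV (ContinuousLinearMap.adjoint p w) (q v)
    simp only [ContinuousLinearMap.adjoint_inner_left] at this
    exact this
  exact tendsto_nhds_unique h2 h1

theorem dep_seq {α : Type*} (P : ℕ → α → Prop) (R : ℕ → α → α → Prop) (a : α) (h0 : P 0 a)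
    (h : ∀ n a, P n a → ∃ b, P (n + 1) b ∧ R n a b) :
    ∃ f : ℕ → α, f 0 = a ∧ (∀ n, P n (f n)) ∧ ∀ n, R n (f n) (f (n + 1)) := by
  choose! g hg using h
  let f : ℕ → α := fun n => Nat.rec a (fun k x => g k x) n
  have hP : ∀ n, P n (f n) := by
    intro n
    induction n with
    | zero => exact h0
    | succ n ih => exact (hg n _ ih).1
  exact ⟨f, rfl, hP, fun n => (hg n _ (hP n)).2⟩

end Fin

open Set Filter Topology
set_option linter.unusedSectionVars false

section Chain
variable {H : Type*} [NormedAddCommGroup H] [InnerProductSpace ℂ H] [CompleteSpace H]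

/-- finite rank approximate identity -/
structure AI (r : ℕ → H →L[ℂ] H) : Prop where
  norm : ∀ n, ‖r n‖ ≤ 1
  fr : ∀ n, FR (r n)
  conv : ∀ v, Tendsto (fun n => r n v) atTop (𝓝 v)
  conv_star : ∀ v, Tendsto (fun n => star (r n) v) atTop (𝓝 v)

theorem AI.left {r : ℕ → H →L[ℂ] H} (h : AI r) {K : H →L[ℂ] H} (hK : IsCompactOperator ⇑K) :
    Tendsto (fun n => ‖(r n - 1) * K‖) atTop (𝓝 0) := ContinuousNest.strong_compact h.norm h.conv hK

theorem AI.star_cpt {r : ℕ → H →L[ℂ] H} (h : AI r) {K : H →L[ℂ] H} (hK : IsCompactOperator ⇑K) :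
    IsCompactOperator ⇑(star K) := by
  have hc : IsClosed {f : H →L[ℂ] H | IsCompactOperator ⇑f} := isClosed_setOfPred_isCompactOperator
  have h1 : Tendsto (fun n => star K * star (r n)) atTop (𝓝 (star K)) := by
    rw [tendsto_iff_norm_sub_tendsto_zero]
    refine (h.left hK).congr fun n => ?_
    rw [← norm_star, star_mul, star_sub, star_one, mul_sub, mul_one]
  exact hc.mem_of_tendsto h1 (Eventually.of_forall fun n => cpt_mul_left _ (h.fr n).star_cpt)

theorem AI.right {r : ℕ → H →L[ℂ] H} (h : AI r) {K : H →L[ℂ] H} (hK : IsCompactOperator ⇑K) :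
    Tendsto (fun n => ‖K * (r n - 1)‖) atTop (𝓝 0) := by
  have := ContinuousNest.strong_compact (r := fun n => star (r n)) (fun n => by rw [norm_star]; exact h.norm n)
    h.conv_star (h.star_cpt hK)
  refine this.congr fun n => ?_
  rw [← norm_star, star_mul, star_star, star_sub, star_one, star_star]

theorem chain_construct {r : ℕ → H →L[ℂ] H} (hr : AI r) (D K : ℕ → H →L[ℂ] H)
    (L : ℕ → ℕ → H →L[ℂ] H) {M ε : ℝ} (hε : 0 < ε) (hD : ∀ j, ‖D j‖ ≤ M)
    (hK : ∀ j, IsCompactOperator ⇑(K j)) (hDK : ∀ j, ‖D j - K j‖ ≤ ε)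
    (hL : ∀ j i, IsCompactOperator ⇑(L j i)) :
    ∃ n : ℕ → ℕ, (∀ j, j ≤ n j) ∧
      (∀ N, ‖∑ j ∈ Finset.range N, D j * (r (n (j + 1)) - r (n j))‖ ≤ 8 * ε) ∧
      ∀ j, ∀ i ≤ j, ‖L j i * (r (n (j + 1)) - r (n j))‖ ≤ 2 * (1 / 2) ^ j := by
  have hM : 0 ≤ M := (norm_nonneg _).trans (hD 0)
  let δ : ℕ → ℝ := fun j => ε * (1 / 2) ^ j / 4
  have hδ : ∀ j, 0 < δ j := fun j => by positivity
  let η : ℕ → ℝ := fun j => min (δ j / 2) (3 * ε * δ j / 2) / (2 * (M + 1))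
  have hη : ∀ j, 0 < η j := fun j => by
    have := hδ j
    have : 0 < min (δ j / 2) (3 * ε * δ j / 2) := lt_min (by positivity) (by positivity)
    positivity
  have hη2 : ∀ j, 2 * (M + 1) * η j = min (δ j / 2) (3 * ε * δ j / 2) := fun j => by
    simp only [η]; field_simp
  let G : ℕ → (H →L[ℂ] H) → ℕ → Prop := fun j A n =>
    j ≤ n ∧ ‖(r n - 1) * kp A‖ ≤ η j ∧ ‖(star A * D j) * (r n - 1)‖ ≤ η j ∧
    ‖K j * (r n - 1)‖ ≤ ε / 2 ∧ ∀ i ∈ Finset.range (j + 1), ‖L j i * (r n - 1)‖ ≤ (1 / 2) ^ j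
  have ev : ∀ {f : ℕ → ℝ} {a : ℝ}, Tendsto f atTop (𝓝 0) → 0 < a → ∀ᶠ n in atTop, f n ≤ a :=
    fun h ha => (h.eventually (Iio_mem_nhds ha)).mono fun n hn => le_of_lt hn
  have hG : ∀ j A, FR A → ∀ᶠ n in atTop, G j A n := by
    intro j A hA
    refine (eventually_ge_atTop j).and ((ev (hr.left hA.kp.cpt) (hη j)).and
      ((ev (hr.right (cpt_mul_right hA.star_cpt _)) (hη j)).and
      ((ev (hr.right (hK j)) (by positivity)).and ?_)))
    rw [Filter.eventually_all_finset]
    exact fun i _ => ev (hr.right (hL j i)) (by positivity)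
  let B : ℕ → ℝ := fun j => ε * (4 - (1 / 2) ^ j)
  let P : ℕ → (H →L[ℂ] H) × (H →L[ℂ] H) × ℕ → Prop := fun j s =>
    G j s.1 s.2.2 ∧ FR s.1 ∧ FR s.2.1 ∧ ‖s.1‖ ≤ B j ∧ ‖s.2.1‖ ≤ B (j + 1)
  let R : ℕ → (H →L[ℂ] H) × (H →L[ℂ] H) × ℕ → (H →L[ℂ] H) × (H →L[ℂ] H) × ℕ → Prop :=
    fun j s s' => G j s.1 s'.2.2 ∧ s'.1 = s.2.1 ∧ s'.2.1 = s.1 + D j * (r s'.2.2 - r s.2.2)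
  have hB : ∀ j, 3 * ε ≤ B j := fun j => by
    have : ((1 : ℝ) / 2) ^ j ≤ 1 := pow_le_one₀ (by norm_num) (by norm_num)
    simp only [B]; nlinarith
  obtain ⟨n0, hn0⟩ := (hG 0 0 FR.zero).exists
  obtain ⟨f, f0, fP, fR⟩ := dep_seq P R (0, 0, n0)
    ⟨hn0, FR.zero, FR.zero, by rw [norm_zero]; linarith [hB 0], by rw [norm_zero]; linarith [hB (0 + 1)]⟩ (by
      rintro j ⟨A, A', n⟩ ⟨g, fA, fA', bA, bA'⟩
      obtain ⟨n', g1, g2⟩ := ((hG j A fA).and (hG (j + 1) A' fA')).exists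
      refine ⟨(A', A + D j * (r n' - r n), n'), ⟨g2, fA', ?_, bA', ?_⟩, g1, rfl, rfl⟩
      · exact fA.add (((hr.fr _).sub (hr.fr _)).mul_left _)
      · change ‖A + D j * (r n' - r n)‖ ≤ B (j + 2)
        simp only at bA bA' g
        have e1 : r n' - r n = (r n' - 1) - (r n - 1) := by abel
        have hT : ‖D j * (r n' - r n)‖ ≤ B j := by
          refine le_trans ?_ (hB j)
          have : D j * (r n' - r n) = (D j - K j) * (r n' - r n) +
            (K j * (r n' - 1) - K j * (r n - 1)) := by noncomm_ring
          rw [this]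
          have b1 : ‖(D j - K j) * (r n' - r n)‖ ≤ ε * 2 := by
            refine (norm_mul_le _ _).trans (mul_le_mul (hDK j) ?_ (norm_nonneg _) hε.le)
            exact (norm_sub_le _ _).trans (by linarith [hr.norm n, hr.norm n'])
          have b2 := norm_sub_le (K j * (r n' - 1)) (K j * (r n - 1))
          have b3 := g1.2.2.2.1
          have b4 := g.2.2.2.1
          have b5 := norm_add_le ((D j - K j) * (r n' - r n)) (K j * (r n' - 1) - K j * (r n - 1))
          linarith
        have h1 : ‖D j * (r n' - r n) * kp A‖ ≤ 2 * (M + 1) * η j := by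
          have : D j * (r n' - r n) * kp A = D j * ((r n' - 1) * kp A - (r n - 1) * kp A) := by
            noncomm_ring
          rw [this]
          have b1 := norm_sub_le ((r n' - 1) * kp A) ((r n - 1) * kp A)
          have b2 := g1.2.1
          have b3 := g.2.1
          calc _ ≤ ‖D j‖ * ‖(r n' - 1) * kp A - (r n - 1) * kp A‖ := norm_mul_le _ _
            _ ≤ (M + 1) * (2 * η j) := by
              gcongr
              · linarith [hD j]
              · linarith
            _ = _ := by ring
        have h2 : ‖star A * (D j * (r n' - r n))‖ ≤ 2 * (M + 1) * η j := by
          have : star A * (D j * (r n' - r n)) =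
              (star A * D j) * (r n' - 1) - (star A * D j) * (r n - 1) := by noncomm_ring
          rw [this]
          have b1 := norm_sub_le ((star A * D j) * (r n' - 1)) ((star A * D j) * (r n - 1))
          have b2 := g1.2.2.1
          have b3 := g.2.2.1
          have b4 := hη j
          nlinarith
        have key := norm_add_almost (kp_proj A) (mul_kp A) (by linarith [hB j]) bA hT h1 h2 (hδ j).le
          (by rw [hη2]; exact min_le_left _ _) (by
            rw [hη2]; refine (min_le_right _ _).trans ?_
            have := hB j
            have := hδ j
            gcongr)
        refine key.trans ?_
        simp only [B, δ, pow_add]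
        have : 0 < ε * (1 / 2 : ℝ) ^ j := by positivity
        nlinarith)
  refine ⟨fun j => (f j).2.2, fun j => (fP j).1.1, ?_, ?_⟩
  · intro N
    have hs : ∀ N, ∑ j ∈ Finset.range N, D j * (r (f (j + 1)).2.2 - r (f j).2.2) =
        (f N).1 + (f N).2.1 := by
      intro N
      induction N with
      | zero => simp [f0]
      | succ N ih =>
        rw [Finset.sum_range_succ, ih, (fR N).2.1, (fR N).2.2]
        abel
    rw [hs]
    have b1 := (fP N).2.2.2.1
    have b2 := (fP N).2.2.2.2
    have b3 := norm_add_le (f N).1 (f N).2.1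
    have : ∀ j, B j ≤ 4 * ε := fun j => by
      have : 0 < ε * (1 / 2 : ℝ) ^ j := by positivity
      simp only [B]; nlinarith
    linarith [this N, this (N + 1)]
  · intro j i hi
    have e1 : L j i * (r (f (j + 1)).2.2 - r (f j).2.2) =
      L j i * (r (f (j + 1)).2.2 - 1) - L j i * (r (f j).2.2 - 1) := by noncomm_ring
    have b1 := (fP j).1.2.2.2.2 i (by simp; omega)
    have b2 := (fR j).1.2.2.2.2 i (by simp; omega)
    change ‖L j i * (r (f (j + 1)).2.2 - r (f j).2.2)‖ ≤ _
    rw [e1]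
    exact (norm_sub_le _ _).trans (by linarith)

end Chain

open Set Filter Topology
set_option linter.unusedSectionVars false

namespace ContinuousNest
variable {H : Type*} [NormedAddCommGroup H] [InnerProductSpace ℂ H] [CompleteSpace H]
variable (𝒩 : ContinuousNest H)

/-- compression of `X` to the corner given by `a` -/
noncomputable def cor (X : H →L[ℂ] H) (a : ℝ × ℝ) : H →L[ℂ] H := 𝒩.co a.1 * X * 𝒩.pr a.2

/-- `X` is null on `a` -/
def Null (X : H →L[ℂ] H) (a : ℝ × ℝ) : Prop := IsCompactOperator ⇑(𝒩.cor X a)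

/-- intersection of corners -/
def meet (a b : ℝ × ℝ) : ℝ × ℝ := (max a.1 b.1, min a.2 b.2)

/-- increasing sequences of intervals -/
def Chn (f : ℕ → ℝ × ℝ) : Prop := ∀ j k, j ≤ k → (f k).1 ≤ (f j).1 ∧ (f j).2 ≤ (f k).2

variable {𝒩}

theorem meet_comm (a b : ℝ × ℝ) : meet a b = meet b a := by
  simp [meet, max_comm, min_comm]

theorem meet_assoc (a b c : ℝ × ℝ) : meet (meet a b) c = meet a (meet b c) := by
  simp [meet, max_assoc, min_assoc]

theorem meet_self (a : ℝ × ℝ) : meet a a = a := by simp [meet]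

theorem cor_cor (X : H →L[ℂ] H) (a b : ℝ × ℝ) : 𝒩.cor (𝒩.cor X a) b = 𝒩.cor X (meet a b) := by
  simp only [cor, meet]
  rw [← co_mul_co, ← pr_mul_pr, ← mul_assoc, ← mul_assoc, co_comm_co]
  simp only [mul_assoc]

theorem cor_add (X Y : H →L[ℂ] H) (a : ℝ × ℝ) : 𝒩.cor (X + Y) a = 𝒩.cor X a + 𝒩.cor Y a := by
  simp only [cor]; noncomm_ring

theorem cor_sub (X Y : H →L[ℂ] H) (a : ℝ × ℝ) : 𝒩.cor (X - Y) a = 𝒩.cor X a - 𝒩.cor Y a := by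
  simp only [cor]; noncomm_ring

theorem cor_norm (X : H →L[ℂ] H) (a : ℝ × ℝ) : ‖𝒩.cor X a‖ ≤ ‖X‖ :=
  norm_mul3_le (co_norm _ _) (pr_norm _ _)

theorem cor_alg {X : H →L[ℂ] H} (h : X ∈ 𝒩.alg) (a : ℝ × ℝ) : 𝒩.cor X a ∈ 𝒩.alg :=
  alg_compress h _ _

theorem Null.add {X Y : H →L[ℂ] H} {a : ℝ × ℝ} (h : 𝒩.Null X a) (h' : 𝒩.Null Y a) :
    𝒩.Null (X + Y) a := by
  unfold Null; rw [cor_add]; exact cpt_add h h'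

theorem Null.sub {X Y : H →L[ℂ] H} {a : ℝ × ℝ} (h : 𝒩.Null X a) (h' : 𝒩.Null Y a) :
    𝒩.Null (X - Y) a := by
  unfold Null; rw [cor_sub]; exact cpt_sub h h'

theorem Null.of_cpt {X : H →L[ℂ] H} (h : IsCompactOperator ⇑X) (a : ℝ × ℝ) : 𝒩.Null X a :=
  cpt_mul_right (cpt_mul_left _ h) _

theorem Null.meet {X : H →L[ℂ] H} {a : ℝ × ℝ} (h : 𝒩.Null X a) (b : ℝ × ℝ) :
    𝒩.Null X (meet a b) := by
  unfold Null; rw [← cor_cor]; exact Null.of_cpt h b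

theorem Null.meet' {X : H →L[ℂ] H} {a : ℝ × ℝ} (h : 𝒩.Null X a) (b : ℝ × ℝ) :
    𝒩.Null X (ContinuousNest.meet b a) := by
  rw [meet_comm]; exact h.meet b

theorem null_triv {X : H →L[ℂ] H} (hX : X ∈ 𝒩.alg) {a : ℝ × ℝ} (h : a.2 ≤ a.1) : 𝒩.Null X a := by
  unfold Null cor
  rw [alg_zero_of_le hX h]; exact cpt_zero

theorem alg_ai [TopologicalSpace.SeparableSpace H] :
    ∃ r : ℕ → H →L[ℂ] H, (∀ n, r n ∈ 𝒩.alg) ∧ AI r := by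
  obtain ⟨r, h1, h2, h3, h4, h5⟩ := 𝒩.exists_erdos
  exact ⟨r, h1, h2, h3, h4, h5⟩

theorem cor_mul_alg {X S : H →L[ℂ] H} (hS : S ∈ 𝒩.alg) (a : ℝ × ℝ) :
    𝒩.cor (X * S) a = 𝒩.cor X a * S * 𝒩.pr a.2 := by
  simp only [cor]
  calc _ = 𝒩.co a.1 * X * (S * 𝒩.pr a.2) := by simp only [mul_assoc]
    _ = 𝒩.co a.1 * X * (𝒩.pr a.2 * S * 𝒩.pr a.2) := by rw [alg_pr hS]
    _ = _ := by simp only [mul_assoc]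

theorem chain_lemma [TopologicalSpace.SeparableSpace H] {X : H →L[ℂ] H} (hX : X ∈ 𝒩.alg)
    {f : ℕ → ℝ × ℝ} (hf : Chn f) {ε : ℝ} (hε : ∀ j, essNorm (𝒩.cor X (f j)) < ε)
    {T : Set (ℝ × ℝ)} (hT : T.Countable) (hXT : ∀ j, ∀ t ∈ T, 𝒩.Null X (meet (f j) t)) :
    ∃ V ∈ 𝒩.alg, ‖V‖ ≤ 8 * ε ∧ (∀ j, 𝒩.Null (X - V) (f j)) ∧ ∀ t ∈ T, 𝒩.Null V t := by
  obtain ⟨r, hra, hr⟩ := 𝒩.alg_ai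
  have hε0 : 0 < ε := lt_of_le_of_lt Metric.infDist_nonneg (hε 0)
  choose K hK hK2 using fun j => essNorm_lt_iff.1 (hε j)
  obtain ⟨t, ht⟩ : ∃ t : ℕ → ℝ × ℝ, insert (1, 0) T = range t :=
    (hT.insert (1, 0)).exists_eq_range (insert_nonempty _ _)
  have hnull : ∀ j i, 𝒩.Null X (meet (f j) (t i)) := by
    intro j i
    have h1 : t i ∈ insert (1, 0) T := by rw [ht]; exact mem_range_self i
    rcases h1 with h1 | h1
    · apply null_triv hX
      rw [h1]
      exact (min_le_right _ _).trans (zero_le_one.trans (le_max_right _ _))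
    · exact hXT j _ h1
  obtain ⟨n, hn, hS, hL⟩ := chain_construct hr (fun j => 𝒩.cor X (f j)) K
    (fun j i => 𝒩.cor X (meet (f j) (t i))) hε0 (fun j => cor_norm X (f j)) hK
    (fun j => (hK2 j).le) hnull
  set Δ : ℕ → H →L[ℂ] H := fun j => r (n (j + 1)) - r (n j) with hΔ
  have hΔa : ∀ j, Δ j ∈ 𝒩.alg := fun j => alg_sub (hra _) (hra _)
  have hΔf : ∀ j, FR (Δ j) := fun j => (hr.fr _).sub (hr.fr _)
  set S : ℕ → H →L[ℂ] H := fun N => ∑ j ∈ Finset.range N, 𝒩.cor X (f j) * Δ j with hSdef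
  have hSa : ∀ N, S N ∈ 𝒩.alg := fun N => alg_sum _ _ fun j _ => alg_mul (cor_alg hX _) (hΔa j)
  have hSc : ∀ N, IsCompactOperator ⇑(S N) := fun N => cpt_sum _ _ fun j _ =>
    cpt_mul_left _ (hΔf j).cpt
  obtain ⟨V, hV, hVw⟩ := exists_weak_limit S hS
  refine ⟨V, ?_, hV, ?_, ?_⟩
  · rw [alg_iff_inner]
    intro s v w
    refine tendsto_nhds_unique (hVw _ _) ?_
    simp only [fun N => (alg_iff_inner.1 (hSa N)) s v w]
    exact tendsto_const_nhds
  · intro k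
    have hT1 : ∀ j, k ≤ j → 𝒩.cor (𝒩.cor X (f j) * Δ j) (f k) =
        𝒩.cor X (f k) * Δ j * 𝒩.pr (f k).2 := by
      intro j hj
      have : meet (f j) (f k) = f k := by
        have := hf k j hj
        simp [meet, this.1, this.2]
      rw [cor_mul_alg (hΔa j), cor_cor, this]
    have hSN : ∀ N, k ≤ N → 𝒩.cor (S N) (f k) = 𝒩.cor (S k) (f k) +
        𝒩.cor X (f k) * (r (n N) - r (n k)) * 𝒩.pr (f k).2 := by
      intro N hN
      induction N, hN using Nat.le_induction with
      | base => simp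
      | succ N hN ih =>
        have : S (N + 1) = S N + 𝒩.cor X (f N) * Δ N := Finset.sum_range_succ _ _
        rw [this, cor_add, ih, hT1 N hN, hΔ]
        noncomm_ring
    have hVk : 𝒩.cor V (f k) = 𝒩.cor (S k) (f k) +
        𝒩.cor X (f k) * (1 - r (n k)) * 𝒩.pr (f k).2 := by
      refine weak_limit_compress hVw fun v => ?_
      have hnt : Tendsto n atTop atTop := tendsto_atTop_mono hn tendsto_id
      have h1 : Tendsto (fun N => (𝒩.cor (S k) (f k)) v + 𝒩.cor X (f k)
          (r (n N) (𝒩.pr (f k).2 v) - r (n k) (𝒩.pr (f k).2 v))) atTop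
          (𝓝 ((𝒩.cor (S k) (f k)) v + 𝒩.cor X (f k)
          ((𝒩.pr (f k).2 v) - r (n k) (𝒩.pr (f k).2 v)))) :=
        tendsto_const_nhds.add (((𝒩.cor X (f k)).continuous.tendsto _).comp
          (((hr.conv _).comp hnt).sub_const _))
      refine h1.congr' ?_
      filter_upwards [eventually_ge_atTop k] with N hN
      exact (congrArg (fun A : H →L[ℂ] H => A v) (hSN N hN)).symm
    unfold Null
    have hXk : 𝒩.cor X (f k) * 𝒩.pr (f k).2 = 𝒩.cor X (f k) := by
      simp only [cor, mul_assoc, pr_idem]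
    have : 𝒩.cor (X - V) (f k) = 𝒩.cor X (f k) * r (n k) * 𝒩.pr (f k).2 - 𝒩.cor (S k) (f k) := by
      rw [cor_sub, hVk, mul_sub, sub_mul, mul_one, hXk]
      abel
    rw [this]
    exact cpt_sub (cpt_mul_right (cpt_mul_left _ (hr.fr _).cpt) _) (Null.of_cpt (hSc k) _)
  · intro a ha
    obtain ⟨i, hi⟩ : a ∈ range t := by rw [← ht]; exact mem_insert_of_mem _ ha
    rw [← hi]
    set g : ℕ → H →L[ℂ] H := fun j => 𝒩.cor (𝒩.cor X (f j) * Δ j) (t i) with hg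
    have hgn : ∀ j, i ≤ j → ‖g j‖ ≤ 2 * (1 / 2) ^ j := by
      intro j hj
      simp only [hg]
      rw [cor_mul_alg (hΔa j), cor_cor]
      calc _ ≤ ‖𝒩.cor X (meet (f j) (t i)) * Δ j‖ * ‖𝒩.pr (t i).2‖ := norm_mul_le _ _
        _ ≤ ‖𝒩.cor X (meet (f j) (t i)) * Δ j‖ * 1 := by gcongr; exact pr_norm _ _
        _ ≤ _ := by rw [mul_one]; exact hL j i hj
    have hsum : Summable g := by
      refine Summable.of_norm_bounded_eventually_nat (g := fun j => 2 * (1 / 2 : ℝ) ^ j)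
        ((summable_geometric_of_lt_one (by norm_num) (by norm_num)).mul_left 2) ?_
      filter_upwards [eventually_ge_atTop i] with j hj using hgn j hj
    have hVt : 𝒩.cor V (t i) = ∑' j, g j := by
      refine weak_limit_compress hVw fun v => ?_
      have h1 := hsum.hasSum.tendsto_sum_nat
      have h2 : ∀ N, ∑ j ∈ Finset.range N, g j = 𝒩.cor (S N) (t i) := by
        intro N
        simp only [hg, hSdef, cor, Finset.mul_sum, Finset.sum_mul]
      simp only [h2] at h1
      exact ((ContinuousLinearMap.apply ℂ H v).continuous.tendsto _).comp h1
    unfold Null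
    rw [hVt]
    exact cpt_tsum (fun j => Null.of_cpt (cpt_mul_left _ (hΔf j).cpt) _) hsum.hasSum

end ContinuousNest

open Set Filter Topology
set_option linter.unusedSectionVars false

namespace ContinuousNest
variable {H : Type*} [NormedAddCommGroup H] [InnerProductSpace ℂ H] [CompleteSpace H]
variable {𝒩 : ContinuousNest H}

/-- constants of the list lemma -/
noncomputable def cc : ℕ → ℝ
  | 0 => 0
  | k + 1 => cc k + 8 * (1 + cc k)

theorem cc_nonneg : ∀ k, 0 ≤ cc k
  | 0 => le_rfl
  | k + 1 => by have := cc_nonneg k; simp only [cc]; linarith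

theorem essNorm_sub_lt {X V : H →L[ℂ] H} {a b : ℝ} (h : essNorm X < a) (hV : ‖V‖ ≤ b) :
    essNorm (X - V) < a + b := by
  rw [essNorm_lt_iff] at *
  obtain ⟨K, hK, h⟩ := h
  refine ⟨K, hK, ?_⟩
  have : X - V - K = (X - K) - V := by abel
  rw [this]
  exact (norm_sub_le _ _).trans_lt (by linarith)

theorem list_lemma [TopologicalSpace.SeparableSpace H] (L : List (ℕ → ℝ × ℝ)) :
    (∀ f ∈ L, Chn f) → ∀ {X : H →L[ℂ] H}, X ∈ 𝒩.alg → ∀ {T : Set (ℝ × ℝ)}, T.Countable →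
    ∀ {ε : ℝ}, (∀ f ∈ L, ∀ j, essNorm (𝒩.cor X (f j)) < ε) →
    (∀ f ∈ L, ∀ j, ∀ t ∈ T, 𝒩.Null X (meet (f j) t)) →
    ∃ V ∈ 𝒩.alg, ‖V‖ ≤ cc L.length * ε ∧ (∀ f ∈ L, ∀ j, 𝒩.Null (X - V) (f j)) ∧
      ∀ t ∈ T, 𝒩.Null V t := by
  induction L with
  | nil =>
    intro _ X hX T hT ε _ _
    refine ⟨0, alg_zero, by simp [cc], by simp, fun t _ => Null.of_cpt cpt_zero t⟩
  | cons f L ih =>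
    intro hL X hX T hT ε hε hXT
    obtain ⟨V, hV, hVn, hVL, hVT⟩ := ih (fun g hg => hL g (by simp [hg])) hX hT
      (fun g hg => hε g (by simp [hg])) (fun g hg => hXT g (by simp [hg]))
    have hXV := alg_sub hX hV
    have hc : (⋃ g ∈ {g | g ∈ L}, range g).Countable :=
      (L.finite_toSet.countable).biUnion fun g _ => countable_range g
    obtain ⟨W, hW, hWn, hWf, hWT⟩ := chain_lemma hXV (hL f (by simp))
      (ε := ε + cc L.length * ε) (T := T ∪ ⋃ g ∈ {g | g ∈ L}, range g) (fun j => by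
        rw [cor_sub]
        exact essNorm_sub_lt (hε f (by simp) j) ((cor_norm _ _).trans hVn))
      (hT.union hc) (by
        intro j t ht
        rcases ht with ht | ht
        · exact (hXT f (by simp) j t ht).sub ((hVT t ht).meet' _)
        · simp only [mem_iUnion] at ht
          obtain ⟨g, hg, k, rfl⟩ := ht
          exact (hVL g hg k).meet' _)
    refine ⟨V + W, alg_add hV hW, ?_, ?_, ?_⟩
    · refine (norm_add_le _ _).trans ?_
      simp only [List.length_cons, cc]
      linarith
    · intro g hg j
      have : X - (V + W) = X - V - W := by abel
      rw [this]
      rcases List.mem_cons.1 hg with rfl | hg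
      · exact hWf j
      · refine (hVL g hg j).sub (hWT _ (Or.inr ?_))
        simp only [mem_iUnion]
        exact ⟨g, hg, mem_range_self j⟩
    · intro t ht
      exact (hVT t ht).add (hWT t (Or.inl ht))

theorem cut_lemma [TopologicalSpace.SeparableSpace H] {Y : H →L[ℂ] H} (hY : Y ∈ 𝒩.alg)
    {T : Set (ℝ × ℝ)} (hT : ∀ t ∈ T, 𝒩.Null Y t) (T0 : Set (ℝ × ℝ)) (hf : T0.Finite) (hT0 : T0 ⊆ T) {δ : ℝ}
    (hδ : 0 < δ) :
    ∃ K ∈ 𝒩.alg, IsCompactOperator ⇑K ∧ ‖K‖ ≤ ‖Y‖ ∧ (∀ t ∈ T, 𝒩.Null (Y - K) t) ∧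
      ∀ t ∈ T0, ‖𝒩.cor (Y - K) t‖ ≤ δ := by
  obtain ⟨r, hra, hr⟩ := 𝒩.alg_ai
  have h1 : ∀ᶠ n in atTop, ∀ t ∈ T0, ‖𝒩.cor Y t * (r n - 1)‖ ≤ δ := by
    rw [Filter.eventually_all_finite hf]
    intro t ht
    exact ((hr.right (hT t (hT0 ht))).eventually (Iio_mem_nhds hδ)).mono fun n hn => le_of_lt hn
  obtain ⟨n, hn⟩ := h1.exists
  have hc : IsCompactOperator ⇑(Y * r n) := cpt_mul_left _ (hr.fr n).cpt
  refine ⟨Y * r n, alg_mul hY (hra n), hc, ?_, ?_, ?_⟩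
  · calc _ ≤ ‖Y‖ * ‖r n‖ := norm_mul_le _ _
      _ ≤ ‖Y‖ * 1 := by gcongr; exact hr.norm n
      _ = _ := mul_one _
  · exact fun t ht => (hT t ht).sub (Null.of_cpt hc t)
  · intro t ht
    have e1 : Y - Y * r n = -(Y * (r n - 1)) := by noncomm_ring
    have e2 : 𝒩.cor (Y - Y * r n) t = -(𝒩.cor (Y * (r n - 1)) t) := by
      rw [e1]; simp only [cor, mul_neg, neg_mul]
    rw [e2, norm_neg, cor_mul_alg (alg_sub (hra n) alg_one)]
    calc _ ≤ ‖𝒩.cor Y t * (r n - 1)‖ * ‖𝒩.pr t.2‖ := norm_mul_le _ _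
        _ ≤ ‖𝒩.cor Y t * (r n - 1)‖ * 1 := by gcongr; exact pr_norm _ _
        _ ≤ _ := by rw [mul_one]; exact hn t ht

theorem Chn.meet {f g : ℕ → ℝ × ℝ} (hf : Chn f) (hg : Chn g) :
    Chn (fun j => meet (f j) (g j)) := fun j k h =>
  ⟨max_le_max (hf j k h).1 (hg j k h).1, min_le_min (hf j k h).2 (hg j k h).2⟩

/-- decomposition of a block -/
theorem block_lemma [TopologicalSpace.SeparableSpace H] :
    ∃ C : ℝ, 0 ≤ C ∧ ∀ (X : H →L[ℂ] H) (_ : X ∈ 𝒩.alg) (L₁ L₂ : List (ℕ → ℝ × ℝ)) (ε δ : ℝ) (n₀ : ℕ),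
      L₁.length = 3 → L₂.length = 3 → (∀ f ∈ L₁, Chn f) → (∀ f ∈ L₂, Chn f) → 0 < ε → 0 < δ →
      (∀ f ∈ L₁, ∀ g ∈ L₂, ∀ j, essNorm (𝒩.cor X (meet (f j) (g j))) < ε) →
      ∃ Z ∈ 𝒩.alg, ∃ K ∈ 𝒩.alg, ∃ Y₁ ∈ 𝒩.alg, ∃ Y₂ ∈ 𝒩.alg, X = Z + K + Y₁ + Y₂ ∧
        IsCompactOperator ⇑K ∧ ‖Z‖ ≤ C * ε ∧ ‖K‖ ≤ C * (‖X‖ + ε) ∧ ‖Y₁‖ ≤ C * (‖X‖ + ε) ∧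
        ‖Y₂‖ ≤ C * (‖X‖ + ε) ∧
        (∀ f ∈ L₁, ∀ j, 𝒩.Null Y₁ (f j) ∧ (j ≤ n₀ → ‖𝒩.cor Y₁ (f j)‖ ≤ δ)) ∧
        (∀ f ∈ L₂, ∀ j, 𝒩.Null Y₂ (f j) ∧ (j ≤ n₀ → ‖𝒩.cor Y₂ (f j)‖ ≤ δ)) := by
  have h9 := cc_nonneg 9
  have h3 := cc_nonneg 3
  refine ⟨4 * (1 + cc 9) * (1 + cc 3), by positivity, ?_⟩
  intro X hX L₁ L₂ ε δ n₀ l₁ l₂ c₁ c₂ hε hδ h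
  obtain ⟨Z, hZ, hZn, hZ0, -⟩ := list_lemma (𝒩 := 𝒩)
    ((L₁ ×ˢ L₂).map fun p j => meet (p.1 j) (p.2 j)) (by
      intro f hf
      simp only [List.mem_map, List.mem_product, Prod.exists] at hf
      obtain ⟨a, b, ⟨ha, hb⟩, rfl⟩ := hf
      exact (c₁ a ha).meet (c₂ b hb)) hX (T := ∅) countable_empty (ε := ε) (by
      intro f hf
      simp only [List.mem_map, List.mem_product, Prod.exists] at hf
      obtain ⟨a, b, ⟨ha, hb⟩, rfl⟩ := hf
      exact h a ha b hb) (by simp)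
  have hl : ((L₁ ×ˢ L₂).map fun p j => meet (p.1 j) (p.2 j)).length = 9 := by
    rw [List.length_map, List.length_product, l₁, l₂]
  rw [hl] at hZn
  have hXZ := alg_sub hX hZ
  have hnull : ∀ f ∈ L₁, ∀ j, ∀ g ∈ L₂, ∀ k, 𝒩.Null (X - Z) (meet (f j) (g k)) := by
    intro f hf j g hg k
    have h1 := hZ0 (fun i => meet (f i) (g i)) (by
      simp only [List.mem_map, List.mem_product, Prod.exists]
      exact ⟨f, g, ⟨hf, hg⟩, rfl⟩) (max j k)
    have h2 := h1.meet (meet (f j) (g k))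
    have a1 := c₁ f hf j (max j k) (le_max_left _ _)
    have a2 := c₂ g hg k (max j k) (le_max_right _ _)
    have : meet (meet (f (max j k)) (g (max j k))) (meet (f j) (g k)) = meet (f j) (g k) := by
      have b1 := max_le_max a1.1 a2.1
      have b2 := min_le_min a1.2 a2.2
      unfold ContinuousNest.meet
      exact Prod.ext (max_eq_right b1) (min_eq_right b2)
    rwa [this] at h2
  have hcount : ∀ L : List (ℕ → ℝ × ℝ), (⋃ g ∈ {g | g ∈ L}, range g).Countable := fun L =>
      (L.finite_toSet.countable).biUnion fun g _ => countable_range g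
  obtain ⟨V, hV, hVn, hV1, hV2⟩ := list_lemma L₁ c₁ hXZ (hcount L₂) (ε := ‖X - Z‖ + ε)
    (fun f _ j => essNorm_lt_of_norm ((cor_norm _ _).trans_lt (by linarith))) (by
      intro f hf j t ht
      simp only [mem_iUnion] at ht
      obtain ⟨g, hg, k, rfl⟩ := ht
      exact hnull f hf j g hg k)
  rw [l₁] at hVn
  have hfin : ∀ L : List (ℕ → ℝ × ℝ), (⋃ g ∈ {g | g ∈ L}, g '' Iic n₀).Finite := fun L =>
      (L.finite_toSet).biUnion fun g _ => (finite_Iic n₀).image g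
  have hsub : ∀ L : List (ℕ → ℝ × ℝ), (⋃ g ∈ {g | g ∈ L}, g '' Iic n₀) ⊆ ⋃ g ∈ {g | g ∈ L}, range g :=
    fun L => iUnion₂_mono fun g _ => image_subset_range _ _
  obtain ⟨K₁, hK₁, hKc₁, hKn₁, hKT₁, hKd₁⟩ := cut_lemma (alg_sub hXZ hV)
    (T := ⋃ g ∈ {g | g ∈ L₁}, range g) (by
      intro t ht
      simp only [mem_iUnion] at ht
      obtain ⟨g, hg, k, rfl⟩ := ht
      exact hV1 g hg k) _ (hfin L₁) (hsub L₁) hδ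
  obtain ⟨K₂, hK₂, hKc₂, hKn₂, hKT₂, hKd₂⟩ := cut_lemma hV hV2 _ (hfin L₂) (hsub L₂) hδ
  have n1 : ‖X - Z‖ ≤ ‖X‖ + cc 9 * ε := (norm_sub_le _ _).trans (by linarith)
  have n2 : ‖X - Z - V‖ ≤ ‖X - Z‖ + ‖V‖ := norm_sub_le _ _
  have n0 := norm_nonneg X
  have B1 : ‖X - Z‖ + ε ≤ (1 + cc 9) * (‖X‖ + ε) := by nlinarith
  have B2 : ‖V‖ ≤ (1 + cc 9) * (1 + cc 3) * (‖X‖ + ε) := by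
    have : cc 3 * (‖X - Z‖ + ε) ≤ cc 3 * ((1 + cc 9) * (‖X‖ + ε)) := by gcongr
    have : 0 ≤ (1 + cc 9) * (‖X‖ + ε) := by positivity
    linarith
  have B3 : ‖X - Z - V‖ ≤ (1 + cc 9) * (1 + cc 3) * (‖X‖ + ε) := by
    have : cc 3 * (‖X - Z‖ + ε) ≤ cc 3 * ((1 + cc 9) * (‖X‖ + ε)) := by gcongr
    linarith
  refine ⟨Z, hZ, K₁ + K₂, alg_add hK₁ hK₂, X - Z - V - K₁, alg_sub (alg_sub hXZ hV) hK₁, V - K₂,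
    alg_sub hV hK₂, by abel, cpt_add hKc₁ hKc₂, ?_, ?_, ?_, ?_, ?_, ?_⟩
  · have : cc 9 * ε ≤ 4 * (1 + cc 9) * (1 + cc 3) * ε := by
      gcongr
      nlinarith
    linarith
  · have := norm_add_le K₁ K₂
    have : 0 ≤ (1 + cc 9) * (1 + cc 3) * (‖X‖ + ε) := by positivity
    linarith
  · have := norm_sub_le (X - Z - V) K₁
    have : 0 ≤ (1 + cc 9) * (1 + cc 3) * (‖X‖ + ε) := by positivity
    linarith
  · have := norm_sub_le V K₂
    have : 0 ≤ (1 + cc 9) * (1 + cc 3) * (‖X‖ + ε) := by positivity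
    linarith
  · intro f hf j
    refine ⟨hKT₁ _ ?_, fun hj => hKd₁ _ ?_⟩
    · simp only [mem_iUnion]
      exact ⟨f, hf, mem_range_self j⟩
    · simp only [mem_iUnion]
      exact ⟨f, hf, j, hj, rfl⟩
  · intro f hf j
    refine ⟨hKT₂ _ ?_, fun hj => hKd₂ _ ?_⟩
    · simp only [mem_iUnion]
      exact ⟨f, hf, mem_range_self j⟩
    · simp only [mem_iUnion]
      exact ⟨f, hf, j, hj, rfl⟩

end ContinuousNest

open Set Filter Topology
set_option linter.unusedSectionVars false

section WSum
variable {H : Type*} [NormedAddCommGroup H] [InnerProductSpace ℂ H] [CompleteSpace H]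

/-- weak operator sums -/
def IsWSum {B : Type*} (T : B → H →L[ℂ] H) (V : H →L[ℂ] H) : Prop :=
  ∀ w v, HasSum (fun β => (inner ℂ w (T β v) : ℂ)) (inner ℂ w (V v))

/-- square summability of a family of operators -/
def Sq {B : Type*} (R : B → H →L[ℂ] H) (a : ℝ) : Prop :=
  ∀ (F : Finset B) (w : H), ∑ β ∈ F, ‖R β w‖ ^ 2 ≤ a * ‖w‖ ^ 2

theorem IsWSum.unique {B : Type*} {T : B → H →L[ℂ] H} {V W : H →L[ℂ] H} (h : IsWSum T V)
    (h' : IsWSum T W) : V = W := by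
  ext v
  apply ext_inner_left ℂ
  intro w
  exact (h w v).unique (h' w v)

theorem inner_mul3 (A T C : H →L[ℂ] H) (w v : H) :
    (inner ℂ w ((A * T * C) v) : ℂ) = inner ℂ (star A w) (T (C v)) :=
  (ContinuousLinearMap.adjoint_inner_left A (T (C v)) w).symm

theorem IsWSum.compress {B : Type*} {T : B → H →L[ℂ] H} {V : H →L[ℂ] H} (h : IsWSum T V)
    (A C : H →L[ℂ] H) : IsWSum (fun β => A * T β * C) (A * V * C) := by
  intro w v
  simp only [inner_mul3]
  exact h _ _

theorem IsWSum.add {B : Type*} {T T' : B → H →L[ℂ] H} {V V' : H →L[ℂ] H} (h : IsWSum T V)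
    (h' : IsWSum T' V') : IsWSum (fun β => T β + T' β) (V + V') := by
  intro w v
  simp only [_root_.add_apply, inner_add_right]
  exact (h w v).add (h' w v)

theorem IsWSum.of_hasSum {B : Type*} {T : B → H →L[ℂ] H} {V : H →L[ℂ] H} (h : HasSum T V) :
    IsWSum T V := by
  intro w v
  have h1 : HasSum (fun β => T β v) (V v) := h.mapL (ContinuousLinearMap.apply ℂ H v)
  exact h1.mapL (innerSL ℂ w)

theorem IsWSum.of_finset {B : Type*} {T : B → H →L[ℂ] H} (F : Finset B)
    (h : ∀ β, β ∉ F → T β = 0) : IsWSum T (∑ β ∈ F, T β) :=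
  IsWSum.of_hasSum (hasSum_sum_of_ne_finset_zero h)

theorem IsWSum.alg {B : Type*} {𝒩 : ContinuousNest H} {T : B → H →L[ℂ] H} {V : H →L[ℂ] H}
    (h : IsWSum T V) (hT : ∀ β, T β ∈ 𝒩.alg) : V ∈ 𝒩.alg := by
  rw [ContinuousNest.alg_iff_inner]
  intro t v w
  have h1 := h (𝒩.co t w) (𝒩.pr t v)
  simp only [fun β => ContinuousNest.alg_iff_inner.1 (hT β) t v w] at h1
  exact h1.unique hasSum_zero

theorem IsWSum.cpt {B : Type*} {T : B → H →L[ℂ] H} {V : H →L[ℂ] H}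
    (h : IsWSum T V) (hT : ∀ β, IsCompactOperator ⇑(T β)) (hs : Summable fun β => ‖T β‖) :
    IsCompactOperator ⇑V := by
  have h1 : HasSum T (∑' β, T β) := hs.of_norm.hasSum
  rw [h.unique (IsWSum.of_hasSum h1)]
  exact cpt_tsum hT h1

theorem exists_wsum {B : Type*} {R Y S : B → H →L[ℂ] H} {a c : ℝ} (ha : 0 ≤ a) (hc : 0 ≤ c)
    (hR : Sq R a) (hS : Sq S a)
    (hY : ∀ β, ‖Y β‖ ≤ c) :
    ∃ V, ‖V‖ ≤ a * c ∧ IsWSum (fun β => star (R β) * Y β * S β) V := by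
  have hterm : ∀ β w v, ‖(inner ℂ w ((star (R β) * Y β * S β) v) : ℂ)‖ ≤
      c * (‖R β w‖ * ‖S β v‖) := by
    intro β w v
    rw [inner_mul3, star_star]
    calc _ ≤ ‖R β w‖ * ‖Y β (S β v)‖ := norm_inner_le_norm _ _
      _ ≤ ‖R β w‖ * (c * ‖S β v‖) := by
        gcongr; exact ContinuousLinearMap.le_of_opNorm_le _ (hY β) _
      _ = _ := by ring
  have hCS : ∀ (F : Finset B) w v, ∑ β ∈ F, ‖R β w‖ * ‖S β v‖ ≤ a * ‖w‖ * ‖v‖ := by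
    intro F w v
    have h1 := Finset.sum_mul_sq_le_sq_mul_sq F (fun β => ‖R β w‖) (fun β => ‖S β v‖)
    have h2 : (∑ β ∈ F, ‖R β w‖ ^ 2) * ∑ β ∈ F, ‖S β v‖ ^ 2 ≤ (a * ‖w‖ ^ 2) * (a * ‖v‖ ^ 2) := by
      gcongr
      · exact hR F w
      · exact hS F v
    rw [← sq_le_sq₀ (Finset.sum_nonneg fun _ _ => by positivity) (by positivity)]
    calc _ ≤ _ := h1
      _ ≤ _ := h2
      _ = _ := by ring
  have hsum : ∀ w v, Summable fun β => ‖(inner ℂ w ((star (R β) * Y β * S β) v) : ℂ)‖ := by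
    intro w v
    refine summable_of_sum_le (c := c * (a * ‖w‖ * ‖v‖)) (fun _ => norm_nonneg _) fun F => ?_
    calc _ ≤ ∑ β ∈ F, c * (‖R β w‖ * ‖S β v‖) := Finset.sum_le_sum fun β _ => hterm β w v
      _ = c * ∑ β ∈ F, (‖R β w‖ * ‖S β v‖) := by rw [Finset.mul_sum]
      _ ≤ _ := by gcongr; exact hCS F w v
  have hS' : ∀ w v, Summable fun β => (inner ℂ w ((star (R β) * Y β * S β) v) : ℂ) :=
    fun w v => (hsum w v).of_norm
  obtain ⟨V, hV, hVB⟩ := exists_op_of_form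
    (fun w v => ∑' β, (inner ℂ w ((star (R β) * Y β * S β) v) : ℂ)) (a * c) (by positivity)
    (fun w v v' => by simp only [map_add, inner_add_right]; exact (hS' w v).tsum_add (hS' w v'))
    (fun w k v => by simp only [map_smul, inner_smul_right]; exact tsum_mul_left)
    (fun w w' v => by simp only [inner_add_left]; exact (hS' w v).tsum_add (hS' w' v))
    (fun w k v => by simp only [inner_smul_left]; exact tsum_mul_left)
    (fun w v => by
      refine (norm_tsum_le_tsum_norm (hsum w v)).trans ?_
      refine (hsum w v).tsum_le_of_sum_le fun F => ?_
      calc _ ≤ ∑ β ∈ F, c * (‖R β w‖ * ‖S β v‖) := Finset.sum_le_sum fun β _ => hterm β w v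
        _ = c * ∑ β ∈ F, (‖R β w‖ * ‖S β v‖) := by rw [Finset.mul_sum]
        _ ≤ c * (a * ‖w‖ * ‖v‖) := by gcongr; exact hCS F w v
        _ = _ := by ring)
  refine ⟨V, hV, fun w v => ?_⟩
  rw [hVB]
  exact (hS' w v).hasSum

theorem Sq.prod {B B' : Type*} {R : B → H →L[ℂ] H} {R' : B' → H →L[ℂ] H} {a b : ℝ} (ha : 0 ≤ a)
    (hR : Sq R a) (hR' : Sq R' b) : Sq (fun m : B × B' => R m.1 * R' m.2) (a * b) := by
  classical
  intro F w
  calc _ ≤ ∑ m ∈ F.image Prod.fst ×ˢ F.image Prod.snd, ‖(R m.1 * R' m.2) w‖ ^ 2 := by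
        refine Finset.sum_le_sum_of_subset_of_nonneg ?_ fun _ _ _ => by positivity
        exact Finset.subset_product
    _ = ∑ j ∈ F.image Prod.snd, ∑ i ∈ F.image Prod.fst, ‖R i (R' j w)‖ ^ 2 := by
        rw [Finset.sum_product_right]; rfl
    _ ≤ ∑ j ∈ F.image Prod.snd, a * ‖R' j w‖ ^ 2 := Finset.sum_le_sum fun j _ => hR _ _
    _ = a * ∑ j ∈ F.image Prod.snd, ‖R' j w‖ ^ 2 := by rw [Finset.mul_sum]
    _ ≤ a * (b * ‖w‖ ^ 2) := by gcongr; exact hR' _ _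
    _ = _ := by ring

theorem Sq.bool {J : Type*} {R : J × Bool → H →L[ℂ] H}
    (h : ∀ b, Sq (fun i => R (i, b)) 1) : Sq R 2 := by
  classical
  intro F w
  calc _ ≤ ∑ m ∈ F.image Prod.fst ×ˢ (Finset.univ : Finset Bool), ‖R m w‖ ^ 2 := by
        refine Finset.sum_le_sum_of_subset_of_nonneg ?_ fun _ _ _ => by positivity
        intro m hm
        simp only [Finset.mem_product, Finset.mem_univ, and_true]
        exact Finset.mem_image_of_mem _ hm
    _ = ∑ j ∈ (Finset.univ : Finset Bool), ∑ i ∈ F.image Prod.fst, ‖R (i, j) w‖ ^ 2 := by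
        rw [Finset.sum_product_right]
    _ ≤ ∑ j ∈ (Finset.univ : Finset Bool), 1 * ‖w‖ ^ 2 := Finset.sum_le_sum fun j _ => h j _ _
    _ = _ := by simp

theorem sq_orth {J : Type*} {R : J → H →L[ℂ] H} (hp : ∀ i, IsStarProjection (R i))
    (ho : ∀ i j, i ≠ j → R i * R j = 0) : Sq R 1 := by
  intro F w
  rw [one_mul]
  have hin : ∀ i x y, (inner ℂ (R i x) y : ℂ) = inner ℂ x (R i y) := by
    intro i x y
    have h9 : ContinuousLinearMap.adjoint (R i) = R i := (hp i).isSelfAdjoint.star_eq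
    conv_lhs => rw [← h9]
    exact ContinuousLinearMap.adjoint_inner_left _ _ _
  have h1 := orth_norm_sq F (fun i => R i w) (fun _ => 1) (by
    intro i _ j _ hij
    have : R i (R j w) = 0 := congrArg (fun A : H →L[ℂ] H => A w) (ho i j hij)
    rw [hin, this, inner_zero_right])
  simp only [one_smul, norm_one, one_pow, one_mul] at h1
  have h2 : ∑ i ∈ F, ‖R i w‖ ^ 2 = RCLike.re (inner ℂ w (∑ i ∈ F, R i w) : ℂ) := by
    rw [inner_sum, map_sum]
    refine Finset.sum_congr rfl fun i _ => ?_
    have : R i (R i w) = R i w := congrArg (fun A : H →L[ℂ] H => A w) (hp i).isIdempotentElem.eq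
    rw [← this, ← hin, this, inner_self_eq_norm_sq]
  have h3 : RCLike.re (inner ℂ w (∑ i ∈ F, R i w) : ℂ) ≤ ‖w‖ * ‖∑ i ∈ F, R i w‖ :=
    (RCLike.re_le_norm _).trans (norm_inner_le_norm _ _)
  rw [← h2, ← h1] at h3
  rw [← h1]
  have := norm_nonneg (∑ i ∈ F, R i w)
  have := norm_nonneg w
  nlinarith

end WSum

open Set Filter Topology
set_option linter.unusedSectionVars false

namespace ContinuousNest
variable {H : Type*} [NormedAddCommGroup H] [InnerProductSpace ℂ H] [CompleteSpace H]
variable {𝒩 : ContinuousNest H}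

theorem iv_comm (s t s' t' : ℝ) : 𝒩.iv s t * 𝒩.iv s' t' = 𝒩.iv s' t' * 𝒩.iv s t := by
  rw [iv_mul, iv_mul, max_comm, min_comm]

/-- system of blocks -/
structure BlkSys (𝒩 : ContinuousNest H) (D : ℝ × ℝ → Prop) (Q : Set (ℝ × ℝ)) (B : Type)
    (R S : B → ℝ × ℝ) (L : B → List (ℕ → ℝ × ℝ)) : Prop where
  cnt : Countable B
  R_sq : Sq (fun β => 𝒩.iv (R β).1 (R β).2) 2
  S_sq : Sq (fun β => 𝒩.iv (S β).1 (S β).2) 2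
  fin : ∀ E ∈ Q, ∃ F : Finset B,
    (∀ β, β ∉ F → ∀ A, 𝒩.iv E.1 E.2 * (𝒩.iv (R β).1 (R β).2 * A * 𝒩.iv (S β).1 (S β).2)
        * 𝒩.iv E.1 E.2 = 0) ∧
    ∀ X ∈ 𝒩.alg, ∑ β ∈ F, 𝒩.iv E.1 E.2 * (𝒩.iv (R β).1 (R β).2 * X * 𝒩.iv (S β).1 (S β).2)
        * 𝒩.iv E.1 E.2 = 𝒩.iv E.1 E.2 * X * 𝒩.iv E.1 E.2
  len : ∀ β, (L β).length = 3
  chn : ∀ β, ∀ f ∈ L β, Chn f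
  sub : ∀ β, ∀ f ∈ L β, ∀ n, D (f n) ∨ (f n).2 ≤ (f n).1
  cov : ∀ E ∈ Q, ∀ β, ∃ f ∈ L β, ∃ n, ∀ Y ∈ 𝒩.alg,
    𝒩.iv E.1 E.2 * (𝒩.iv (R β).1 (R β).2 * Y * 𝒩.iv (S β).1 (S β).2) * 𝒩.iv E.1 E.2 =
    𝒩.iv E.1 E.2 * (𝒩.iv (R β).1 (R β).2 * 𝒩.cor Y (f n) * 𝒩.iv (S β).1 (S β).2) * 𝒩.iv E.1 E.2

theorem blk_norm (E R S : ℝ × ℝ) (Y : H →L[ℂ] H) :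
    ‖𝒩.iv E.1 E.2 * (𝒩.iv R.1 R.2 * Y * 𝒩.iv S.1 S.2) * 𝒩.iv E.1 E.2‖ ≤ ‖Y‖ :=
  (norm_mul3_le (iv_norm _ _ _) (iv_norm _ _ _)).trans
    (norm_mul3_le (iv_norm _ _ _) (iv_norm _ _ _))

theorem cpt_mul3 {K : H →L[ℂ] H} (h : IsCompactOperator ⇑K) (A C : H →L[ℂ] H) :
    IsCompactOperator ⇑(A * K * C) := cpt_mul_right (cpt_mul_left _ h) _

theorem blk_half {D : ℝ × ℝ → Prop} {Q : Set (ℝ × ℝ)} {B : Type}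
    {R S : B → ℝ × ℝ} {L : B → List (ℕ → ℝ × ℝ)} (h : BlkSys 𝒩 D Q B R S L)
    {M : Type*} (π : M → B) (code : M → ℕ) (hcode : Function.Injective code)
    (Y K T P P' : M → H →L[ℂ] H) (A : Set M) (hA : ∀ β, {m ∈ A | π m = β}.Finite)
    (hYa : ∀ m, Y m ∈ 𝒩.alg) (hK : ∀ m, IsCompactOperator ⇑(K m)) (hKA : ∀ m, m ∉ A → K m = 0)
    (hY : ∀ m, ∀ f ∈ L (π m), ∀ j, 𝒩.Null (Y m) (f j) ∧
      (j ≤ code m → ‖𝒩.cor (Y m) (f j)‖ ≤ (1 / 2) ^ code m))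
    (hP : ∀ m, ‖P m‖ ≤ 1) (hP' : ∀ m, ‖P' m‖ ≤ 1) {E : ℝ × ℝ} (hE : E ∈ Q)
    (hT : ∀ m, 𝒩.iv E.1 E.2 * T m * 𝒩.iv E.1 E.2 = P m *
      (𝒩.iv E.1 E.2 * (𝒩.iv (R (π m)).1 (R (π m)).2 * (Y m + K m) * 𝒩.iv (S (π m)).1 (S (π m)).2)
        * 𝒩.iv E.1 E.2) * P' m) {V : H →L[ℂ] H} (hV : IsWSum T V) :
    IsCompactOperator ⇑(𝒩.iv E.1 E.2 * V * 𝒩.iv E.1 E.2) := by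
  classical
  obtain ⟨F, hF, -⟩ := h.fin E hE
  choose f hf n hn using h.cov E hE
  have hterm : ∀ m, 𝒩.iv E.1 E.2 * T m * 𝒩.iv E.1 E.2 =
      P m * (𝒩.iv E.1 E.2 * (𝒩.iv (R (π m)).1 (R (π m)).2 * 𝒩.cor (Y m) (f (π m) (n (π m)))
        * 𝒩.iv (S (π m)).1 (S (π m)).2) * 𝒩.iv E.1 E.2) * P' m +
      P m * (𝒩.iv E.1 E.2 * (𝒩.iv (R (π m)).1 (R (π m)).2 * K m
        * 𝒩.iv (S (π m)).1 (S (π m)).2) * 𝒩.iv E.1 E.2) * P' m := by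
    intro m
    rw [hT, ← hn (π m) (Y m) (hYa m)]
    noncomm_ring
  refine (hV.compress (𝒩.iv E.1 E.2) (𝒩.iv E.1 E.2)).cpt ?_ ?_
  · intro m
    rw [hterm]
    exact cpt_add (cpt_mul3 (cpt_mul3 (cpt_mul3 (hY m _ (hf _) _).1 _ _) _ _) _ _)
      (cpt_mul3 (cpt_mul3 (cpt_mul3 (hK m) _ _) _ _) _ _)
  · have hg : Summable fun m => ((1 : ℝ) / 2) ^ code m :=
      (summable_geometric_of_lt_one (by norm_num) (by norm_num)).comp_injective hcode
    refine Summable.of_norm_bounded_eventually hg ?_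
    let bad : Set M := (⋃ β ∈ F, {m ∈ A | π m = β}) ∪ ⋃ β ∈ F, code ⁻¹' (Iic (n β))
    have hbad : bad.Finite := by
      refine Set.Finite.union (F.finite_toSet.biUnion fun β _ => hA β)
        (F.finite_toSet.biUnion fun β _ => ?_)
      exact (finite_Iic _).preimage (hcode.injOn)
    have hc : badᶜ ∈ cofinite := hbad.compl_mem_cofinite
    filter_upwards [hc] with m hm
    rw [norm_norm]
    by_cases hF' : π m ∈ F
    · have h1 : m ∉ A := fun h1 => hm (Or.inl (by
        simp only [mem_iUnion]; exact ⟨π m, hF', h1, rfl⟩))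
      have h2 : n (π m) ≤ code m := by
        by_contra h2
        exact hm (Or.inr (by
          simp only [mem_iUnion]; exact ⟨π m, hF', (not_le.1 h2).le⟩))
      rw [hterm, hKA m h1, mul_zero, zero_mul, mul_zero, zero_mul, mul_zero, zero_mul, add_zero]
      exact (norm_mul3_le (hP m) (hP' m)).trans ((blk_norm _ _ _ _).trans
        ((hY m _ (hf _) _).2 h2))
    · rw [hT, hF _ hF', mul_zero, zero_mul, norm_zero]
      positivity

theorem phi_exists {D : ℝ × ℝ → Prop} {Q : Set (ℝ × ℝ)} {B : Type}
    {R S : B → ℝ × ℝ} {L : B → List (ℕ → ℝ × ℝ)} (h : BlkSys 𝒩 D Q B R S L) {X : H →L[ℂ] H}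
    (hX : X ∈ 𝒩.alg) :
    ∃ V ∈ 𝒩.alg, ‖V‖ ≤ 2 * ‖X‖ ∧
      IsWSum (fun β => 𝒩.iv (R β).1 (R β).2 * X * 𝒩.iv (S β).1 (S β).2) V ∧
      ∀ E ∈ Q, 𝒩.iv E.1 E.2 * V * 𝒩.iv E.1 E.2 = 𝒩.iv E.1 E.2 * X * 𝒩.iv E.1 E.2 := by
  obtain ⟨V, hVn, hV⟩ := exists_wsum (Y := fun _ => X) zero_le_two (norm_nonneg X) h.R_sq h.S_sq
    (fun _ => le_rfl)
  simp only [fun a b => (𝒩.iv_proj a b).isSelfAdjoint.star_eq] at hV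
  refine ⟨V, hV.alg fun β => alg_mul (alg_mul (iv_mem_alg _ _ _) hX) (iv_mem_alg _ _ _), hVn, hV,
    fun E hE => ?_⟩
  obtain ⟨F, h1, h2⟩ := h.fin E hE
  rw [← h2 X hX]
  exact (hV.compress _ _).unique (IsWSum.of_finset F fun β hβ => h1 β hβ X)

theorem assembly [TopologicalSpace.SeparableSpace H] : ∃ C : ℝ, 0 ≤ C ∧ ∀ (X : H →L[ℂ] H) (_ : X ∈ 𝒩.alg)
    (ε : ℝ) (_ : 0 < ε) (D₁ D₂ : ℝ × ℝ → Prop) (Q₁ Q₂ : Set (ℝ × ℝ)) (B₁ B₂ : Type)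
    (R₁ S₁ : B₁ → ℝ × ℝ) (R₂ S₂ : B₂ → ℝ × ℝ) (L₁ : B₁ → List (ℕ → ℝ × ℝ))
    (L₂ : B₂ → List (ℕ → ℝ × ℝ)), BlkSys 𝒩 D₁ Q₁ B₁ R₁ S₁ L₁ → BlkSys 𝒩 D₂ Q₂ B₂ R₂ S₂ L₂ →
    (∀ a b, D₁ a → D₂ b → essNorm (𝒩.cor X (meet a b)) < ε) →
    ∃ X₁ ∈ 𝒩.alg, ∃ X₂ ∈ 𝒩.alg, ∃ Z ∈ 𝒩.alg, X = X₁ + X₂ + Z ∧ ‖X₁‖ ≤ C * (‖X‖ + ε) ∧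
      ‖X₂‖ ≤ C * (‖X‖ + ε) ∧ ‖Z‖ ≤ C * ε ∧
      (∀ E ∈ Q₁, IsCompactOperator ⇑(𝒩.iv E.1 E.2 * X₁ * 𝒩.iv E.1 E.2)) ∧
      (∀ E ∈ Q₂, IsCompactOperator ⇑(𝒩.iv E.1 E.2 * X₂ * 𝒩.iv E.1 E.2)) := by
  classical
  obtain ⟨C, hC, hblock⟩ := 𝒩.block_lemma
  refine ⟨8 * C + 6, by positivity, ?_⟩
  intro X hX ε hε D₁ D₂ Q₁ Q₂ B₁ B₂ R₁ S₁ R₂ S₂ L₁ L₂ h₁ h₂ hess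
  have := h₁.cnt
  have := h₂.cnt
  obtain ⟨c₁, hc₁⟩ := Countable.exists_injective_nat B₁
  obtain ⟨c₂, hc₂⟩ := Countable.exists_injective_nat B₂
  obtain ⟨code, hcode⟩ := Countable.exists_injective_nat (B₁ × B₂)
  obtain ⟨Φ₁, hΦ₁, nΦ₁, wΦ₁, eΦ₁⟩ := phi_exists h₁ hX
  obtain ⟨Φ₂, hΦ₂, nΦ₂, wΦ₂, eΦ₂⟩ := phi_exists h₂ hΦ₁
  have hb := fun m : B₁ × B₂ => hblock X hX (L₁ m.1) (L₂ m.2) ε ((1 / 2) ^ code m) (code m)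
    (h₁.len _) (h₂.len _) (h₁.chn _) (h₂.chn _) hε (by positivity) (by
      intro f hf g hg j
      rcases h₁.sub _ f hf j with a | a
      · rcases h₂.sub _ g hg j with b | b
        · exact hess _ _ a b
        · refine essNorm_lt_of_cpt hε (null_triv hX ?_)
          exact (min_le_right _ _).trans (b.trans (le_max_right _ _))
      · refine essNorm_lt_of_cpt hε (null_triv hX ?_)
        exact (min_le_left _ _).trans (a.trans (le_max_left _ _)))
  choose Z hZ K hK Y₁ hY₁ Y₂ hY₂ hXeq hKc hZn hKn hY₁n hY₂n hN₁ hN₂ using hb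
  let K₁ : B₁ × B₂ → H →L[ℂ] H := fun m => if c₂ m.2 ≤ c₁ m.1 then K m else 0
  let K₂ : B₁ × B₂ → H →L[ℂ] H := fun m => if c₂ m.2 ≤ c₁ m.1 then 0 else K m
  have hKsum : ∀ m, K m = K₁ m + K₂ m := by
    intro m; simp only [K₁, K₂]; split_ifs <;> simp
  set N := C * (‖X‖ + ε) with hN
  have hN0 : 0 ≤ N := by positivity
  have hK₁n : ∀ m, ‖K₁ m‖ ≤ N := by
    intro m; simp only [K₁]; split_ifs
    · exact hKn m
    · simpa using hN0
  have hK₂n : ∀ m, ‖K₂ m‖ ≤ N := by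
    intro m; simp only [K₂]; split_ifs
    · simpa using hN0
    · exact hKn m
  have hK₁a : ∀ m, K₁ m ∈ 𝒩.alg := by
    intro m; simp only [K₁]; split_ifs
    · exact hK m
    · exact alg_zero
  have hK₂a : ∀ m, K₂ m ∈ 𝒩.alg := by
    intro m; simp only [K₂]; split_ifs
    · exact alg_zero
    · exact hK m
  have hK₁c : ∀ m, IsCompactOperator ⇑(K₁ m) := by
    intro m; simp only [K₁]; split_ifs
    · exact hKc m
    · exact cpt_zero
  have hK₂c : ∀ m, IsCompactOperator ⇑(K₂ m) := by
    intro m; simp only [K₂]; split_ifs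
    · exact cpt_zero
    · exact hKc m
  have hRsq := Sq.prod zero_le_two h₁.R_sq h₂.R_sq
  have hSsq := Sq.prod zero_le_two h₁.S_sq h₂.S_sq
  let T : (B₁ × B₂ → H →L[ℂ] H) → B₁ × B₂ → H →L[ℂ] H := fun W m =>
    𝒩.iv (R₂ m.2).1 (R₂ m.2).2 * (𝒩.iv (R₁ m.1).1 (R₁ m.1).2 * W m *
      𝒩.iv (S₁ m.1).1 (S₁ m.1).2) * 𝒩.iv (S₂ m.2).1 (S₂ m.2).2
  have hTalg : ∀ W : B₁ × B₂ → H →L[ℂ] H, (∀ m, W m ∈ 𝒩.alg) → ∀ m, T W m ∈ 𝒩.alg := fun W hW m =>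
    alg_mul (alg_mul (iv_mem_alg _ _ _) (alg_mul (alg_mul (iv_mem_alg _ _ _) (hW m))
      (iv_mem_alg _ _ _))) (iv_mem_alg _ _ _)
  have hTex : ∀ (W : B₁ × B₂ → H →L[ℂ] H) (c : ℝ), 0 ≤ c → (∀ m, W m ∈ 𝒩.alg) → (∀ m, ‖W m‖ ≤ c) →
      ∃ V ∈ 𝒩.alg, ‖V‖ ≤ 4 * c ∧ IsWSum (T W) V := by
    intro W c hc hWa hWn
    obtain ⟨V, hVn, hV⟩ := exists_wsum (by norm_num) hc hRsq hSsq hWn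
    have e : (fun β => star (𝒩.iv (R₁ β.1).1 (R₁ β.1).2 * 𝒩.iv (R₂ β.2).1 (R₂ β.2).2) * W β *
        (𝒩.iv (S₁ β.1).1 (S₁ β.1).2 * 𝒩.iv (S₂ β.2).1 (S₂ β.2).2)) = T W := by
      funext m
      simp only [T, star_mul, fun a b => (𝒩.iv_proj a b).isSelfAdjoint.star_eq, mul_assoc]
    rw [e] at hV
    exact ⟨V, hV.alg (hTalg W hWa), by linarith, hV⟩
  obtain ⟨V₁, hV₁a, hV₁n, hV₁⟩ := hTex (fun m => Y₁ m + K₁ m) (2 * N) (by positivity)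
    (fun m => alg_add (hY₁ m) (hK₁a m))
    (fun m => (norm_add_le _ _).trans (by linarith [hY₁n m, hK₁n m]))
  obtain ⟨V₂, hV₂a, hV₂n, hV₂⟩ := hTex (fun m => Y₂ m + K₂ m) (2 * N) (by positivity)
    (fun m => alg_add (hY₂ m) (hK₂a m))
    (fun m => (norm_add_le _ _).trans (by linarith [hY₂n m, hK₂n m]))
  obtain ⟨VZ, hVZa, hVZn, hVZ⟩ := hTex Z (C * ε) (by positivity) hZ hZn
  obtain ⟨VX, -, -, hVX⟩ := hTex (fun _ => X) ‖X‖ (by positivity) (fun _ => hX) (fun _ => le_rfl)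
  have hsum : VX = V₁ + V₂ + VZ := by
    refine hVX.unique ?_
    have := (hV₁.add hV₂).add hVZ
    have e : (fun β => T (fun m => Y₁ m + K₁ m) β + T (fun m => Y₂ m + K₂ m) β + T Z β) =
        T fun _ => X := by
      funext m
      simp only [T]
      conv_rhs => rw [hXeq m, hKsum m]
      noncomm_ring
    rwa [e] at this
  have hΦ : Φ₂ = VX := by
    ext v
    apply ext_inner_left ℂ
    intro w
    have h1 := (Equiv.prodComm B₂ B₁).hasSum_iff.2 (hVX w v)
    have h2 := h1.prod_fiberwise (g := fun β₂ => (inner ℂ w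
      ((𝒩.iv (R₂ β₂).1 (R₂ β₂).2 * Φ₁ * 𝒩.iv (S₂ β₂).1 (S₂ β₂).2) v) : ℂ)) (fun β₂ => by
        have := (wΦ₁.compress (𝒩.iv (R₂ β₂).1 (R₂ β₂).2) (𝒩.iv (S₂ β₂).1 (S₂ β₂).2)) w v
        exact this)
    exact (wΦ₂ w v).unique h2
  refine ⟨(X - Φ₁) + V₁, alg_add (alg_sub hX hΦ₁) hV₁a, (Φ₁ - Φ₂) + V₂,
    alg_add (alg_sub hΦ₁ hΦ₂) hV₂a, VZ, hVZa, ?_, ?_, ?_, ?_, ?_, ?_⟩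
  · rw [hΦ, hsum]; abel
  · have a1 := norm_add_le (X - Φ₁) V₁
    have a2 := norm_sub_le X Φ₁
    have := norm_nonneg X
    nlinarith
  · have a1 := norm_add_le (Φ₁ - Φ₂) V₂
    have a2 := norm_sub_le Φ₁ Φ₂
    have := norm_nonneg X
    nlinarith
  · nlinarith
  · intro E hE
    have e1 : 𝒩.iv E.1 E.2 * (X - Φ₁ + V₁) * 𝒩.iv E.1 E.2 = 𝒩.iv E.1 E.2 * V₁ * 𝒩.iv E.1 E.2 := by
      rw [mul_add, add_mul, mul_sub, sub_mul, eΦ₁ E hE, sub_self, zero_add]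
    rw [e1]
    refine blk_half h₁ Prod.fst code hcode Y₁ K₁ _ (fun m => 𝒩.iv (R₂ m.2).1 (R₂ m.2).2)
      (fun m => 𝒩.iv (S₂ m.2).1 (S₂ m.2).2) {m | c₂ m.2 ≤ c₁ m.1} ?_ hY₁ hK₁c ?_ hN₁
      (fun m => iv_norm _ _ _) (fun m => iv_norm _ _ _) hE ?_ hV₁
    · intro β
      have : ((fun b => (β, b)) '' (c₂ ⁻¹' Iic (c₁ β))).Finite :=
        ((finite_Iic _).preimage hc₂.injOn).image _
      refine this.subset ?_
      rintro ⟨a, b⟩ ⟨h, rfl⟩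
      exact ⟨b, h, rfl⟩
    · intro m hm
      simp only [K₁]
      exact if_neg (show ¬ (c₂ m.2 ≤ c₁ m.1) from hm)
    · intro m
      simp only [T]
      have q1 := 𝒩.iv_comm E.1 E.2 (R₂ m.2).1 (R₂ m.2).2
      have q2 := 𝒩.iv_comm E.1 E.2 (S₂ m.2).1 (S₂ m.2).2
      calc _ = (𝒩.iv E.1 E.2 * 𝒩.iv (R₂ m.2).1 (R₂ m.2).2) * (𝒩.iv (R₁ m.1).1 (R₁ m.1).2 *
            (Y₁ m + K₁ m) * 𝒩.iv (S₁ m.1).1 (S₁ m.1).2) *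
            (𝒩.iv (S₂ m.2).1 (S₂ m.2).2 * 𝒩.iv E.1 E.2) := by simp only [mul_assoc]
        _ = _ := by rw [q1, ← q2]; simp only [mul_assoc]
  · intro E hE
    have e1 : 𝒩.iv E.1 E.2 * (Φ₁ - Φ₂ + V₂) * 𝒩.iv E.1 E.2 = 𝒩.iv E.1 E.2 * V₂ * 𝒩.iv E.1 E.2 := by
      rw [mul_add, add_mul, mul_sub, sub_mul, eΦ₂ E hE, sub_self, zero_add]
    rw [e1]
    refine blk_half h₂ Prod.snd code hcode Y₂ K₂ _ (fun m => 𝒩.iv (R₁ m.1).1 (R₁ m.1).2)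
      (fun m => 𝒩.iv (S₁ m.1).1 (S₁ m.1).2) {m | c₁ m.1 < c₂ m.2} ?_ hY₂ hK₂c ?_ hN₂
      (fun m => iv_norm _ _ _) (fun m => iv_norm _ _ _) hE ?_ hV₂
    · intro β
      have : ((fun b => (b, β)) '' (c₁ ⁻¹' Iic (c₂ β))).Finite :=
        ((finite_Iic _).preimage hc₁.injOn).image _
      refine this.subset ?_
      rintro ⟨a, b⟩ ⟨h, rfl⟩
      exact ⟨a, (show c₁ a ≤ c₂ b from le_of_lt h), rfl⟩
    · intro m hm
      simp only [K₂]
      exact if_pos (not_lt.1 (show ¬ (c₁ m.1 < c₂ m.2) from hm))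
    · intro m
      simp only [T]
      have q1 := 𝒩.iv_comm E.1 E.2 (R₁ m.1).1 (R₁ m.1).2
      have q2 := 𝒩.iv_comm E.1 E.2 (S₁ m.1).1 (S₁ m.1).2
      have q3 := 𝒩.iv_comm (R₂ m.2).1 (R₂ m.2).2 (R₁ m.1).1 (R₁ m.1).2
      have q4 := 𝒩.iv_comm (S₂ m.2).1 (S₂ m.2).2 (S₁ m.1).1 (S₁ m.1).2
      calc _ = 𝒩.iv E.1 E.2 * (𝒩.iv (R₂ m.2).1 (R₂ m.2).2 * 𝒩.iv (R₁ m.1).1 (R₁ m.1).2) *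
            (Y₂ m + K₂ m) * (𝒩.iv (S₁ m.1).1 (S₁ m.1).2 *
            𝒩.iv (S₂ m.2).1 (S₂ m.2).2) * 𝒩.iv E.1 E.2 := by simp only [mul_assoc]
        _ = (𝒩.iv E.1 E.2 * 𝒩.iv (R₁ m.1).1 (R₁ m.1).2) * 𝒩.iv (R₂ m.2).1 (R₂ m.2).2 *
            (Y₂ m + K₂ m) * 𝒩.iv (S₂ m.2).1 (S₂ m.2).2 * (𝒩.iv (S₁ m.1).1 (S₁ m.1).2 *
             𝒩.iv E.1 E.2) := by rw [q3, ← q4]; simp only [mul_assoc]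
        _ = _ := by rw [q1, ← q2]; simp only [mul_assoc]

end ContinuousNest

open Set Filter Topology
set_option linter.unusedSectionVars false

namespace ContinuousNest
variable {H : Type*} [NormedAddCommGroup H] [InnerProductSpace ℂ H] [CompleteSpace H]
variable {𝒩 : ContinuousNest H}

theorem iv_cor_iv {a b c d : ℝ} {f : ℝ × ℝ} (h1 : f.1 ≤ a) (h2 : d ≤ f.2) (Y : H →L[ℂ] H) :
    𝒩.iv a b * 𝒩.cor Y f * 𝒩.iv c d = 𝒩.iv a b * Y * 𝒩.iv c d := by
  have e1 : 𝒩.iv a b * 𝒩.co f.1 = 𝒩.iv a b := by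
    rw [iv_eq', mul_assoc, co_mul_co, max_eq_left h1]
  have e2 : 𝒩.pr f.2 * 𝒩.iv c d = 𝒩.iv c d := by
    rw [iv_eq', ← mul_assoc, pr_mul_pr, min_eq_right h2]
  calc _ = (𝒩.iv a b * 𝒩.co f.1) * Y * (𝒩.pr f.2 * 𝒩.iv c d) := by
        unfold cor; simp only [mul_assoc]
    _ = _ := by rw [e1, e2]

theorem iv_alg_iv_zero {a b c d : ℝ} (h : d ≤ a) {Y : H →L[ℂ] H} (hY : Y ∈ 𝒩.alg) :
    𝒩.iv a b * Y * 𝒩.iv c d = 0 := by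
  have := alg_zero_of_le hY h
  calc _ = 𝒩.pr b * (𝒩.co a * Y * 𝒩.pr d) * 𝒩.co c := by
        rw [iv_eq', iv_eq' 𝒩 c d]; simp only [mul_assoc]
    _ = _ := by rw [this]; simp

theorem blk_eq (E R S : ℝ × ℝ) (Y : H →L[ℂ] H) :
    𝒩.iv E.1 E.2 * (𝒩.iv R.1 R.2 * Y * 𝒩.iv S.1 S.2) * 𝒩.iv E.1 E.2 =
    𝒩.iv (max E.1 R.1) (min E.2 R.2) * Y * 𝒩.iv (max E.1 S.1) (min E.2 S.2) := by
  rw [← iv_mul, ← iv_mul, iv_comm E.1 E.2 S.1 S.2]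
  simp only [mul_assoc]

theorem exists_cofinal_up (A : Set ℝ) (hb : BddAbove A) (hne : A.Nonempty) :
    ∃ u : ℕ → ℝ, Monotone u ∧ (∀ n, u n ∈ A) ∧ ∀ a ∈ A, ∃ n, a ≤ u n := by
  by_cases hm : ∃ m ∈ A, ∀ a ∈ A, a ≤ m
  · obtain ⟨m, hm, h⟩ := hm
    exact ⟨fun _ => m, monotone_const, fun _ => hm, fun a ha => ⟨0, h a ha⟩⟩
  · push Not at hm
    obtain ⟨u, hu, ht, hA⟩ := exists_seq_tendsto_sSup hne hb
    refine ⟨u, hu, hA, fun a ha => ?_⟩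
    obtain ⟨b, hb', hab⟩ := hm a ha
    have : a < sSup A := hab.trans_le (le_csSup hb hb')
    obtain ⟨n, hn⟩ := (ht.eventually (lt_mem_nhds this)).exists
    exact ⟨n, hn.le⟩

theorem exists_cofinal_down (A : Set ℝ) (hb : BddBelow A) (hne : A.Nonempty) :
    ∃ u : ℕ → ℝ, Antitone u ∧ (∀ n, u n ∈ A) ∧ ∀ a ∈ A, ∃ n, u n ≤ a := by
  obtain ⟨u, h1, h2, h3⟩ := exists_cofinal_up (-A) hb.neg hne.neg
  refine ⟨fun n => - u n, fun i j h => neg_le_neg (h1 h), fun n => h2 n, fun a ha => ?_⟩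
  obtain ⟨n, hn⟩ := h3 (-a) (by simpa using ha)
  exact ⟨n, by linarith⟩

theorem chains_exist (D : ℝ × ℝ → Prop) (r σ : ℝ)
    (hintr : ∀ x y, r < x → x ≤ y → y < σ → D (x, y)) :
    ∃ L : List (ℕ → ℝ × ℝ), L.length = 3 ∧ (∀ f ∈ L, Chn f) ∧
      (∀ f ∈ L, ∀ n, D (f n) ∨ (f n).2 ≤ (f n).1) ∧
      ∀ x y, D (x, y) → (∀ x' y', x ≤ x' → y' ≤ y → D (x', y')) →
        ∃ f ∈ L, ∃ n, (f n).1 ≤ max x r ∧ min y σ ≤ (f n).2 ∨ min y σ ≤ max x r := by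
  have hone : ∀ n : ℕ, (0:ℝ) < 1 / ((n:ℝ) + 1) := fun n => by positivity
  -- left chain
  have hl : ∃ f : ℕ → ℝ × ℝ, Chn f ∧ (∀ n, D (f n) ∨ (f n).2 ≤ (f n).1) ∧
      ∀ y ≤ σ, D (r, y) → ∃ n, (f n).1 ≤ r ∧ y ≤ (f n).2 := by
    by_cases hne : {y | y ≤ σ ∧ D (r, y)}.Nonempty
    · obtain ⟨u, h1, h2, h3⟩ := exists_cofinal_up _ ⟨σ, fun y hy => hy.1⟩ hne
      refine ⟨fun n => (r, u n), fun j k h => ⟨le_rfl, h1 h⟩, fun n => Or.inl (h2 n).2, ?_⟩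
      intro y hy hD
      obtain ⟨n, hn⟩ := h3 y ⟨hy, hD⟩
      exact ⟨n, le_rfl, hn⟩
    · refine ⟨fun _ => (1, 0), fun j k h => ⟨le_rfl, le_rfl⟩, fun n => Or.inr (by simp), ?_⟩
      intro y hy hD
      exact absurd ⟨y, hy, hD⟩ hne
  have ht : ∃ f : ℕ → ℝ × ℝ, Chn f ∧ (∀ n, D (f n) ∨ (f n).2 ≤ (f n).1) ∧
      ∀ x, r ≤ x → D (x, σ) → ∃ n, (f n).1 ≤ x ∧ σ ≤ (f n).2 := by
    by_cases hne : {x | r ≤ x ∧ D (x, σ)}.Nonempty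
    · obtain ⟨u, h1, h2, h3⟩ := exists_cofinal_down _ ⟨r, fun y hy => hy.1⟩ hne
      refine ⟨fun n => (u n, σ), fun j k h => ⟨h1 h, le_rfl⟩, fun n => Or.inl (h2 n).2, ?_⟩
      intro y hy hD
      obtain ⟨n, hn⟩ := h3 y ⟨hy, hD⟩
      exact ⟨n, hn, le_rfl⟩
    · refine ⟨fun _ => (1, 0), fun j k h => ⟨le_rfl, le_rfl⟩, fun n => Or.inr (by simp), ?_⟩
      intro y hy hD
      exact absurd ⟨y, hy, hD⟩ hne
  obtain ⟨f, f1, f2, f3⟩ := hl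
  obtain ⟨g, g1, g2, g3⟩ := ht
  let q : ℕ → ℝ × ℝ := fun n => (r + 1 / ((n:ℝ) + 1), σ - 1 / ((n:ℝ) + 1))
  have q1 : Chn q := by
    intro j k h
    have : 1 / ((k:ℝ) + 1) ≤ 1 / ((j:ℝ) + 1) := one_div_le_one_div_of_le (by positivity) (by
      have : (j:ℝ) ≤ k := by exact_mod_cast h
      linarith)
    constructor <;> simp only [q] <;> linarith
  have q2 : ∀ n, D (q n) ∨ (q n).2 ≤ (q n).1 := by
    intro n
    by_cases h : (q n).2 ≤ (q n).1
    · exact Or.inr h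
    · left
      push Not at h
      have := hone n
      exact hintr _ _ (by linarith) h.le (by linarith)
  refine ⟨[f, g, q], rfl, by simp [f1, g1, q1], by simp [f2, g2, q2], ?_⟩
  intro x y hD hdn
  by_cases h0 : min y σ ≤ max x r
  · exact ⟨f, by simp, 0, Or.inr h0⟩
  by_cases hx : x ≤ r
  · obtain ⟨n, h1, h2⟩ := f3 (min y σ) (min_le_right _ _) (hdn _ _ hx (min_le_left _ _))
    exact ⟨f, by simp, n, Or.inl ⟨h1.trans (le_max_right _ _), h2⟩⟩
  push Not at hx
  by_cases hy : σ ≤ y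
  · obtain ⟨n, h1, h2⟩ := g3 x hx.le (hdn _ _ le_rfl hy)
    exact ⟨g, by simp, n, Or.inl ⟨h1.trans (le_max_left _ _), (min_le_right _ _).trans h2⟩⟩
  push Not at hy
  obtain ⟨n, hn⟩ := exists_nat_one_div_lt (show 0 < min (x - r) (σ - y) from
    lt_min (by linarith) (by linarith))
  have a1 := lt_min_iff.1 hn
  refine ⟨q, by simp, n, Or.inl ⟨?_, ?_⟩⟩
  · rw [max_eq_left hx.le]; simp only [q]; linarith [a1.1]
  · rw [min_eq_left hy.le]; simp only [q]; linarith [a1.2]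

theorem blkSys_of_grid {ι : Type} [Countable ι] (D : ℝ × ℝ → Prop) (Q : Set (ℝ × ℝ))
    (hD : ∀ x y x' y', D (x, y) → x ≤ x' → y' ≤ y → D (x', y'))
    (e : ι → ℤ → ℝ) (hm : ∀ c, Monotone (e c))
    (hno : ∀ c c', c ≠ c' → (∀ i k, e c i ≤ e c' k) ∨ (∀ i k, e c' k ≤ e c i))
    (hα : ∀ c j x y, e c j < x → x ≤ y → y < e c (j + 2) → D (x, y))
    (hQ : ∀ E ∈ Q, D E ∧ ∃ c j, e c j ≤ E.1 ∧ E.2 ≤ e c (j + 2)) :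
    ∃ (B : Type) (R S : B → ℝ × ℝ) (L : B → List (ℕ → ℝ × ℝ)), BlkSys 𝒩 D Q B R S L := by
  classical
  let z : Bool → ℤ := fun b => if b then 1 else 0
  let B := (ι × ℤ) × Bool
  let R : B → ℝ × ℝ := fun β => (e β.1.1 β.1.2, e β.1.1 (β.1.2 + 1))
  let S : B → ℝ × ℝ := fun β => (e β.1.1 (β.1.2 + z β.2), e β.1.1 (β.1.2 + z β.2 + 1))
  have hz : ∀ b, z b = 0 ∨ z b = 1 := by intro b; cases b <;> simp [z]
  have hintr : ∀ β : B, ∀ x y, (R β).1 < x → x ≤ y → y < (S β).2 → D (x, y) := by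
    intro β x y h1 h2 h3
    refine hα β.1.1 β.1.2 x y h1 h2 (h3.trans_le (hm _ ?_))
    rcases hz β.2 with h | h <;> omega
  choose L L1 L2 L3 L4 using fun β : B => chains_exist D (R β).1 (S β).2 (hintr β)
  have orth : ∀ (w : ℤ) (m n : ι × ℤ), m ≠ n →
      𝒩.iv (e m.1 (m.2 + w)) (e m.1 (m.2 + w + 1)) * 𝒩.iv (e n.1 (n.2 + w)) (e n.1 (n.2 + w + 1))
        = 0 := by
    rintro w ⟨c, i⟩ ⟨c', k⟩ hne
    rw [iv_mul]
    apply iv_zero_of_le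
    simp only
    by_cases hc : c = c'
    · subst hc
      have : i ≠ k := fun h => hne (by rw [h])
      rcases lt_or_gt_of_ne this with h | h
      · exact (min_le_left _ _).trans (le_trans (hm c (by omega)) (le_max_right _ _))
      · exact (min_le_right _ _).trans (le_trans (hm c (by omega)) (le_max_left _ _))
    · rcases hno c c' hc with h | h
      · exact (min_le_left _ _).trans (le_trans (h _ _) (le_max_right _ _))
      · exact (min_le_right _ _).trans (le_trans (h _ _) (le_max_left _ _))
  refine ⟨B, R, S, L, ?_, ?_, ?_, ?_, L1, L2, L3, ?_⟩
  · infer_instance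
  · apply Sq.bool
    intro b
    apply sq_orth (fun i => iv_proj _ _ _)
    intro m n hmn
    simpa using orth 0 m n hmn
  · apply Sq.bool
    intro b
    apply sq_orth (fun i => iv_proj _ _ _)
    intro m n hmn
    exact orth (z b) m n hmn
  · intro E hE
    obtain ⟨-, c, j, hx, hy⟩ := hQ E hE
    refine ⟨{((c, j), false), ((c, j), true), ((c, j + 1), false)}, ?_, ?_⟩
    · rintro ⟨⟨c', i⟩, b⟩ hβ A
      have key : 𝒩.iv E.1 E.2 * 𝒩.iv (R ((c', i), b)).1 (R ((c', i), b)).2 = 0 ∨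
          𝒩.iv (S ((c', i), b)).1 (S ((c', i), b)).2 * 𝒩.iv E.1 E.2 = 0 := by
        rw [iv_mul, iv_mul]
        simp only [R, S]
        by_cases hc : c = c'
        · subst hc
          rcases lt_trichotomy i j with h | h | h
          · left; apply iv_zero_of_le
            exact (min_le_right _ _).trans (le_trans ((hm c (by omega)).trans hx) (le_max_left _ _))
          · subst h
            exfalso; apply hβ
            cases b <;> simp
          · by_cases h2 : i = j + 1
            · subst h2
              cases b
              · exfalso; apply hβ; simp
              · right; apply iv_zero_of_le
                refine (min_le_right _ _).trans (le_trans (hy.trans (hm c ?_)) (le_max_left _ _))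
                simp [z]; omega
            · left; apply iv_zero_of_le
              exact (min_le_left _ _).trans (le_trans (hy.trans (hm c (by omega))) (le_max_right _ _))
        · left; apply iv_zero_of_le
          rcases hno c c' hc with h | h
          · exact (min_le_left _ _).trans (le_trans (hy.trans (h _ _)) (le_max_right _ _))
          · exact (min_le_right _ _).trans (le_trans ((h _ _).trans hx) (le_max_left _ _))
      rcases key with h | h
      · calc _ = (𝒩.iv E.1 E.2 * 𝒩.iv (R ((c', i), b)).1 (R ((c', i), b)).2) * A *
              𝒩.iv (S ((c', i), b)).1 (S ((c', i), b)).2 * 𝒩.iv E.1 E.2 := by simp only [mul_assoc]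
          _ = 0 := by rw [h]; simp
      · calc _ = 𝒩.iv E.1 E.2 * 𝒩.iv (R ((c', i), b)).1 (R ((c', i), b)).2 * A *
              (𝒩.iv (S ((c', i), b)).1 (S ((c', i), b)).2 * 𝒩.iv E.1 E.2) := by simp only [mul_assoc]
          _ = 0 := by rw [h]; simp
    · intro X hX
      have n1 : ((c, j), false) ∉ ({((c, j), true), ((c, j + 1), false)} : Finset B) := by
        simp
      have n2 : ((c, j), true) ∉ ({((c, j + 1), false)} : Finset B) := by simp
      rw [Finset.sum_insert n1, Finset.sum_insert n2, Finset.sum_singleton]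
      have r1 : R ((c, j), false) = (e c j, e c (j + 1)) := rfl
      have r2 : R ((c, j), true) = (e c j, e c (j + 1)) := rfl
      have r3 : R ((c, j + 1), false) = (e c (j + 1), e c (j + 2)) := by
        simp only [R]; rw [show j + 1 + 1 = j + 2 by ring]
      have s1 : S ((c, j), false) = (e c j, e c (j + 1)) := by simp [S, z]
      have s2 : S ((c, j), true) = (e c (j + 1), e c (j + 2)) := by
        simp only [S, z]; simp; rw [show j + 1 + 1 = j + 2 by ring]
      have s3 : S ((c, j + 1), false) = (e c (j + 1), e c (j + 2)) := by
        simp only [S, z]; simp; rw [show j + 1 + 1 = j + 2 by ring]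
      rw [r1, r3, s1, s2, s3]; try rw [r2]
      have o1 : e c j ≤ e c (j + 1) := hm c (by omega)
      have o2 : e c (j + 1) ≤ e c (j + 2) := hm c (by omega)
      set A := 𝒩.iv (e c j) (e c (j + 1)) with hA
      set A' := 𝒩.iv (e c (j + 1)) (e c (j + 2)) with hA'
      set P := 𝒩.iv E.1 E.2 with hP
      have hsum : A + A' = 𝒩.iv (e c j) (e c (j + 2)) := by
        rw [hA, hA', iv_eq_sub 𝒩 o1, iv_eq_sub 𝒩 o2, iv_eq_sub 𝒩 (o1.trans o2)]; abel
      have hP1 : P * (A + A') = P := by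
        rw [hsum, hP, iv_mul, max_eq_left hx, min_eq_left hy]
      have hP2 : (A + A') * P = P := by
        rw [hsum, hP, iv_mul, max_eq_right hx, min_eq_right hy]
      have hzero : A' * X * A = 0 := iv_alg_iv_zero le_rfl hX
      calc _ = P * (A * X * A + A * X * A' + A' * X * A') * P := by noncomm_ring
        _ = P * (A * X * A + A * X * A' + A' * X * A' + A' * X * A) * P := by rw [hzero, add_zero]
        _ = (P * (A + A')) * X * ((A + A') * P) := by noncomm_ring
        _ = _ := by rw [hP1, hP2]
  · intro E hE β
    obtain ⟨f, hf, n, h⟩ := L4 β E.1 E.2 (hQ E hE).1 (fun x' y' => hD _ _ _ _ (hQ E hE).1)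
    refine ⟨f, hf, n, fun Y hY => ?_⟩
    rw [blk_eq, blk_eq]
    rcases h with ⟨h1, h2⟩ | h
    · rw [iv_cor_iv h1 h2]
    · rw [iv_alg_iv_zero h hY, iv_alg_iv_zero h (cor_alg hY _)]

end ContinuousNest

open Set Filter Topology
set_option linter.unusedSectionVars false

section comb

theorem right_step (D : ℝ → ℝ → Prop) (hD : ∀ x y x' y', D x y → x ≤ x' → y' ≤ y → D x' y')
    (c b : ℝ) (hloc : ∀ z, c ≤ z → z < b → ∃ u v, u < z ∧ z < v ∧ D u v)
    (G W : ℝ) (hc : c ≤ G) (hb : G < b) (hGW : G < W) (hDW : D G W) :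
    ∃ G' W' e1 e2 e3 : ℝ, (c ≤ G' ∧ G' < b ∧ G' < W' ∧ D G' W') ∧
      G < e1 ∧ e1 < e2 ∧ e2 < e3 ∧ e3 < G' ∧ e1 < W ∧
      (∀ y < b, D G y → (G + y) / 2 ≤ G') ∧
      ((∃ y < b, ¬ D G y) → ¬ D G G' ∧ D G e2 ∧ D e1 e3 ∧ D e2 G' ∧ D e3 W') := by
  by_cases hv : ∃ y < b, ¬ D G y
  · obtain ⟨y0, hy0, hny0⟩ := hv
    let A := {y | y ≤ b ∧ D G y}
    have hA : BddAbove A := ⟨b, fun y hy => hy.1⟩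
    have hmem : min W b ∈ A := ⟨min_le_right _ _, hD _ _ _ _ hDW le_rfl (min_le_left _ _)⟩
    have hle : sSup A ≤ y0 := by
      refine csSup_le ⟨_, hmem⟩ ?_
      rintro y ⟨_, hy⟩
      by_contra h
      push Not at h
      exact hny0 (hD _ _ _ _ hy le_rfl h.le)
    have hgt : G < sSup A := (lt_min hGW hb).trans_le (le_csSup hA hmem)
    have hlow : ∀ y < sSup A, D G y := by
      intro y hy
      obtain ⟨y', hy', h⟩ := exists_lt_of_lt_csSup ⟨_, hmem⟩ hy
      exact hD _ _ _ _ hy'.2 le_rfl h.le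
    set φ := sSup A with hφ
    have hφb : φ < b := hle.trans_lt hy0
    obtain ⟨u, v, hu, hvv, huv⟩ := hloc φ (hc.trans hgt.le) hφb
    obtain ⟨G', h1, h2⟩ := exists_between (lt_min hvv hφb)
    obtain ⟨h2, h3⟩ := lt_min_iff.1 h2
    obtain ⟨e1, h4, h5⟩ := exists_between (lt_min hgt hGW)
    obtain ⟨h5, h6⟩ := lt_min_iff.1 h5
    obtain ⟨e2, h7, h8⟩ := exists_between (max_lt h5 hu)
    obtain ⟨h7, h9⟩ := max_lt_iff.1 h7
    obtain ⟨e3, h10, h11⟩ := exists_between h8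
    refine ⟨G', v, e1, e2, e3, ⟨by linarith, h3, h2, hD _ _ _ _ huv (by linarith) le_rfl⟩,
      h4, h7, h10, by linarith, h6, ?_, fun _ => ⟨?_, hlow _ h8, ?_, ?_, ?_⟩⟩
    · intro y hy hDy
      have : y ≤ φ := le_csSup hA ⟨hy.le, hDy⟩
      linarith
    · intro h
      have : G' ≤ φ := le_csSup hA ⟨h3.le, h⟩
      linarith
    · exact hD _ _ _ _ (hlow _ h11) h4.le le_rfl
    · exact hD _ _ _ _ huv h9.le h2.le
    · exact hD _ _ _ _ huv (by linarith) le_rfl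
  · obtain ⟨u, v, hu, hvv, huv⟩ := hloc ((G + b) / 2) (by linarith) (by linarith)
    obtain ⟨e1, h4, h5⟩ := exists_between (lt_min (show G < (G + b) / 2 by linarith) hGW)
    obtain ⟨h5, h6⟩ := lt_min_iff.1 h5
    obtain ⟨e2, h7, h8⟩ := exists_between h5
    obtain ⟨e3, h10, h11⟩ := exists_between h8
    refine ⟨(G + b) / 2, v, e1, e2, e3, ⟨by linarith, by linarith, hvv,
      hD _ _ _ _ huv hu.le le_rfl⟩, h4, h7, h10, h11, h6, ?_, fun h => absurd h hv⟩
    intro y hy _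
    linarith

theorem right_lemma (D : ℝ → ℝ → Prop) (hD : ∀ x y x' y', D x y → x ≤ x' → y' ≤ y → D x' y')
    (c b : ℝ) (hcb : c < b) (hloc : ∀ z, c ≤ z → z < b → ∃ u v, u < z ∧ z < v ∧ D u v)
    (W : ℝ) (hcW : c < W) (hDW : D c W) :
    ∃ e : ℕ → ℝ, StrictMono e ∧ e 0 = c ∧ (∀ n, e n < b) ∧ (∀ z < b, ∃ n, z < e n) ∧ e 1 < W ∧
      (∀ j, (∃ y < b, ¬ D (e (4 * j)) y) → ¬ D (e (4 * j)) (e (4 * j + 4))) ∧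
      (∀ i, (∃ y < b, ¬ D (e (4 * (i / 4))) y) → D (e i) (e (i + 2))) := by
  classical
  let Stt := {p : ℝ × ℝ // c ≤ p.1 ∧ p.1 < b ∧ p.1 < p.2 ∧ D p.1 p.2}
  have hstep : ∀ σ : Stt, ∃ (σ' : Stt) (e1 e2 e3 : ℝ),
      σ.1.1 < e1 ∧ e1 < e2 ∧ e2 < e3 ∧ e3 < σ'.1.1 ∧ e1 < σ.1.2 ∧
      (∀ y < b, D σ.1.1 y → (σ.1.1 + y) / 2 ≤ σ'.1.1) ∧
      ((∃ y < b, ¬ D σ.1.1 y) → ¬ D σ.1.1 σ'.1.1 ∧ D σ.1.1 e2 ∧ D e1 e3 ∧ D e2 σ'.1.1 ∧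
        D e3 σ'.1.2) := by
    rintro ⟨⟨G, W⟩, h1, h2, h3, h4⟩
    obtain ⟨G', W', e1, e2, e3, h, h'⟩ := right_step D hD c b hloc G W h1 h2 h3 h4
    exact ⟨⟨(G', W'), h⟩, e1, e2, e3, h'⟩
  choose nx f1 f2 f3 p1 p2 p3 p4 p5 p6 p7 using hstep
  let s : ℕ → Stt := fun n => Nat.rec ⟨(c, W), le_rfl, hcb, hcW, hDW⟩ (fun _ σ => nx σ) n
  have s0 : (s 0).1 = (c, W) := rfl
  have sS : ∀ n, s (n + 1) = nx (s n) := fun n => rfl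
  let e : ℕ → ℝ := fun n => if n % 4 = 0 then (s (n / 4)).1.1 else if n % 4 = 1 then f1 (s (n / 4))
    else if n % 4 = 2 then f2 (s (n / 4)) else f3 (s (n / 4))
  have e0 : ∀ j, e (4 * j) = (s j).1.1 := fun j => by
    simp only [e]; rw [if_pos (by omega), show 4 * j / 4 = j by omega]
  have e1 : ∀ j, e (4 * j + 1) = f1 (s j) := fun j => by
    simp only [e]; rw [if_neg (by omega), if_pos (by omega), show (4 * j + 1) / 4 = j by omega]
  have e2 : ∀ j, e (4 * j + 2) = f2 (s j) := fun j => by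
    simp only [e]; rw [if_neg (by omega), if_neg (by omega), if_pos (by omega),
      show (4 * j + 2) / 4 = j by omega]
  have e3 : ∀ j, e (4 * j + 3) = f3 (s j) := fun j => by
    simp only [e]; rw [if_neg (by omega), if_neg (by omega), if_neg (by omega),
      show (4 * j + 3) / 4 = j by omega]
  have e4 : ∀ j, e (4 * j + 4) = (nx (s j)).1.1 := fun j => by
    rw [show 4 * j + 4 = 4 * (j + 1) by ring, e0, sS]
  have e5 : ∀ j, e (4 * j + 5) = f1 (nx (s j)) := fun j => by
    rw [show 4 * j + 5 = 4 * (j + 1) + 1 by ring, e1, sS]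
  have hmono : StrictMono e := by
    refine strictMono_nat_of_lt_succ fun n => ?_
    obtain ⟨j, r, hr, rfl⟩ : ∃ j r, r < 4 ∧ n = 4 * j + r := ⟨n / 4, n % 4, by omega, by omega⟩
    interval_cases r
    · rw [add_zero, e0, e1]; exact p1 _
    · rw [show 4 * j + 1 + 1 = 4 * j + 2 by ring, e1, e2]; exact p2 _
    · rw [show 4 * j + 2 + 1 = 4 * j + 3 by ring, e2, e3]; exact p3 _
    · rw [show 4 * j + 3 + 1 = 4 * j + 4 by ring, e3, e4]; exact p4 _
  have hlt : ∀ n, e n < b := by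
    intro n
    have : e n ≤ e (4 * n) := hmono.monotone (by omega)
    rw [e0] at this
    exact this.trans_lt (s n).2.2.1
  refine ⟨e, hmono, ?_, hlt, ?_, ?_, ?_, ?_⟩
  · rw [show 0 = 4 * 0 by ring, e0, s0]
  · by_contra hcon
    push Not at hcon
    obtain ⟨z, hz, hz'⟩ := hcon
    have hbd : BddAbove (range e) := ⟨z, by rintro _ ⟨n, rfl⟩; exact hz' n⟩
    have ht := tendsto_atTop_ciSup hmono.monotone hbd
    set L := ⨆ i, e i with hL
    have hLz : L ≤ z := ciSup_le hz'
    have hLe : ∀ n, e n ≤ L := fun n => le_ciSup hbd n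
    have hcL : c ≤ L := by
      have := hLe (4 * 0)
      rw [e0, s0] at this
      exact this
    obtain ⟨u, v, hu, hv, huv⟩ := hloc L hcL (hLz.trans_lt hz)
    obtain ⟨y, hy1, hy2⟩ := exists_between (lt_min hv (hLz.trans_lt hz))
    obtain ⟨hy2, hy3⟩ := lt_min_iff.1 hy2
    have h1 : max u (2 * L - y) < L := max_lt hu (by linarith)
    obtain ⟨n, hn⟩ := (ht.eventually (lt_mem_nhds h1)).exists
    have h2 : e n ≤ e (4 * n) := hmono.monotone (by omega)
    obtain ⟨h3, h4⟩ := max_lt_iff.1 (hn.trans_le h2)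
    have h5 := p6 (s n) y hy3 (by rw [← e0]; exact hD _ _ _ _ huv h3.le hy2.le)
    rw [← e0, ← e4] at h5
    have := hLe (4 * n + 4)
    linarith
  · have := p5 (s 0)
    rw [← e1, s0] at this
    exact this
  · intro j hj
    rw [e0] at hj ⊢
    rw [e4]
    exact (p7 _ hj).1
  · intro i hi
    obtain ⟨j, r, hr, rfl⟩ : ∃ j r, r < 4 ∧ i = 4 * j + r := ⟨i / 4, i % 4, by omega, by omega⟩
    rw [show (4 * j + r) / 4 = j by omega, e0] at hi
    obtain ⟨q1, q2, q3, q4, q5⟩ := p7 _ hi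
    interval_cases r
    · rw [add_zero, e0, e2]; exact q2
    · rw [show 4 * j + 1 + 2 = 4 * j + 3 by ring, e1, e3]; exact q3
    · rw [show 4 * j + 2 + 2 = 4 * j + 4 by ring, e2, e4]; exact q4
    · rw [show 4 * j + 3 + 2 = 4 * j + 5 by ring, e3, e5]
      exact hD _ _ _ _ q5 le_rfl (p5 _).le

/-- the clipped grid on the right side -/
theorem right_clip (D : ℝ → ℝ → Prop) (hD : ∀ x y x' y', D x y → x ≤ x' → y' ≤ y → D x' y')
    (c b : ℝ) (hcb : c < b) (hloc : ∀ z, c ≤ z → z < b → ∃ u v, u < z ∧ z < v ∧ D u v)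
    (W : ℝ) (hcW : c < W) (hDW : D c W) :
    ∃ e e' : ℕ → ℝ, ∃ v : ℕ → Prop, StrictMono e ∧ e 0 = c ∧ (∀ n, e n < b) ∧
      (∀ z < b, ∃ n, z < e n) ∧ e 1 < W ∧
      (∀ i j, i ≤ j → v j → v i) ∧ (∀ j, v j → ¬ D (e (4 * j)) (e (4 * j + 4))) ∧
      ((∃ y < b, ¬ D c y) → v 0) ∧
      Monotone e' ∧ (∀ n, e n ≤ e' n) ∧ (∀ n, e' n ≤ b) ∧ e' 0 = e 0 ∧ e' 1 = e 1 ∧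
      (∀ i, e' (i + 1) = b ∨ e' i = e i ∧ e' (i + 1) = e (i + 1) ∧ (i = 0 ∨ v ((i - 1) / 4))) ∧
      (∀ i x y, e' i < x → x ≤ y → y < e' (i + 2) → D x y) := by
  classical
  obtain ⟨e, h1, h2, h3, h4, h5, h6, h7⟩ := right_lemma D hD c b hcb hloc W hcW hDW
  let v : ℕ → Prop := fun j => ∃ y < b, ¬ D (e (4 * j)) y
  have hv : ∀ i j, i ≤ j → v j → v i := by
    rintro i j hij ⟨y, hy, hn⟩
    exact ⟨y, hy, fun h => hn (hD _ _ _ _ h (h1.monotone (by omega)) le_rfl)⟩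
  let e' : ℕ → ℝ := fun i => if i ≤ 1 ∨ v ((i - 2) / 4) then e i else b
  have ha : ∀ i, (i ≤ 1 ∨ v ((i - 2) / 4)) → e' i = e i := fun i h => if_pos h
  have hb : ∀ i, ¬ (i ≤ 1 ∨ v ((i - 2) / 4)) → e' i = b := fun i h => if_neg h
  have hle : ∀ n, e n ≤ e' n := by
    intro n
    by_cases h : n ≤ 1 ∨ v ((n - 2) / 4)
    · rw [ha n h]
    · rw [hb n h]; exact (h3 n).le
  have hleb : ∀ n, e' n ≤ b := by
    intro n
    by_cases h : n ≤ 1 ∨ v ((n - 2) / 4)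
    · rw [ha n h]; exact (h3 n).le
    · rw [hb n h]
  have hprev : ∀ i, (i + 1 ≤ 1 ∨ v ((i + 1 - 2) / 4)) → (i ≤ 1 ∨ v ((i - 2) / 4)) := by
    rintro i (h | h)
    · left; omega
    · right; exact hv _ _ (by omega) h
  refine ⟨e, e', v, h1, h2, h3, h4, h5, hv, h6, ?_, ?_, hle, hleb, ha 0 (by simp), ha 1 (by simp),
    ?_, ?_⟩
  · intro h
    simpa [v, h2] using h
  · refine monotone_nat_of_le_succ fun n => ?_
    by_cases h : n + 1 ≤ 1 ∨ v ((n + 1 - 2) / 4)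
    · rw [ha _ h, ha _ (hprev _ h)]; exact (h1 (by omega)).le
    · rw [hb _ h]; exact hleb n
  · intro i
    by_cases h : i + 1 ≤ 1 ∨ v ((i + 1 - 2) / 4)
    · right
      refine ⟨ha _ (hprev _ h), ha _ h, ?_⟩
      rcases h with h | h
      · left; omega
      · right; exact h
    · left; exact hb _ h
  · intro i x y hx hxy hy
    by_cases hi : v (i / 4)
    · rw [ha (i + 2) (Or.inr hi)] at hy
      exact hD _ _ _ _ (h7 i hi) ((hle i).trans hx.le) hy.le
    · simp only [v] at hi
      push Not at hi
      have := hi y (hy.trans_le (hleb _))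
      exact hD _ _ _ _ this ((h1.monotone (by omega)).trans ((hle i).trans hx.le)) le_rfl

end comb

open Set Filter Topology
set_option linter.unusedSectionVars false

section comb

theorem int_bracket {g : ℤ → ℝ} (hm : Monotone g) {z : ℝ} (h1 : ∃ i, g i ≤ z) (h2 : ∃ i, z < g i) :
    ∃ i, g i ≤ z ∧ z < g (i + 1) := by
  obtain ⟨k, hk⟩ := h2
  have hb : ∃ b : ℤ, ∀ i, g i ≤ z → i ≤ b := ⟨k, fun i hi => by
    by_contra h
    push Not at h
    exact absurd (hm h.le) (not_le.2 (hi.trans_lt hk))⟩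
  obtain ⟨i, hi, hmax⟩ := Int.exists_greatest_of_bdd hb h1
  refine ⟨i, hi, ?_⟩
  by_contra h
  push Not at h
  have := hmax _ h
  omega

/-- piecewise linear interpolation -/
noncomputable def plf (g : ℤ → ℝ) (s : ℝ) : ℝ := g ⌊s⌋ + Int.fract s * (g (⌊s⌋ + 1) - g ⌊s⌋)

theorem plf_int (g : ℤ → ℝ) (n : ℤ) : plf g n = g n := by simp [plf]

theorem plf_bd {g : ℤ → ℝ} (hg : StrictMono g) (s : ℝ) :
    g ⌊s⌋ ≤ plf g s ∧ plf g s < g (⌊s⌋ + 1) := by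
  have h1 := Int.fract_nonneg s
  have h2 := Int.fract_lt_one s
  have h3 : g ⌊s⌋ < g (⌊s⌋ + 1) := hg (by omega)
  unfold plf
  constructor <;> nlinarith

theorem plf_strictMono {g : ℤ → ℝ} (hg : StrictMono g) : StrictMono (plf g) := by
  intro s t hst
  rcases (Int.floor_mono hst.le).lt_or_eq with h | h
  · exact (plf_bd hg s).2.trans_le ((hg.monotone (by omega)).trans (plf_bd hg t).1)
  · unfold plf
    rw [h]
    have h3 : g ⌊t⌋ < g (⌊t⌋ + 1) := hg (by omega)
    have : Int.fract s < Int.fract t := by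
      unfold Int.fract; rw [h]; linarith
    nlinarith

theorem plf_surj {g : ℤ → ℝ} (hg : StrictMono g) {z : ℝ} (h1 : ∃ i, g i ≤ z) (h2 : ∃ i, z < g i) :
    ∃ s, plf g s = z := by
  obtain ⟨i, hi, hi'⟩ := int_bracket hg.monotone h1 h2
  have hd : 0 < g (i + 1) - g i := by linarith
  have hf : ⌊(i : ℝ) + (z - g i) / (g (i + 1) - g i)⌋ = i := by
    rw [Int.floor_eq_iff]
    constructor
    · have : 0 ≤ (z - g i) / (g (i + 1) - g i) := div_nonneg (by linarith) hd.le
      linarith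
    · have : (z - g i) / (g (i + 1) - g i) < 1 := by rw [div_lt_one hd]; linarith
      linarith
  refine ⟨i + (z - g i) / (g (i + 1) - g i), ?_⟩
  unfold plf Int.fract
  rw [hf]
  field_simp
  ring

theorem pl_homeo {a b : ℝ} (hab : a < b) {g t : ℤ → ℝ} (hg : StrictMono g) (ht : StrictMono t)
    (hgI : ∀ n, g n ∈ Ioo a b) (htI : ∀ n, t n ∈ Ioo a b)
    (hg1 : ∀ z, a < z → ∃ i, g i < z) (hg2 : ∀ z, z < b → ∃ i, z < g i)
    (ht1 : ∀ z, a < z → ∃ i, t i < z) (ht2 : ∀ z, z < b → ∃ i, z < t i) :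
    ∃ h : ℝ → ℝ, StrictMonoOn h (Icc a b) ∧ BijOn h (Icc a b) (Icc a b) ∧ ∀ n, h (g n) = t n := by
  classical
  have hin : ∀ {q : ℤ → ℝ}, StrictMono q → (∀ n, q n ∈ Ioo a b) → ∀ s, plf q s ∈ Ioo a b :=
    fun hq hI s => ⟨(hI _).1.trans_le (plf_bd hq s).1, (plf_bd hq s).2.trans (hI _).2⟩
  have hs : ∀ z, ∃ s, z ∈ Ioo a b → plf g s = z := by
    intro z
    by_cases hz : z ∈ Ioo a b
    · obtain ⟨s, hs⟩ := plf_surj hg ((hg1 z hz.1).imp fun _ h => h.le) (hg2 z hz.2)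
      exact ⟨s, fun _ => hs⟩
    · exact ⟨0, fun h => absurd h hz⟩
  choose iv hiv using hs
  let h : ℝ → ℝ := fun z => if z ∈ Ioo a b then plf t (iv z) else z
  have h1 : ∀ z ∈ Ioo a b, h z = plf t (iv z) := fun z hz => if_pos hz
  have h2 : ∀ s, h (plf g s) = plf t s := by
    intro s
    rw [h1 _ (hin hg hgI s)]
    congr 1
    exact (plf_strictMono hg).injective (hiv _ (hin hg hgI s))
  have ha : h a = a := if_neg (by simp)
  have hb : h b = b := if_neg (by simp)
  have hI : ∀ z ∈ Ioo a b, h z ∈ Ioo a b := fun z hz => by rw [h1 z hz]; exact hin ht htI _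
  have hcase : ∀ z ∈ Icc a b, z = a ∨ z = b ∨ z ∈ Ioo a b := by
    rintro z ⟨h3, h4⟩
    rcases h3.eq_or_lt with h | h
    · left; exact h.symm
    rcases h4.eq_or_lt with h' | h'
    · right; left; exact h'
    · right; right; exact ⟨h, h'⟩
  have hmono : StrictMonoOn h (Icc a b) := by
    intro x hx y hy hxy
    rcases hcase x hx with rfl | rfl | hx'
    · rcases hcase y hy with rfl | rfl | hy'
      · exact absurd hxy (lt_irrefl _)
      · rw [ha, hb]; exact hab
      · rw [ha]; exact (hI y hy').1
    · exact absurd hy.2 (not_le.2 hxy)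
    · rcases hcase y hy with rfl | rfl | hy'
      · exact absurd hx.1 (not_le.2 hxy)
      · rw [hb]; exact (hI x hx').2
      · rw [h1 x hx', h1 y hy']
        apply plf_strictMono ht
        rw [← (plf_strictMono hg).lt_iff_lt, hiv x hx', hiv y hy']
        exact hxy
  refine ⟨h, hmono, ⟨?_, hmono.injOn, ?_⟩, ?_⟩
  · intro z hz
    rcases hcase z hz with rfl | rfl | hz'
    · rw [ha]; exact hz
    · rw [hb]; exact hz
    · exact Ioo_subset_Icc_self (hI z hz')
  · intro w hw
    rcases hcase w hw with rfl | rfl | hw'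
    · exact ⟨_, hw, ha⟩
    · exact ⟨_, hw, hb⟩
    · obtain ⟨s, hs⟩ := plf_surj ht ((ht1 w hw'.1).imp fun _ h => h.le) (ht2 w hw'.2)
      exact ⟨plf g s, Ioo_subset_Icc_self (hin hg hgI s), by rw [h2, hs]⟩
  · intro n
    rw [← plf_int g n, h2, plf_int]

theorem beta_lemma {a b : ℝ} {e' : ℤ → ℝ} (hm : Monotone e')
    (h1 : ∀ z, a < z → ∃ i, e' i < z) (h2 : ∀ z, z < b → ∃ i, z < e' i)
    {x y : ℝ} (hax : a ≤ x) (hxy : x < y) (hyb : y ≤ b)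
    (hbad : ∀ i, a < e' i → e' i < b → e' (i + 1) = b ∨ ¬ (x ≤ e' i ∧ e' (i + 1) ≤ y)) :
    ∃ j, e' j ≤ x ∧ y ≤ e' (j + 2) := by
  by_cases h : ∃ i, e' i ≤ x
  · obtain ⟨i, hi, hi'⟩ := int_bracket hm h (h2 x (hxy.trans_le hyb))
    refine ⟨i, hi, ?_⟩
    have h3 : e' (i + 1) ≤ e' (i + 2) := hm (by omega)
    by_cases hb : b ≤ e' (i + 1)
    · linarith
    push Not at hb
    rcases hbad (i + 1) (by linarith) hb with h4 | h4
    · rw [show i + 1 + 1 = i + 2 by ring] at h4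
      linarith
    · rw [show i + 1 + 1 = i + 2 by ring] at h4
      by_contra hc
      push Not at hc
      exact h4 ⟨hi'.le, hc.le⟩
  · push Not at h
    obtain ⟨i, hi⟩ := h1 y (hax.trans_lt hxy)
    have h3 : e' (i - 1) ≤ e' i := hm (by omega)
    have h4 := h (i - 1)
    rcases hbad (i - 1) (by linarith) (by linarith) with h5 | h5
    · rw [show i - 1 + 1 = i by ring] at h5
      linarith
    · rw [show i - 1 + 1 = i by ring] at h5
      exact absurd ⟨h4.le, hi.le⟩ h5

end comb

open Set Filter Topology
set_option linter.unusedSectionVars false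

section comb

/-- glue two one-sided sequences -/
def glue (r l : ℕ → ℝ) : ℤ → ℝ
  | Int.ofNat n => r n
  | Int.negSucc n => - l (n + 1)

theorem glue_nat (r l : ℕ → ℝ) (n : ℕ) : glue r l (n : ℤ) = r n := rfl

theorem glue_neg {r l : ℕ → ℝ} (h : r 0 = - l 0) (n : ℕ) : glue r l (-(n : ℤ)) = - l n := by
  cases n with
  | zero => simpa [glue] using h
  | succ n => rfl

theorem int_cases (i : ℤ) : (∃ n : ℕ, i = n) ∨ ∃ n : ℕ, i = -((n + 1 : ℕ) : ℤ) := by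
  rcases lt_or_ge i 0 with h | h
  · right; exact ⟨(-i - 1).toNat, by omega⟩
  · left; exact ⟨i.toNat, by omega⟩

theorem glue_mono {r l : ℕ → ℝ} (h : r 0 = - l 0) (hr : Monotone r) (hl : Monotone l) :
    Monotone (glue r l) := by
  refine monotone_int_of_le_succ fun i => ?_
  rcases int_cases i with ⟨n, rfl⟩ | ⟨n, rfl⟩
  · rw [show (n : ℤ) + 1 = ((n + 1 : ℕ) : ℤ) by push_cast; ring, glue_nat, glue_nat]
    exact hr (by omega)
  · rw [show -((n + 1 : ℕ) : ℤ) + 1 = -(n : ℤ) by push_cast; ring, glue_neg h, glue_neg h]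
    exact neg_le_neg (hl (by omega))

theorem glue_strictMono {r l : ℕ → ℝ} (h : r 0 = - l 0) (hr : StrictMono r) (hl : StrictMono l) :
    StrictMono (glue r l) := by
  refine strictMono_int_of_lt_succ fun i => ?_
  rcases int_cases i with ⟨n, rfl⟩ | ⟨n, rfl⟩
  · rw [show (n : ℤ) + 1 = ((n + 1 : ℕ) : ℤ) by push_cast; ring, glue_nat, glue_nat]
    exact hr (by omega)
  · rw [show -((n + 1 : ℕ) : ℤ) + 1 = -(n : ℤ) by push_cast; ring, glue_neg h, glue_neg h]
    exact neg_lt_neg (hl (by omega))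

theorem comp_thm (D : ℝ → ℝ → Prop) (hD : ∀ x y x' y', D x y → x ≤ x' → y' ≤ y → D x' y')
    (a b : ℝ) (hab : a < b) (hloc : ∀ z, a < z → z < b → ∃ u v, u < z ∧ z < v ∧ D u v) :
    ∃ (e : ℤ → ℝ) (h : Fin 14 → ℝ → ℝ), Monotone e ∧ (∀ i, e i ∈ Icc a b) ∧
      (∀ j x y, e j < x → x ≤ y → y < e (j + 2) → D x y) ∧
      (∀ k, StrictMonoOn (h k) (Icc a b) ∧ BijOn (h k) (Icc a b) (Icc a b)) ∧
      ∀ x y, a ≤ x → x < y → y ≤ b →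
        (∀ k, ∃ x' ∈ Icc a b, ∃ y' ∈ Icc a b, D x' y' ∧ h k x' ≤ x ∧ y ≤ h k y') →
        ∃ j, e j ≤ x ∧ y ≤ e (j + 2) := by
  classical
  by_cases hC : ∀ x y, a < x → x ≤ y → y < b → D x y
  · refine ⟨fun i => if i ≤ 0 then a else b, fun _ => id, ?_, ?_, ?_, ?_, ?_⟩
    · intro i j hij
      simp only
      split_ifs with h1 h2
      · exact le_rfl
      · exact hab.le
      · omega
      · exact le_rfl
    · intro i
      simp only
      split_ifs
      · exact ⟨le_rfl, hab.le⟩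
      · exact ⟨hab.le, le_rfl⟩
    · intro j x y h1 h2 h3
      refine hC x y (lt_of_le_of_lt ?_ h1) h2 (lt_of_lt_of_le h3 ?_)
      · beta_reduce; split_ifs <;> linarith
      · beta_reduce; split_ifs <;> linarith
    · exact fun k => ⟨strictMonoOn_id, bijOn_id _⟩
    · intro x y h1 h2 h3 _
      exact ⟨0, by simpa using h1, by simpa using h3⟩
  push Not at hC
  obtain ⟨c, y1, hac, hcy, hyb, hnD⟩ := hC
  have hcb : c < b := hcy.trans_lt hyb
  obtain ⟨U, W, hU, hW, hUW⟩ := hloc c hac hcb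
  obtain ⟨r, r', v, r1, r2, r3, r4, r5, r6, r7, r8, r9, r10, r11, r12, r13, r14, r15⟩ :=
    right_clip D hD c b hcb (fun z h1 h2 => hloc z (hac.trans_le h1) h2) W hW
      (hD _ _ _ _ hUW hU.le le_rfl)
  obtain ⟨l, l', w, l1, l2, l3, l4, l5, l6, l7, -, l9, l10, l11, l12, l13, l14, l15⟩ :=
    right_clip (fun x y => D (-y) (-x))
      (fun x y x' y' h h1 h2 => hD _ _ _ _ h (by linarith) (by linarith)) (-c) (-a) (by linarith)
      (fun z h1 h2 => by
        obtain ⟨u, v, h3, h4, h5⟩ := hloc (-z) (by linarith) (by linarith)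
        exact ⟨-v, -u, by linarith, by linarith, by simpa using h5⟩) (-U) (by linarith)
      (hD _ _ _ _ hUW (by simp) (by simpa using hW.le))
  have v0 : v 0 := r8 ⟨y1, hyb, hnD⟩
  have g0 : r 0 = - l 0 := by rw [r2, l2, neg_neg]
  have g0' : r' 0 = - l' 0 := by rw [r12, l12, g0]
  set e := glue r l with he
  set e' := glue r' l' with he'
  have hes : StrictMono e := glue_strictMono g0 r1 l1
  have hem : Monotone e' := glue_mono g0' r9 l9
  have heI : ∀ n, e n ∈ Ioo a b := by
    intro i
    rcases int_cases i with ⟨n, rfl⟩ | ⟨n, rfl⟩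
    · rw [he, glue_nat]
      refine ⟨lt_of_lt_of_le ?_ (r1.monotone (Nat.zero_le n)), r3 n⟩
      rw [r2]; exact hac
    · rw [he, glue_neg g0]
      have := l3 (n + 1)
      have h2 := l1.monotone (Nat.zero_le (n + 1))
      rw [l2] at h2
      exact ⟨by linarith, by linarith⟩
  have he1 : ∀ z, a < z → ∃ i, e i < z := by
    intro z hz
    obtain ⟨n, hn⟩ := l4 (-z) (by linarith)
    exact ⟨-(n : ℤ), by rw [he, glue_neg g0]; linarith⟩
  have he2 : ∀ z, z < b → ∃ i, z < e i := by
    intro z hz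
    obtain ⟨n, hn⟩ := r4 z hz
    exact ⟨(n : ℤ), by rw [he, glue_nat]; exact hn⟩
  have he1' : ∀ z, a < z → ∃ i, e' i < z := by
    intro z hz
    obtain ⟨n, hn⟩ := l4 (-z) (by linarith)
    exact ⟨-(n : ℤ), by rw [he', glue_neg g0']; linarith [l10 n]⟩
  have he2' : ∀ z, z < b → ∃ i, z < e' i := by
    intro z hz
    obtain ⟨n, hn⟩ := r4 z hz
    exact ⟨(n : ℤ), by rw [he', glue_nat]; linarith [r10 n]⟩
  -- non-D intervals
  have hN : ∀ j : ℤ, (∀ n : ℕ, j = n → v n) → (∀ n : ℕ, j = -((n + 1 : ℕ) : ℤ) → w n) →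
      ¬ D (e (4 * j)) (e (4 * (j + 1))) := by
    intro j h1 h2
    rcases int_cases j with ⟨n, rfl⟩ | ⟨n, rfl⟩
    · rw [he, show 4 * (n : ℤ) = ((4 * n : ℕ) : ℤ) by push_cast; ring,
        show 4 * ((n : ℤ) + 1) = ((4 * n + 4 : ℕ) : ℤ) by push_cast; ring, glue_nat, glue_nat]
      exact r7 n (h1 n rfl)
    · rw [he, show 4 * (-((n + 1 : ℕ) : ℤ)) = -((4 * n + 4 : ℕ) : ℤ) by push_cast; ring,
        show 4 * ((-((n + 1 : ℕ) : ℤ)) + 1) = -((4 * n : ℕ) : ℤ) by push_cast; ring,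
        glue_neg g0, glue_neg g0]
      exact l7 n (h2 n rfl)
  -- homeomorphisms
  have hT : ∀ k : Fin 14, ∃ h : ℝ → ℝ, StrictMonoOn h (Icc a b) ∧ BijOn h (Icc a b) (Icc a b) ∧
      ∀ n : ℤ, h (e (4 * n)) = e (8 * (n / 2) + ((k : ℕ) : ℤ) - 5 + n % 2) := by
    intro k
    have cof1 : ∀ i : ℤ, ∃ n : ℤ, 4 * n ≤ i := fun i => ⟨i / 4, by omega⟩
    refine pl_homeo hab (g := fun n => e (4 * n))
      (t := fun n => e (8 * (n / 2) + ((k : ℕ) : ℤ) - 5 + n % 2))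
      (fun i j hij => hes (by omega)) (fun i j hij => hes (by omega)) (fun n => heI _)
      (fun n => heI _) ?_ ?_ ?_ ?_
    · intro z hz
      obtain ⟨i, hi⟩ := he1 z hz
      exact ⟨i / 4, (hes.monotone (by omega)).trans_lt hi⟩
    · intro z hz
      obtain ⟨i, hi⟩ := he2 z hz
      exact ⟨i / 4 + 1, hi.trans_le (hes.monotone (by omega))⟩
    · intro z hz
      obtain ⟨i, hi⟩ := he1 z hz
      exact ⟨2 * ((i - 20) / 8), (hes.monotone (by omega)).trans_lt hi⟩
    · intro z hz
      obtain ⟨i, hi⟩ := he2 z hz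
      exact ⟨2 * ((i + 20) / 8), hi.trans_le (hes.monotone (by omega))⟩
  choose h hh1 hh2 hh3 using hT
  refine ⟨e', h, hem, ?_, ?_, fun k => ⟨hh1 k, hh2 k⟩, ?_⟩
  · intro i
    rcases int_cases i with ⟨n, rfl⟩ | ⟨n, rfl⟩
    · rw [he', glue_nat]
      have h3 := r9 (Nat.zero_le n)
      rw [r12, r2] at h3
      exact ⟨by linarith, r11 n⟩
    · rw [he', glue_neg g0']
      have h3 := l9 (Nat.zero_le (n + 1))
      rw [l12, l2] at h3
      have := l11 (n + 1)
      exact ⟨by linarith, by linarith⟩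
  · intro j x y h1 h2 h3
    rcases int_cases j with ⟨n, rfl⟩ | ⟨n, rfl⟩
    · rw [show (n : ℤ) + 2 = ((n + 2 : ℕ) : ℤ) by push_cast; ring] at h3
      exact r15 n x y h1 h2 h3
    · cases n with
      | zero =>
        rw [show -((0 + 1 : ℕ) : ℤ) + 2 = ((1 : ℕ) : ℤ) by norm_num, he', glue_nat, r13] at h3
        rw [he', glue_neg g0'] at h1
        simp only [zero_add] at h1
        rw [l13] at h1
        exact hD _ _ _ _ hUW (by linarith) (by linarith)
      | succ n =>
        rw [show -((n + 1 + 1 : ℕ) : ℤ) + 2 = -(n : ℤ) by push_cast; ring, he', glue_neg g0'] at h3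
        rw [he', glue_neg g0'] at h1
        have := l15 n (-y) (-x) (by linarith) (by linarith)
          (by rw [show n + 2 = n + 1 + 1 by ring]; linarith)
        simpa using this
  · intro x y hax hxy hyb hE
    refine beta_lemma hem he1' he2' hax hxy hyb ?_
    -- bad pairs
    have hbad : ∀ i j : ℤ, -5 ≤ i - 8 * j → i - 8 * j ≤ 8 → ¬ D (e (4 * (2 * j))) (e (4 * (2 * j + 1))) →
        ¬ (x ≤ e i ∧ e (i + 1) ≤ y) := by
      rintro i j h1 h2 h3 ⟨h4, h5⟩
      let k : Fin 14 := ⟨(i - 8 * j + 5).toNat, by omega⟩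
      have hk : ((k : ℕ) : ℤ) = i - 8 * j + 5 := by simp only [k]; omega
      obtain ⟨x', hx', y', hy', hD', h6, h7⟩ := hE k
      have q1 := hh3 k (2 * j)
      have q2 := hh3 k (2 * j + 1)
      rw [hk, show 8 * (2 * j / 2) + (i - 8 * j + 5) - 5 + 2 * j % 2 = i by omega] at q1
      rw [hk, show 8 * ((2 * j + 1) / 2) + (i - 8 * j + 5) - 5 + (2 * j + 1) % 2 = i + 1 by omega] at q2
      rw [← q1] at h4
      rw [← q2] at h5
      have m1 : x' ≤ e (4 * (2 * j)) :=
        ((hh1 k).le_iff_le hx' (Ioo_subset_Icc_self (heI _))).1 (h6.trans h4)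
      have m2 : e (4 * (2 * j + 1)) ≤ y' :=
        ((hh1 k).le_iff_le (Ioo_subset_Icc_self (heI _)) hy').1 (h5.trans h7)
      exact h3 (hD _ _ _ _ hD' m1 m2)
    intro i h1 h2
    rcases int_cases i with ⟨n, rfl⟩ | ⟨n, rfl⟩
    · rcases r14 n with h3 | ⟨h3, h4, h5⟩
      · left
        rw [show (n : ℤ) + 1 = ((n + 1 : ℕ) : ℤ) by push_cast; ring]
        exact h3
      · right
        have E1 : e' (n : ℤ) = e (n : ℤ) := h3
        have E2 : e' ((n : ℤ) + 1) = e ((n : ℤ) + 1) := by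
          rw [show (n : ℤ) + 1 = ((n + 1 : ℕ) : ℤ) by push_cast; ring]; exact h4
        rw [E1, E2]
        refine hbad n (((n - 1) / 8 : ℕ) : ℤ) (by omega) (by omega) (hN _ ?_ ?_)
        · intro m hm
          rcases h5 with h5 | h5
          · rw [show m = 0 by omega]; exact v0
          · exact r6 _ _ (by omega) h5
        · intro m hm
          omega
    · right
      rcases l14 n with h3 | ⟨h3, h4, h5⟩
      · exfalso
        rw [he', glue_neg g0', h3] at h1
        linarith
      · have E1 : e' (-((n + 1 : ℕ) : ℤ)) = e (-((n + 1 : ℕ) : ℤ)) := by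
          rw [he', he, glue_neg g0', glue_neg g0, h4]
        have E2 : e' (-((n + 1 : ℕ) : ℤ) + 1) = e (-((n + 1 : ℕ) : ℤ) + 1) := by
          rw [show -((n + 1 : ℕ) : ℤ) + 1 = -(n : ℤ) by push_cast; ring,
            he', he, glue_neg g0', glue_neg g0, h3]
        rw [E1, E2]
        refine hbad _ (-(((n + 3) / 8 : ℕ) : ℤ)) (by omega) (by omega) (hN _ ?_ ?_)
        · intro m hm
          rw [show m = 0 by omega]; exact v0
        · intro m hm
          rcases h5 with h5 | h5
          · omega
          · exact l6 _ _ (by omega) h5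

end comb

open Set Filter Topology
set_option linter.unusedSectionVars false

section comb

theorem fix_ends {a b : ℝ} (hab : a ≤ b) {h : ℝ → ℝ} (hm : StrictMonoOn h (Icc a b))
    (hb : BijOn h (Icc a b) (Icc a b)) : h a = a ∧ h b = b := by
  have ha : a ∈ Icc a b := ⟨le_rfl, hab⟩
  have hb' : b ∈ Icc a b := ⟨hab, le_rfl⟩
  constructor
  · obtain ⟨z, hz, h1⟩ := hb.surjOn ha
    have h2 : h a ≤ h z := (hm.le_iff_le ha hz).2 hz.1
    exact le_antisymm (h2.trans h1.le) (hb.mapsTo ha).1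
  · obtain ⟨z, hz, h1⟩ := hb.surjOn hb'
    have h2 : h z ≤ h b := (hm.le_iff_le hz hb').2 hz.2
    exact le_antisymm (hb.mapsTo hb').2 (h1.ge.trans h2)

theorem ct (S : Set (ℝ × ℝ)) (hS : ∀ p ∈ S, 0 ≤ p.1 ∧ p.1 < p.2 ∧ p.2 ≤ 1) :
    ∃ (ι : Type) (_ : Countable ι) (e : ι → ℤ → ℝ) (θ : Fin 14 → ℝ → ℝ),
      (∀ c, Monotone (e c)) ∧
      (∀ c c', c ≠ c' → (∀ i k, e c i ≤ e c' k) ∨ (∀ i k, e c' k ≤ e c i)) ∧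
      (∀ c j x y, e c j < x → x ≤ y → y < e c (j + 2) → ∃ p ∈ S, p.1 ≤ x ∧ y ≤ p.2) ∧
      (∀ k, StrictMonoOn (θ k) (Icc 0 1) ∧ BijOn (θ k) (Icc 0 1) (Icc 0 1)) ∧
      ∀ x y, x < y → (∀ k, ∃ p ∈ S, θ k p.1 ≤ x ∧ y ≤ θ k p.2) →
        ∃ c j, e c j ≤ x ∧ y ≤ e c (j + 2) := by
  classical
  let U : Set ℝ := ⋃ p ∈ S, Ioo p.1 p.2
  have hUo : IsOpen U := isOpen_biUnion fun p _ => isOpen_Ioo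
  have hmemU : ∀ z, z ∈ U ↔ ∃ p ∈ S, p.1 < z ∧ z < p.2 := by
    intro z
    simp only [U, mem_iUnion, exists_prop, mem_Ioo]
  have hU01 : ∀ z ∈ U, 0 < z ∧ z < 1 := by
    intro z hz
    obtain ⟨p, hp, h1, h2⟩ := (hmemU z).1 hz
    have := hS p hp
    exact ⟨by linarith, by linarith⟩
  let ι := {c : ℝ × ℝ // c.1 < c.2 ∧ c.1 ∉ U ∧ c.2 ∉ U ∧ Ioo c.1 c.2 ⊆ U}
  have hsep : ∀ c c' : ι, c ≠ c' → c.1.2 ≤ c'.1.1 ∨ c'.1.2 ≤ c.1.1 := by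
    rintro ⟨⟨a, b⟩, h1, h2, h3, h4⟩ ⟨⟨a', b'⟩, h1', h2', h3', h4'⟩ hne
    by_contra hcon
    push Not at hcon
    simp only at *
    obtain ⟨q1, q2⟩ := hcon
    have e1 : a' ≤ a := by
      by_contra h; push Not at h
      exact h2' (h4 ⟨h, q1⟩)
    have e2 : a ≤ a' := by
      by_contra h; push Not at h
      exact h2 (h4' ⟨h, q2⟩)
    have e3 : b ≤ b' := by
      by_contra h; push Not at h
      exact h3' (h4 ⟨q2, h⟩)
    have e4 : b' ≤ b := by
      by_contra h; push Not at h
      exact h3 (h4' ⟨q1, h⟩)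
    apply hne
    have : a = a' := le_antisymm e2 e1
    have : b = b' := le_antisymm e3 e4
    subst_vars
    rfl
  have hcnt : Countable ι := by
    have : (univ : Set ι).Countable := by
      refine Set.PairwiseDisjoint.countable_of_isOpen (s := fun c : ι => Ioo c.1.1 c.1.2) ?_
        (fun c _ => isOpen_Ioo) (fun c _ => nonempty_Ioo.2 c.2.1)
      intro c _ c' _ hne
      rw [Function.onFun, Set.disjoint_left]
      intro z h1 h2
      rcases hsep c c' hne with h | h
      · linarith [h1.2, h2.1]
      · linarith [h1.1, h2.2]
    exact countable_univ_iff.1 this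
  have h01 : ∀ c : ι, 0 ≤ c.1.1 ∧ c.1.2 ≤ 1 := by
    intro c
    constructor
    · by_contra h; push Not at h
      obtain ⟨z, h1, h2⟩ := exists_between (lt_min h c.2.1)
      obtain ⟨h2, h3⟩ := lt_min_iff.1 h2
      linarith [(hU01 z (c.2.2.2.2 ⟨h1, h3⟩)).1]
    · by_contra h; push Not at h
      obtain ⟨z, h1, h2⟩ := exists_between (max_lt h c.2.1)
      obtain ⟨h1, h3⟩ := max_lt_iff.1 h1
      linarith [(hU01 z (c.2.2.2.2 ⟨h3, h2⟩)).2]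
  have hcomp : ∀ z ∈ U, ∃ c : ι, z ∈ Ioo c.1.1 c.1.2 := by
    intro z hz
    have hz01 := hU01 z hz
    have hcl : IsClosed Uᶜ := hUo.isClosed_compl
    have z0 : (0 : ℝ) ∉ U := fun h => lt_irrefl _ (hU01 0 h).1
    have z1 : (1 : ℝ) ∉ U := fun h => lt_irrefl _ (hU01 1 h).2
    have hA1 : (Uᶜ ∩ Iic z).Nonempty := ⟨0, z0, hz01.1.le⟩
    have hA2 : BddAbove (Uᶜ ∩ Iic z) := ⟨z, fun w hw => hw.2⟩
    have hB1 : (Uᶜ ∩ Ici z).Nonempty := ⟨1, z1, hz01.2.le⟩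
    have hB2 : BddBelow (Uᶜ ∩ Ici z) := ⟨z, fun w hw => hw.2⟩
    have hA := (hcl.inter isClosed_Iic).csSup_mem hA1 hA2
    have hB := (hcl.inter isClosed_Ici).csInf_mem hB1 hB2
    have q1 : sSup (Uᶜ ∩ Iic z) < z := lt_of_le_of_ne hA.2 fun h => hA.1 (by rw [h]; exact hz)
    have q2 : z < sInf (Uᶜ ∩ Ici z) := lt_of_le_of_ne hB.2 fun h => hB.1 (by rw [← h]; exact hz)
    refine ⟨⟨(sSup (Uᶜ ∩ Iic z), sInf (Uᶜ ∩ Ici z)), q1.trans q2, hA.1, hB.1, ?_⟩, q1, q2⟩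
    rintro w ⟨w1, w2⟩
    by_contra hw
    rcases le_total w z with h | h
    · exact absurd (le_csSup hA2 ⟨hw, h⟩) (not_le.2 w1)
    · exact absurd (csInf_le hB2 ⟨hw, h⟩) (not_le.2 w2)
  have huniq : ∀ (c c' : ι) z w, c.1.1 ≤ z → z < w → w ≤ c.1.2 → c'.1.1 ≤ z → w ≤ c'.1.2 →
      c = c' := by
    intro c c' z w h1 h2 h3 h4 h5
    by_contra hne
    rcases hsep c c' hne with h | h <;> linarith
  have huniq' : ∀ (c c' : ι) z, z ∈ Ioo c.1.1 c.1.2 → z ∈ Ioo c'.1.1 c'.1.2 → c = c' := by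
    intro c c' z h1 h2
    by_contra hne
    rcases hsep c c' hne with h | h
    · linarith [h1.2, h2.1]
    · linarith [h1.1, h2.2]
  let D : ℝ → ℝ → Prop := fun x y => ∃ p ∈ S, p.1 ≤ x ∧ y ≤ p.2
  have hD : ∀ x y x' y', D x y → x ≤ x' → y' ≤ y → D x' y' := by
    rintro x y x' y' ⟨p, hp, h1, h2⟩ h3 h4
    exact ⟨p, hp, h1.trans h3, h4.trans h2⟩
  have hct := fun c : ι => comp_thm D hD c.1.1 c.1.2 c.2.1 (fun z h1 h2 => by
    obtain ⟨p, hp, h3, h4⟩ := (hmemU z).1 (c.2.2.2.2 ⟨h1, h2⟩)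
    exact ⟨p.1, p.2, h3, h4, p, hp, le_rfl, le_rfl⟩)
  choose e h c1 c2 c3 c4 c5 using hct
  choose cp hcp using hcomp
  let θ : Fin 14 → ℝ → ℝ := fun k z => if hz : z ∈ U then h (cp z hz) k z else z
  have hθn : ∀ k z, z ∉ U → θ k z = z := fun k z hz => dif_neg hz
  have hends : ∀ c k, h c k c.1.1 = c.1.1 ∧ h c k c.1.2 = c.1.2 := fun c k =>
    fix_ends c.2.1.le (c4 c k).1 (c4 c k).2
  have hθI : ∀ k (c : ι) z, z ∈ Icc c.1.1 c.1.2 → θ k z = h c k z := by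
    intro k c z hz
    rcases hz.1.eq_or_lt with h1 | h1
    · rw [← h1, hθn _ _ c.2.2.1, (hends c k).1]
    rcases hz.2.eq_or_lt with h2 | h2
    · rw [h2, hθn _ _ c.2.2.2.1, (hends c k).2]
    have hzU : z ∈ U := c.2.2.2.2 ⟨h1, h2⟩
    have : cp z hzU = c := huniq' _ _ z (hcp z hzU) ⟨h1, h2⟩
    simp only [θ]
    rw [dif_pos hzU, this]
  have hθin : ∀ k (c : ι) z, z ∈ Icc c.1.1 c.1.2 → θ k z ∈ Icc c.1.1 c.1.2 := by
    intro k c z hz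
    rw [hθI k c z hz]
    exact (c4 c k).2.mapsTo hz
  have hθoo : ∀ k (c : ι) z, z ∈ Ioo c.1.1 c.1.2 → θ k z ∈ Ioo c.1.1 c.1.2 := by
    intro k c z hz
    have hz' := Ioo_subset_Icc_self hz
    rw [hθI k c z hz']
    have m1 := (c4 c k).1 ⟨le_rfl, c.2.1.le⟩ hz' hz.1
    have m2 := (c4 c k).1 hz' ⟨c.2.1.le, le_rfl⟩ hz.2
    rw [(hends c k).1] at m1
    rw [(hends c k).2] at m2
    exact ⟨m1, m2⟩
  have hmono : ∀ k, StrictMono (θ k) := by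
    intro k x y hxy
    by_cases hx : x ∈ U
    · have hxc := hcp x hx
      set c := cp x hx
      by_cases hy : y ≤ c.1.2
      · rw [hθI k c x (Ioo_subset_Icc_self hxc), hθI k c y ⟨by linarith [hxc.1], hy⟩]
        exact (c4 c k).1 (Ioo_subset_Icc_self hxc) ⟨by linarith [hxc.1], hy⟩ hxy
      · push Not at hy
        have l1 := (hθoo k c x hxc).2
        by_cases hyU : y ∈ U
        · have hyc := hcp y hyU
          have l2 := (hθoo k _ y hyc).1
          have : c.1.2 ≤ (cp y hyU).1.1 := by
            by_contra hh; push Not at hh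
            exact c.2.2.2.1 ((cp y hyU).2.2.2.2 ⟨hh, hy.trans hyc.2⟩)
          linarith
        · rw [hθn k y hyU]; linarith
    · rw [hθn k x hx]
      by_cases hyU : y ∈ U
      · have hyc := hcp y hyU
        have l2 := (hθoo k _ y hyc).1
        have : x ≤ (cp y hyU).1.1 := by
          by_contra hh; push Not at hh
          exact hx ((cp y hyU).2.2.2.2 ⟨hh, hxy.trans hyc.2⟩)
        linarith
      · rw [hθn k y hyU]; exact hxy
  refine ⟨ι, hcnt, e, θ, c1, ?_, c3, ?_, ?_⟩
  · intro c c' hne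
    rcases hsep c c' hne with hh | hh
    · left; intro i k
      exact (c2 c i).2.trans (hh.trans (c2 c' k).1)
    · right; intro i k
      exact (c2 c' k).2.trans (hh.trans (c2 c i).1)
  · intro k
    refine ⟨(hmono k).strictMonoOn _, ?_, (hmono k).injective.injOn, ?_⟩
    · intro z hz
      by_cases hzU : z ∈ U
      · have := hθoo k _ z (hcp z hzU)
        have h3 := h01 (cp z hzU)
        exact ⟨by linarith [this.1], by linarith [this.2]⟩
      · rw [hθn k z hzU]; exact hz
    · intro w hw
      by_cases hwU : w ∈ U
      · obtain ⟨z, hz, hzw⟩ := (c4 (cp w hwU) k).2.surjOn (Ioo_subset_Icc_self (hcp w hwU))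
        have h3 := h01 (cp w hwU)
        refine ⟨z, ⟨by linarith [hz.1], by linarith [hz.2]⟩, ?_⟩
        rw [hθI k _ z hz, hzw]
      · exact ⟨w, hw, hθn k w hwU⟩
  · intro x y hxy hk
    have key : ∀ k, ∃ c : ι, c.1.1 ≤ x ∧ y ≤ c.1.2 ∧ ∃ x' ∈ Icc c.1.1 c.1.2,
        ∃ y' ∈ Icc c.1.1 c.1.2, D x' y' ∧ h c k x' ≤ x ∧ y ≤ h c k y' := by
      intro k
      obtain ⟨p, hp, h1, h2⟩ := hk k
      obtain ⟨m, hm1, hm2⟩ := exists_between (hS p hp).2.1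
      have hmU : m ∈ U := (hmemU m).2 ⟨p, hp, hm1, hm2⟩
      have hmc := hcp m hmU
      set c := cp m hmU
      have q1 : c.1.1 ≤ p.1 := by
        by_contra hh; push Not at hh
        exact c.2.2.1 ((hmemU _).2 ⟨p, hp, hh, hmc.1.trans hm2⟩)
      have q2 : p.2 ≤ c.1.2 := by
        by_contra hh; push Not at hh
        exact c.2.2.2.1 ((hmemU _).2 ⟨p, hp, hm1.trans hmc.2, hh⟩)
      have p1 : p.1 ∈ Icc c.1.1 c.1.2 := ⟨q1, by linarith⟩
      have p2 : p.2 ∈ Icc c.1.1 c.1.2 := ⟨by linarith, q2⟩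
      refine ⟨c, (hθin k c _ p1).1.trans h1, h2.trans (hθin k c _ p2).2, p.1, p1, p.2, p2,
        ⟨p, hp, le_rfl, le_rfl⟩, ?_, ?_⟩
      · rw [← hθI k c _ p1]; exact h1
      · rw [← hθI k c _ p2]; exact h2
    obtain ⟨c, hc1, hc2, -⟩ := key 0
    obtain ⟨j, hj⟩ := c5 c x y hc1 hxy hc2 (fun k => by
      obtain ⟨c', hc1', hc2', hh⟩ := key k
      have : c = c' := huniq c c' x y hc1 hxy hc2 hc1' hc2'
      rw [this]; exact hh)
    exact ⟨c, j, hj⟩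

end comb

open Set Filter Topology
set_option linter.unusedSectionVars false

namespace ContinuousNest
variable {H : Type*} [NormedAddCommGroup H] [InnerProductSpace ℂ H] [CompleteSpace H]
variable {𝒩 : ContinuousNest H}

theorem refines_trans {P Q R : Set (H →L[ℂ] H)} (h : OpRefines P Q) (h' : OpRefines Q R) :
    OpRefines P R := by
  intro E hE
  obtain ⟨F, hF, h1⟩ := h E hE
  obtain ⟨G, hG, h2⟩ := h' F hF
  refine ⟨G, hG, ?_⟩
  have := h2.add h1
  rwa [sub_add_sub_cancel] at this

theorem net_finite {O : Set (Set (H →L[ℂ] H))} (hO : 𝒩.IsNet O) {P : Set (H →L[ℂ] H)} (hP : P ∈ O)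
    (n : ℕ) (f : Fin n → Set (H →L[ℂ] H)) (hf : ∀ k, f k ∈ O) :
    ∃ R ∈ O, OpRefines R P ∧ ∀ k, OpRefines R (f k) := by
  induction n with
  | zero =>
    obtain ⟨R, hR, h1, h2⟩ := hO.2 P hP P hP
    exact ⟨R, hR, h1, fun k => k.elim0⟩
  | succ n ih =>
    obtain ⟨R, hR, h1, h2⟩ := ih (fun k => f k.succ) (fun k => hf _)
    obtain ⟨R', hR', h3, h4⟩ := hO.2 R hR (f 0) (hf 0)
    refine ⟨R', hR', refines_trans h3 h1, fun k => ?_⟩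
    refine Fin.cases ?_ (fun k => ?_) k
    · exact h4
    · exact refines_trans h3 (h2 k)

/-- pairs of endpoints of the nonzero intervals of a family -/
def ends (𝒩 : ContinuousNest H) (P : Set (H →L[ℂ] H)) : Set (ℝ × ℝ) :=
  {p | (0 ≤ p.1 ∧ p.1 < p.2 ∧ p.2 ≤ 1) ∧ 𝒩.iv p.1 p.2 ∈ P}

theorem prep {O : Set (Set (H →L[ℂ] H))} (hO : 𝒩.IsStableNet O) {P : Set (H →L[ℂ] H)} (hP : P ∈ O) :
    ∃ Q ∈ O, ∃ (B : Type) (R S : B → ℝ × ℝ) (L : B → List (ℕ → ℝ × ℝ)),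
      BlkSys 𝒩 (fun a => ∃ p ∈ 𝒩.ends P, p.1 ≤ a.1 ∧ a.2 ≤ p.2) (𝒩.ends Q) B R S L := by
  obtain ⟨ι, hι, e, θ, hm, hno, hα, hθ, hβ⟩ := ct (𝒩.ends P) (fun p hp => hp.1)
  choose Θ hΘ hΘe using fun k => exists_auto (𝒩 := 𝒩) (hθ k).2 (hθ k).1
  obtain ⟨Q, hQ, hQP, hQk⟩ := net_finite hO.1 hP 14 (fun k => 𝒩.autoImage (Θ k) P)
    (fun k => hO.2 _ (hΘ k) P hP)
  refine ⟨Q, hQ, ?_⟩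
  refine blkSys_of_grid (fun a => ∃ p ∈ 𝒩.ends P, p.1 ≤ a.1 ∧ a.2 ≤ p.2) (𝒩.ends Q) ?_ e hm hno
    hα ?_
  · rintro x y x' y' ⟨p, hp, h1, h2⟩ h3 h4
    exact ⟨p, hp, h1.trans h3, h4.trans h2⟩
  · rintro ⟨x, y⟩ ⟨⟨h0, hxy, h1⟩, hE⟩
    simp only at h0 hxy h1 hE
    have hEn := iv_ne_zero (𝒩 := 𝒩) h0 hxy h1
    constructor
    · obtain ⟨F, hF, hle⟩ := hQP _ hE
      obtain ⟨s, t, s0, hst, t1, rfl⟩ := isInterval_iff.1 (hO.1.1 P hP F hF)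
      rw [proj_le_iff (iv_proj _ _ _) (iv_proj _ _ _)] at hle
      obtain ⟨q1, q2⟩ := iv_le_iv h0 hxy h1 hle
      exact ⟨(s, t), ⟨⟨s0, by simp only; linarith, t1⟩, hF⟩, q1, q2⟩
    · refine hβ x y hxy fun k => ?_
      obtain ⟨F, ⟨s, t, s0, hst, t1, hst', rfl⟩, hle⟩ := hQk k _ hE
      have hs : s ∈ Icc (0 : ℝ) 1 := ⟨s0, hst.trans t1⟩
      have ht : t ∈ Icc (0 : ℝ) 1 := ⟨s0.trans hst, t1⟩
      have hs' := (hθ k).2.mapsTo hs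
      have ht' := (hθ k).2.mapsTo ht
      rw [hΘe k t ht, hΘe k s hs, iv_eq_N hs'.1 ((hθ k).1.monotoneOn hs ht hst) ht'.2,
        proj_le_iff (iv_proj _ _ _) (iv_proj _ _ _)] at hle
      obtain ⟨q1, q2⟩ := iv_le_iv h0 hxy h1 hle
      have hlt : s < t := by
        refine lt_of_le_of_ne hst fun h => ?_
        subst h
        linarith
      rw [iv_eq_N s0 hst t1] at hst'
      exact ⟨(s, t), ⟨⟨s0, hlt, t1⟩, hst'⟩, q1, q2⟩

theorem mem_kernel_of_cpt {O : Set (Set (H →L[ℂ] H))} (hO : 𝒩.IsNet O) {Q : Set (H →L[ℂ] H)}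
    (hQ : Q ∈ O) {X : H →L[ℂ] H} (hX : X ∈ 𝒩.alg)
    (h : ∀ E ∈ 𝒩.ends Q, IsCompactOperator ⇑(𝒩.iv E.1 E.2 * X * 𝒩.iv E.1 E.2)) :
    X ∈ 𝒩.kernel O := by
  refine ⟨hX, fun ε hε => ⟨Q, hQ, fun E hE => essNorm_lt_of_cpt hε ?_⟩⟩
  obtain ⟨s, t, s0, hst, t1, rfl⟩ := isInterval_iff.1 (hO.1 Q hQ E hE)
  rcases hst.eq_or_lt with h' | h'
  · rw [iv_zero_of_le 𝒩 h'.ge]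
    simpa using cpt_zero
  · exact h (s, t) ⟨⟨s0, h', t1⟩, hE⟩

theorem decomp [TopologicalSpace.SeparableSpace H] {O₁ O₂ : Set (Set (H →L[ℂ] H))}
    (h₁ : 𝒩.IsStableNet O₁) (h₂ : 𝒩.IsStableNet O₂) : ∃ C : ℝ, 0 ≤ C ∧
    ∀ X ∈ 𝒩.kernel {P | ∃ P₁ ∈ O₁, ∃ P₂ ∈ O₂, P = prodFam P₁ P₂}, ∀ δ : ℝ, 0 < δ →
      ∃ X₁ ∈ 𝒩.kernel O₁, ∃ X₂ ∈ 𝒩.kernel O₂,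
        ∃ Z ∈ 𝒩.kernel {P | ∃ P₁ ∈ O₁, ∃ P₂ ∈ O₂, P = prodFam P₁ P₂}, X = X₁ + X₂ + Z ∧
        ‖X₁‖ ≤ C * (‖X‖ + δ) ∧ ‖X₂‖ ≤ C * (‖X‖ + δ) ∧ ‖Z‖ ≤ δ := by
  obtain ⟨C, hC, hass⟩ := assembly (𝒩 := 𝒩)
  refine ⟨C, hC, ?_⟩
  rintro X hXK δ hδ
  have hX := hXK.1
  set ε := δ / (C + 1) with hε
  have hC1 : 0 < C + 1 := by linarith
  have hε0 : 0 < ε := div_pos hδ hC1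
  have hεδ : ε ≤ δ := by rw [hε, div_le_iff₀ hC1]; nlinarith
  have hCε : C * ε ≤ δ := by
    have : (C + 1) * ε = δ := by rw [hε]; field_simp
    nlinarith
  obtain ⟨_, ⟨P₁, hP₁, P₂, hP₂, rfl⟩, hE⟩ := hXK.2 ε hε0
  obtain ⟨Q₁, hQ₁, B₁, R₁, S₁, L₁, hB₁⟩ := prep h₁ hP₁
  obtain ⟨Q₂, hQ₂, B₂, R₂, S₂, L₂, hB₂⟩ := prep h₂ hP₂
  obtain ⟨X₁, a1, X₂, a2, Z, a3, hsum, n1, n2, n3, k1, k2⟩ :=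
    hass X hX ε hε0 _ _ _ _ B₁ B₂ R₁ S₁ R₂ S₂ L₁ L₂ hB₁ hB₂ (by
      rintro a b ⟨p, hp, p1, p2⟩ ⟨q, hq, q1, q2⟩
      have h3 := hE _ ⟨_, hp.2, _, hq.2, rfl⟩
      rw [iv_mul, iv_compress hX] at h3
      have h4 : 𝒩.cor X (meet a b) = 𝒩.cor (𝒩.cor X (meet p q)) (meet a b) := by
        rw [cor_cor]
        congr 1
        unfold meet
        simp only
        rw [max_eq_right (max_le_max p1 q1), min_eq_right (min_le_min p2 q2)]
      rw [h4]
      exact essNorm_mul_lt (co_norm _ _) (pr_norm _ _) h3)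
  have m1 := mem_kernel_of_cpt h₁.1 hQ₁ a1 k1
  have m2 := mem_kernel_of_cpt h₂.1 hQ₂ a2 k2
  have hst := prod_stableNet h₁ h₂
  refine ⟨X₁, m1, X₂, m2, Z, ?_, hsum, ?_, ?_, n3.trans hCε⟩
  · have : Z = X + -(X₁ + X₂) := by rw [hsum]; abel
    rw [this]
    exact kernel_add hst.1 hXK (kernel_neg (kernel_add hst.1
      (kernel_prod_left h₁.1 h₂.1 ⟨_, hP₂⟩ m1) (kernel_prod_right h₁.1 h₂.1 ⟨_, hP₁⟩ m2)))
  · exact n1.trans (mul_le_mul_of_nonneg_left (by linarith) hC)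
  · exact n2.trans (mul_le_mul_of_nonneg_left (by linarith) hC)

theorem kernel_split [TopologicalSpace.SeparableSpace H] {O₁ O₂ : Set (Set (H →L[ℂ] H))}
    (h₁ : 𝒩.IsStableNet O₁) (h₂ : 𝒩.IsStableNet O₂)
    (c₁ : IsClosed (𝒩.kernel O₁)) (c₂ : IsClosed (𝒩.kernel O₂))
    (z₁ : (0 : H →L[ℂ] H) ∈ 𝒩.kernel O₁) (z₂ : (0 : H →L[ℂ] H) ∈ 𝒩.kernel O₂)
    {X : H →L[ℂ] H} (hX : X ∈ 𝒩.kernel {P | ∃ P₁ ∈ O₁, ∃ P₂ ∈ O₂, P = prodFam P₁ P₂}) :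
    ∃ X₁ ∈ 𝒩.kernel O₁, ∃ X₂ ∈ 𝒩.kernel O₂, X = X₁ + X₂ := by
  obtain ⟨C, hC, hdec⟩ := decomp h₁ h₂
  have hpos : ∀ n : ℕ, (0 : ℝ) < (1 / 2) ^ n := fun n => by positivity
  choose! Y₁ hY₁ Y₂ hY₂ Z hZ hs n1 n2 n3 using hdec
  let q : ℕ → H →L[ℂ] H := fun n => Nat.rec X (fun k x => Z x ((1 / 2) ^ k)) n
  have q0 : q 0 = X := rfl
  have qS : ∀ n, q (n + 1) = Z (q n) ((1 / 2) ^ n) := fun n => rfl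
  have hq : ∀ n, q n ∈ 𝒩.kernel {P | ∃ P₁ ∈ O₁, ∃ P₂ ∈ O₂, P = prodFam P₁ P₂} := by
    intro n
    induction n with
    | zero => exact hX
    | succ n ih => rw [qS]; exact hZ _ ih _ (hpos n)
  have hqn : ∀ n, ‖q n‖ ≤ (‖X‖ + 2) * (1 / 2) ^ n := by
    intro n
    cases n with
    | zero => rw [q0]; simp
    | succ n =>
      rw [qS]
      refine (n3 _ (hq n) _ (hpos n)).trans ?_
      rw [pow_succ]
      have := hpos n
      nlinarith [norm_nonneg X]
  have hb : ∀ n, C * (‖q n‖ + (1 / 2) ^ n) ≤ (C * (‖X‖ + 3)) * (1 / 2) ^ n := by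
    intro n
    calc _ ≤ C * ((‖X‖ + 2) * (1 / 2) ^ n + (1 / 2) ^ n) :=
          mul_le_mul_of_nonneg_left (by linarith [hqn n]) hC
      _ = _ := by ring
  have hg : Summable fun n : ℕ => (C * (‖X‖ + 3)) * ((1 : ℝ) / 2) ^ n :=
    (summable_geometric_of_lt_one (by norm_num) (by norm_num)).mul_left _
  have s1 : Summable fun n => Y₁ (q n) ((1 / 2) ^ n) :=
    Summable.of_norm_bounded hg fun n => (n1 _ (hq n) _ (hpos n)).trans (hb n)
  have s2 : Summable fun n => Y₂ (q n) ((1 / 2) ^ n) :=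
    Summable.of_norm_bounded hg fun n => (n2 _ (hq n) _ (hpos n)).trans (hb n)
  have t1 := s1.hasSum.tendsto_sum_nat
  have t2 := s2.hasSum.tendsto_sum_nat
  have hfin : ∀ {O : Set (Set (H →L[ℂ] H))}, 𝒩.IsNet O → (0 : H →L[ℂ] H) ∈ 𝒩.kernel O →
      ∀ f : ℕ → H →L[ℂ] H, (∀ n, f n ∈ 𝒩.kernel O) → ∀ n, ∑ i ∈ Finset.range n, f i ∈ 𝒩.kernel O := by
    intro O hO hz f hf n
    induction n with
    | zero => simpa using hz
    | succ n ih => rw [Finset.sum_range_succ]; exact kernel_add hO ih (hf n)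
  refine ⟨_, c₁.mem_of_tendsto t1 (Eventually.of_forall
      (hfin h₁.1 z₁ _ fun n => hY₁ _ (hq n) _ (hpos n))),
    _, c₂.mem_of_tendsto t2 (Eventually.of_forall
      (hfin h₂.1 z₂ _ fun n => hY₂ _ (hq n) _ (hpos n))), ?_⟩
  have hpart : ∀ n, ∑ i ∈ Finset.range n, Y₁ (q i) ((1 / 2) ^ i) +
      ∑ i ∈ Finset.range n, Y₂ (q i) ((1 / 2) ^ i) = X - q n := by
    intro n
    induction n with
    | zero => simp [q0]
    | succ n ih =>
      have := hs _ (hq n) _ (hpos n)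
      rw [← qS] at this
      rw [Finset.sum_range_succ, Finset.sum_range_succ, add_add_add_comm, ih]
      conv_lhs => lhs; rw [this]
      abel
  have hq0 : Tendsto q atTop (𝓝 0) := by
    refine squeeze_zero_norm hqn ?_
    have := (tendsto_pow_atTop_nhds_zero_of_lt_one (r := (1 : ℝ) / 2) (by norm_num)
      (by norm_num)).const_mul (‖X‖ + 2)
    simpa using this
  have t3 : Tendsto (fun n => X - q n) atTop (𝓝 X) := by
    simpa using (tendsto_const_nhds (x := X)).sub hq0
  have t4 := t1.add t2
  simp only [hpart] at t4
  exact tendsto_nhds_unique t3 t4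

end ContinuousNest

theorem stmt3 {H : Type*} [NormedAddCommGroup H] [InnerProductSpace ℂ H] [CompleteSpace H]
    [TopologicalSpace.SeparableSpace H] (hH : ¬FiniteDimensional ℂ H)
    (𝒩 : ContinuousNest H) (O₁ O₂ : Set (Set (H →L[ℂ] H))) (I₁ I₂ : Set (H →L[ℂ] H))
    (h₁ : 𝒩.IsStableNet O₁) (h₂ : 𝒩.IsStableNet O₂)
    (hI₁ : 𝒩.IsStableIdeal I₁) (hI₂ : 𝒩.IsStableIdeal I₂)
    (hk₁ : I₁ = 𝒩.kernel O₁) (hk₂ : I₂ = 𝒩.kernel O₂) :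
    𝒩.IsStableNet {P | ∃ P₁ ∈ O₁, ∃ P₂ ∈ O₂, P = prodFam P₁ P₂} ∧
    {Z | ∃ X ∈ I₁, ∃ Y ∈ I₂, Z = X + Y} =
      𝒩.kernel {P | ∃ P₁ ∈ O₁, ∃ P₂ ∈ O₂, P = prodFam P₁ P₂} := by
  subst hk₁ hk₂
  have hst := ContinuousNest.prod_stableNet h₁ h₂
  refine ⟨hst, Set.Subset.antisymm ?_ ?_⟩
  · rintro Z ⟨X, hX, Y, hY, rfl⟩
    obtain ⟨P₁, hP₁, -⟩ := hX.2 1 one_pos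
    obtain ⟨P₂, hP₂, -⟩ := hY.2 1 one_pos
    exact ContinuousNest.kernel_add hst.1
      (ContinuousNest.kernel_prod_left h₁.1 h₂.1 ⟨_, hP₂⟩ hX)
      (ContinuousNest.kernel_prod_right h₁.1 h₂.1 ⟨_, hP₁⟩ hY)
  · intro X hX
    exact ContinuousNest.kernel_split h₁ h₂ hI₁.2.1 hI₂.2.1 hI₁.1.2.1 hI₂.1.2.1 hX
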